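/- For every η with 4/9 < η ≤ 1/2 there exist positive constants c₁, c₂, c₃ and D₀ (possibly ineffective) such that for every squarefree integer D > D₀ with D ≡ 3 (mod 4), the number of pairs of integers (a, b) with c₁ D^η ≤ a ≤ c₂ D^η, |b| ≤ a, and b² ≡ −D (mod 4a) is at least c₃ · h(−D) / D^{1/2 − η}. In particular, there exist solutions to b² ≡ −D (mod 4a) with a of size comparable to D^η. -/

import Mathlib

/-- A reduced binary quadratic form `(a, b, c)` of discriminant `-D`:
`a > 0`, `b² - 4ac = -D`, `|b| ≤ a ≤ c`, and `b ≥ 0` whenever `|b| = a` or `a = c`. -/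
def IsReducedForm (D : ℕ) (f : ℤ × ℤ × ℤ) : Prop :=
  0 < f.1 ∧ f.2.1 ^ 2 - 4 * f.1 * f.2.2 = -(D : ℤ) ∧ |f.2.1| ≤ f.1 ∧ f.1 ≤ f.2.2 ∧
    ((|f.2.1| = f.1 ∨ f.1 = f.2.2) → 0 ≤ f.2.1)

/-- The class number `h(-D)`, the number of reduced forms of discriminant `-D`. -/
noncomputable def classNumber (D : ℕ) : ℕ := Nat.card {f : ℤ × ℤ × ℤ // IsReducedForm D f}



set_option linter.unusedSectionVars false
set_option linter.deprecated false

namespace HB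

section CubicSums
variable {F : Type*} [Field F] [Fintype F] [DecidableEq F]

/-- the cubic with coefficient vector `a` -/
def cub (a : Fin 4 → F) (y : F) : F := a 0 + a 1 * y + a 2 * y ^ 2 + a 3 * y ^ 3

lemma cub_vanish (hF : ringChar F ≠ 2) {y1 y2 y3 y4 : F} (h2 : y1 ≠ y2) (h3 : y1 ≠ y3)
    (h4 : y1 ≠ y4) :
    ∑ a : Fin 4 → F, quadraticChar F (cub a y1) * quadraticChar F (cub a y2) *
      quadraticChar F (cub a y3) * quadraticChar F (cub a y4) = 0 := by
  set G : (Fin 4 → F) → ℤ := fun a => quadraticChar F (cub a y1) * quadraticChar F (cub a y2) *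
      quadraticChar F (cub a y3) * quadraticChar F (cub a y4) with hG
  set l : Fin 4 → F := ![-(y2 * y3 * y4), y2 * y3 + y2 * y4 + y3 * y4, -(y2 + y3 + y4), 1] with hl
  have hc : (y1 - y2) * (y1 - y3) * (y1 - y4) ≠ 0 := by
    simp [sub_eq_zero, h2, h3, h4]
  have key : ∀ a, ∑ t : F, G (a + t • l) = 0 := by
    intro a
    have e : ∀ t : F, G (a + t • l) = (quadraticChar F (cub a y2) *
        quadraticChar F (cub a y3) * quadraticChar F (cub a y4)) *
        quadraticChar F (cub a y1 + t * ((y1 - y2) * (y1 - y3) * (y1 - y4))) := by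
      intro t
      have e1 : cub (a + t • l) y1 = cub a y1 + t * ((y1 - y2) * (y1 - y3) * (y1 - y4)) := by
        simp [cub, hl]; ring
      have e2 : cub (a + t • l) y2 = cub a y2 := by simp [cub, hl]; ring
      have e3 : cub (a + t • l) y3 = cub a y3 := by simp [cub, hl]; ring
      have e4 : cub (a + t • l) y4 = cub a y4 := by simp [cub, hl]; ring
      simp only [hG, e1, e2, e3, e4]; ring
    simp_rw [e, ← Finset.mul_sum]
    have : ∑ t : F, quadraticChar F (cub a y1 + t * ((y1 - y2) * (y1 - y3) * (y1 - y4))) = 0 := by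
      rw [← quadraticChar_sum_zero hF]
      exact Fintype.sum_equiv ((Equiv.mulRight₀ _ hc).trans (Equiv.addLeft (cub a y1))) _ _
        (fun t => by simp)
    rw [this, mul_zero]
  have h1 : ∑ a, ∑ t : F, G (a + t • l) = (Fintype.card F : ℤ) * ∑ a, G a := by
    rw [Finset.sum_comm]
    have : ∀ t : F, ∑ a, G (a + t • l) = ∑ a, G a := fun t =>
      Fintype.sum_equiv (Equiv.addRight (t • l)) _ _ (fun a => by simp)
    simp [this]
  have h0 : (Fintype.card F : ℤ) * ∑ a, G a = 0 := by
    rw [← h1]; exact Finset.sum_eq_zero fun a _ => key a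
  rcases mul_eq_zero.1 h0 with h | h
  · exact absurd h (by exact_mod_cast Fintype.card_ne_zero)
  · exact h

lemma qc_le_one (x : F) : |quadraticChar F x| ≤ 1 := by
  rcases eq_or_ne x 0 with h | h
  · simp [h]
  · rcases quadraticChar_dichotomy h with h | h <;> simp [h]

lemma cub_term_le (hF : ringChar F ≠ 2) (y1 y2 y3 y4 : F) :
    ∑ a : Fin 4 → F, quadraticChar F (cub a y1) * quadraticChar F (cub a y2) *
      quadraticChar F (cub a y3) * quadraticChar F (cub a y4) ≤
      (Fintype.card F : ℤ) ^ 4 * ((if y1 = y2 ∧ y3 = y4 then 1 else 0) +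
        (if y1 = y3 ∧ y2 = y4 then 1 else 0) + (if y1 = y4 ∧ y2 = y3 then 1 else 0)) := by
  have triv : ∑ a : Fin 4 → F, quadraticChar F (cub a y1) * quadraticChar F (cub a y2) *
      quadraticChar F (cub a y3) * quadraticChar F (cub a y4) ≤ (Fintype.card F : ℤ) ^ 4 := by
    calc _ ≤ ∑ a : Fin 4 → F, (1 : ℤ) := by
          refine Finset.sum_le_sum fun a _ => ?_
          refine (le_abs_self _).trans ?_
          rw [abs_mul, abs_mul, abs_mul]
          have := qc_le_one (cub a y1)
          have := qc_le_one (cub a y2)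
          have := qc_le_one (cub a y3)
          have := qc_le_one (cub a y4)
          exact mul_le_one₀ (mul_le_one₀ (mul_le_one₀ ‹_› (abs_nonneg _) ‹_›) (abs_nonneg _) ‹_›)
            (abs_nonneg _) ‹_›
      _ = _ := by simp
  by_cases hp : (y1 = y2 ∧ y3 = y4) ∨ (y1 = y3 ∧ y2 = y4) ∨ (y1 = y4 ∧ y2 = y3)
  · refine triv.trans ?_
    refine le_mul_of_one_le_right (by positivity) ?_
    rcases hp with h | h | h
    · rw [if_pos h]; split_ifs <;> norm_num
    · rw [if_pos h]; split_ifs <;> norm_num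
    · rw [if_pos h]; split_ifs <;> norm_num
  · have : ∑ a : Fin 4 → F, quadraticChar F (cub a y1) * quadraticChar F (cub a y2) *
      quadraticChar F (cub a y3) * quadraticChar F (cub a y4) = 0 := by
      have hs : (y1 ≠ y2 ∧ y1 ≠ y3 ∧ y1 ≠ y4) ∨ (y2 ≠ y1 ∧ y2 ≠ y3 ∧ y2 ≠ y4) ∨
        (y3 ≠ y1 ∧ y3 ≠ y2 ∧ y3 ≠ y4) ∨ (y4 ≠ y1 ∧ y4 ≠ y2 ∧ y4 ≠ y3) := by grind
      rcases hs with ⟨h1, h2, h3⟩ | ⟨h1, h2, h3⟩ | ⟨h1, h2, h3⟩ | ⟨h1, h2, h3⟩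
      · exact cub_vanish hF h1 h2 h3
      · rw [← cub_vanish hF h1 h2 h3]; exact Finset.sum_congr rfl fun a _ => by ring
      · rw [← cub_vanish hF h1 h2 h3]; exact Finset.sum_congr rfl fun a _ => by ring
      · rw [← cub_vanish hF h1 h2 h3]; exact Finset.sum_congr rfl fun a _ => by ring
    rw [this]
    positivity

lemma sum_pow_four {ι : Type*} (s : Finset ι) (f : ι → ℤ) :
    (∑ i ∈ s, f i) ^ 4 = ∑ i ∈ s, ∑ j ∈ s, ∑ k ∈ s, ∑ l ∈ s, f i * f j * f k * f l := by
  have : (∑ i ∈ s, f i) ^ 4 = (∑ i ∈ s, f i) * (∑ i ∈ s, f i) * (∑ i ∈ s, f i) *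
    (∑ i ∈ s, f i) := by ring
  rw [this]
  simp only [Finset.sum_mul, Finset.mul_sum]
  refine Finset.sum_congr rfl fun i _ => Finset.sum_congr rfl fun j _ =>
    Finset.sum_congr rfl fun k _ => Finset.sum_congr rfl fun l _ => by ring

lemma cub_moment (hF : ringChar F ≠ 2) :
    ∑ a : Fin 4 → F, (∑ y : F, quadraticChar F (cub a y)) ^ 4 ≤ 3 * (Fintype.card F : ℤ) ^ 6 := by
  simp_rw [sum_pow_four]
  rw [Finset.sum_comm]
  have e1 : ∀ i : F, (∑ a : Fin 4 → F, ∑ j, ∑ k, ∑ l, quadraticChar F (cub a i) *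
      quadraticChar F (cub a j) * quadraticChar F (cub a k) * quadraticChar F (cub a l)) =
      ∑ j, ∑ k, ∑ l, ∑ a : Fin 4 → F, quadraticChar F (cub a i) *
      quadraticChar F (cub a j) * quadraticChar F (cub a k) * quadraticChar F (cub a l) := by
    intro i
    rw [Finset.sum_comm]
    refine Finset.sum_congr rfl fun j _ => ?_
    rw [Finset.sum_comm]
    refine Finset.sum_congr rfl fun k _ => ?_
    rw [Finset.sum_comm]
  simp_rw [e1]
  calc _ ≤ ∑ i : F, ∑ j : F, ∑ k : F, ∑ l : F, (Fintype.card F : ℤ) ^ 4 *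
        ((if i = j ∧ k = l then 1 else 0) +
        (if i = k ∧ j = l then 1 else 0) + (if i = l ∧ j = k then 1 else 0)) := by
        gcongr with i _ j _ k _ l _
        exact cub_term_le hF i j k l
    _ = 3 * (Fintype.card F : ℤ) ^ 6 := by
        simp_rw [← Finset.mul_sum, Finset.sum_add_distrib, ite_and]
        simp
        ring

/-- the product of three linear factors -/
def g3 (c1 c2 c3 y : F) : F := (1 + c1 * y) * (1 + c2 * y) * (1 + c3 * y)

lemma g3_zero {c1 c2 c3 y : F} (h1 : c1 ≠ 0) (h2 : c2 ≠ 0) (h3 : c3 ≠ 0) :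
    g3 c1 c2 c3 y = 0 ↔ y = -c1⁻¹ ∨ y = -c2⁻¹ ∨ y = -c3⁻¹ := by
  have aux : ∀ c : F, c ≠ 0 → (1 + c * y = 0 ↔ y = -c⁻¹) := by
    intro c hc
    constructor
    · intro h; field_simp; linear_combination h
    · rintro rfl; field_simp; ring
  simp only [g3, mul_eq_zero, aux _ h1, aux _ h2, aux _ h3, or_assoc]

/-- coefficient vector of `lam * g3 (u y + v)` -/
def coefs (c1 c2 c3 : F) (t : F × F × F) : Fin 4 → F :=
  ![t.1 * ((1 + c1 * t.2.2) * (1 + c2 * t.2.2) * (1 + c3 * t.2.2)),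
    t.1 * (c1 * t.2.1 * (1 + c2 * t.2.2) * (1 + c3 * t.2.2) +
      c2 * t.2.1 * (1 + c1 * t.2.2) * (1 + c3 * t.2.2) +
      c3 * t.2.1 * (1 + c1 * t.2.2) * (1 + c2 * t.2.2)),
    t.1 * (c1 * t.2.1 * (c2 * t.2.1) * (1 + c3 * t.2.2) +
      c1 * t.2.1 * (c3 * t.2.1) * (1 + c2 * t.2.2) +
      c2 * t.2.1 * (c3 * t.2.1) * (1 + c1 * t.2.2)),
    t.1 * (c1 * t.2.1 * (c2 * t.2.1) * (c3 * t.2.1))]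

lemma cub_coefs (c1 c2 c3 : F) (t : F × F × F) (y : F) :
    cub (coefs c1 c2 c3 t) y = t.1 * g3 c1 c2 c3 (t.2.1 * y + t.2.2) := by
  simp [cub, coefs, g3]; ring

lemma g3_bound (hF : ringChar F ≠ 2) {c1 c2 c3 : F} (h1 : c1 ≠ 0) (h2 : c2 ≠ 0) (h3 : c3 ≠ 0)
    (h12 : c1 ≠ c2) :
    ((Fintype.card F : ℤ) - 1) ^ 2 * (Fintype.card F : ℤ) *
      (∑ y : F, quadraticChar F (g3 c1 c2 c3 y)) ^ 4 ≤ 27 * (Fintype.card F : ℤ) ^ 6 := by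
  set S := ∑ y : F, quadraticChar F (g3 c1 c2 c3 y) with hS
  set s : Finset (F × F × F) := (Finset.univ.erase 0) ×ˢ ((Finset.univ.erase 0) ×ˢ Finset.univ)
    with hs
  have hsc : (s.card : ℤ) = ((Fintype.card F : ℤ) - 1) ^ 2 * (Fintype.card F : ℤ) := by
    have : 1 ≤ Fintype.card F := Fintype.card_pos
    rw [hs, Finset.card_product, Finset.card_product, Finset.card_erase_of_mem (Finset.mem_univ _),
      Finset.card_univ]
    push_cast [Nat.cast_sub this]; ring
  have hmem : ∀ t ∈ s, t.1 ≠ 0 ∧ t.2.1 ≠ 0 := by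
    intro t ht
    simpa [hs] using ht
  have hsum : ∀ t ∈ s, (∑ y : F, quadraticChar F (cub (coefs c1 c2 c3 t) y)) ^ 4 = S ^ 4 := by
    intro t ht
    obtain ⟨ht1, ht2⟩ := hmem t ht
    simp_rw [cub_coefs, map_mul, ← Finset.mul_sum]
    have : ∑ y : F, quadraticChar F (g3 c1 c2 c3 (t.2.1 * y + t.2.2)) = S :=
      Fintype.sum_equiv ((Equiv.mulLeft₀ _ ht2).trans (Equiv.addRight t.2.2)) _ _
        (fun y => by simp)
    rw [this, mul_pow]
    rcases quadraticChar_dichotomy ht1 with h | h <;> simp [h]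
  have hfib : s.card ≤ 9 * (s.image (coefs c1 c2 c3)).card := by
    refine Finset.card_le_mul_card_image s 9 ?_
    intro a ha
    obtain ⟨t0, ht0, rfl⟩ := Finset.mem_image.1 ha
    obtain ⟨ht1, ht2⟩ := hmem t0 ht0
    set Z : Finset F := {(-c1⁻¹ - t0.2.2) / t0.2.1, (-c2⁻¹ - t0.2.2) / t0.2.1,
      (-c3⁻¹ - t0.2.2) / t0.2.1} with hZ
    have hZc : Z.card ≤ 3 := Finset.card_le_three
    have hz0 : ∀ y, cub (coefs c1 c2 c3 t0) y = 0 → y ∈ Z := by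
      intro y hy
      rw [cub_coefs, mul_eq_zero, or_iff_right ht1, g3_zero h1 h2 h3] at hy
      simp only [hZ, Finset.mem_insert, Finset.mem_singleton]
      rcases hy with h | h | h
      · left; rw [eq_div_iff ht2]; linear_combination h
      · right; left; rw [eq_div_iff ht2]; linear_combination h
      · right; right; rw [eq_div_iff ht2]; linear_combination h
    calc _ ≤ (Z ×ˢ Z).card := by
          refine Finset.card_le_card_of_injOn
            (fun t => ((-c1⁻¹ - t.2.2) / t.2.1, (-c2⁻¹ - t.2.2) / t.2.1)) ?_ ?_
          · intro t ht
            simp only [Finset.coe_filter, Set.mem_setOf_eq] at ht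
            obtain ⟨hts, hte⟩ := ht
            obtain ⟨ht1', ht2'⟩ := hmem t hts
            simp only [Finset.coe_product, Set.mem_prod, Finset.mem_coe]
            constructor
            · apply hz0
              rw [← hte, cub_coefs, mul_div_cancel₀ _ ht2']
              rw [(g3_zero h1 h2 h3).2 (by left; ring), mul_zero]
            · apply hz0
              rw [← hte, cub_coefs, mul_div_cancel₀ _ ht2']
              rw [(g3_zero h1 h2 h3).2 (by right; left; ring), mul_zero]
          · intro t ht t' ht' he
            simp only [Finset.coe_filter, Set.mem_setOf_eq] at ht ht'
            obtain ⟨hts, hte⟩ := ht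
            obtain ⟨hts', hte'⟩ := ht'
            obtain ⟨hu1, hu2⟩ := hmem t hts
            obtain ⟨hv1, hv2⟩ := hmem t' hts'
            simp only [Prod.mk.injEq] at he
            obtain ⟨e1, e2⟩ := he
            rw [div_eq_div_iff hu2 hv2] at e1 e2
            have hne : c2⁻¹ - c1⁻¹ ≠ 0 := by
              intro h; apply h12
              exact (inv_injective (sub_eq_zero.1 h)).symm
            have hu : t'.2.1 = t.2.1 := by
              apply mul_left_cancel₀ hne
              linear_combination e1 - e2
            rw [hu] at e1
            have hv : t.2.2 = t'.2.2 := by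
              apply mul_right_cancel₀ hu2
              linear_combination -e1
            have hl : t.1 * (c1 * t.2.1 * (c2 * t.2.1) * (c3 * t.2.1)) =
                t'.1 * (c1 * t'.2.1 * (c2 * t'.2.1) * (c3 * t'.2.1)) := by
              have := congrFun (hte.trans hte'.symm) 3
              simpa [coefs] using this
            rw [hu] at hl
            have hl' := mul_right_cancel₀ (by simp [h1, h2, h3, hu2]) hl
            exact Prod.ext hl' (Prod.ext hu.symm hv)
      _ ≤ 9 := by
          rw [Finset.card_product]; nlinarith
  have himg : ((s.image (coefs c1 c2 c3)).card : ℤ) * S ^ 4 ≤ 3 * (Fintype.card F : ℤ) ^ 6 := by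
    calc _ = ∑ a ∈ s.image (coefs c1 c2 c3), S ^ 4 := by simp
      _ = ∑ a ∈ s.image (coefs c1 c2 c3), (∑ y : F, quadraticChar F (cub a y)) ^ 4 := by
          refine Finset.sum_congr rfl fun a ha => ?_
          obtain ⟨t, ht, rfl⟩ := Finset.mem_image.1 ha
          exact (hsum t ht).symm
      _ ≤ ∑ a : Fin 4 → F, (∑ y : F, quadraticChar F (cub a y)) ^ 4 :=
          Finset.sum_le_sum_of_subset_of_nonneg (Finset.subset_univ _)
            (fun a _ _ => by positivity)
      _ ≤ _ := cub_moment hF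
  rw [← hsc]
  have hfib' : (s.card : ℤ) ≤ 9 * (s.image (coefs c1 c2 c3)).card := by exact_mod_cast hfib
  have hS4 : 0 ≤ S ^ 4 := by positivity
  nlinarith [mul_le_mul_of_nonneg_right hfib' hS4]

lemma quart_inv {c1 c2 c3 : F} :
    ∑ x : F, quadraticChar F (x * (x + c1) * (x + c2) * (x + c3)) =
      ∑ y : F, quadraticChar F (g3 c1 c2 c3 y) - 1 := by
  have e : ∀ x : F, quadraticChar F (x * (x + c1) * (x + c2) * (x + c3)) =
      quadraticChar F (g3 c1 c2 c3 x⁻¹) - if x = 0 then 1 else 0 := by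
    intro x
    rcases eq_or_ne x 0 with rfl | hx
    · simp [g3]
    · have : x * (x + c1) * (x + c2) * (x + c3) = x ^ 2 * x ^ 2 * g3 c1 c2 c3 x⁻¹ := by
        simp only [g3]; field_simp
      rw [this, map_mul, map_mul, quadraticChar_sq_one' hx]; simp [hx]
  simp_rw [e, Finset.sum_sub_distrib]
  congr 1
  · exact Fintype.sum_equiv ((inv_involutive (G := F)).toPerm) _ _ (fun y => by simp)
  · simp

lemma quad_sum (hF : ringChar F ≠ 2) {d e : F} (hde : d ≠ e) :
    ∑ x : F, quadraticChar F ((x + d) * (x + e)) = -1 := by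
  have h0 : ∑ x : F, quadraticChar F ((x + d) * (x + e)) =
      ∑ x : F, quadraticChar F (x * (x + (e - d))) :=
    Fintype.sum_equiv (Equiv.addRight d) _ _ (fun y => by simp)
  have hk : e - d ≠ 0 := sub_ne_zero.2 hde.symm
  set k := e - d
  have e1 : ∀ x : F, quadraticChar F (x * (x + k)) =
      quadraticChar F (1 + k * x⁻¹) - if x = 0 then 1 else 0 := by
    intro x
    rcases eq_or_ne x 0 with rfl | hx
    · simp
    · have : x * (x + k) = x ^ 2 * (1 + k * x⁻¹) := by
        field_simp
      rw [this, map_mul, quadraticChar_sq_one' hx]; simp [hx]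
  rw [h0]
  simp_rw [e1, Finset.sum_sub_distrib]
  have : ∑ x : F, quadraticChar F (1 + k * x⁻¹) = 0 := by
    rw [← quadraticChar_sum_zero hF]
    exact Fintype.sum_equiv ((((inv_involutive (G := F)).toPerm).trans (Equiv.mulLeft₀ k hk)).trans (Equiv.addLeft 1))
      _ _ (fun y => by simp)
  rw [this]; simp

lemma quart_deg (hF : ringChar F ≠ 2) {c d e : F} (hde : d ≠ e) :
    |∑ x : F, quadraticChar F ((x + c) ^ 2 * ((x + d) * (x + e)))| ≤ 2 := by
  have e1 : ∀ x : F, quadraticChar F ((x + c) ^ 2 * ((x + d) * (x + e))) =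
      quadraticChar F ((x + d) * (x + e)) -
        if x = -c then quadraticChar F ((-c + d) * (-c + e)) else 0 := by
    intro x
    rcases eq_or_ne x (-c) with rfl | hx
    · simp
    · have : x + c ≠ 0 := fun h => hx (eq_neg_of_add_eq_zero_left h)
      rw [map_mul, quadraticChar_sq_one' this]; simp [hx]
  simp_rw [e1, Finset.sum_sub_distrib, quad_sum hF hde]
  simp only [Finset.sum_ite_eq', Finset.mem_univ, if_true]
  have := abs_le.1 (qc_le_one ((-c + d) * (-c + e)))
  rw [abs_le]; constructor <;> linarith [this.1, this.2]

/-- weak (exponent 3/4) bound for unpaired quartic character sums -/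
lemma quart_bound (hF : ringChar F ≠ 2) (b1 b2 b3 b4 : F)
    (hp : ¬ ((b1 = b2 ∧ b3 = b4) ∨ (b1 = b3 ∧ b2 = b4) ∨ (b1 = b4 ∧ b2 = b3))) :
    (∑ x : F, quadraticChar F ((x + b1) * (x + b2) * (x + b3) * (x + b4))) ^ 4 ≤
      512 * (Fintype.card F : ℤ) ^ 3 := by
  have hq : 3 ≤ Fintype.card F := by
    have h1 : 1 < Fintype.card F := Fintype.one_lt_card
    have h2 : Fintype.card F ≠ 2 := by
      intro h
      apply hF
      have := FiniteField.even_card_iff_char_two (F := F)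
      rw [this, h]
    omega
  set q : ℤ := (Fintype.card F : ℤ) with hqd
  have hq3 : (3 : ℤ) ≤ q := by rw [hqd]; exact_mod_cast hq
  have small : ∀ T : ℤ, |T| ≤ 2 → T ^ 4 ≤ 512 * q ^ 3 := by
    intro T hT
    have h4 : T ^ 4 ≤ 16 := by
      rw [← (show Even 4 by decide).pow_abs]
      calc |T| ^ 4 ≤ 2 ^ 4 := by gcongr
        _ = 16 := by norm_num
    have : (1 : ℤ) ≤ q ^ 3 := one_le_pow₀ (by linarith)
    linarith
  have degen : ∀ c d e : F, d ≠ e → (∀ x, (x + b1) * (x + b2) * (x + b3) * (x + b4) =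
      (x + c) ^ 2 * ((x + d) * (x + e))) →
      (∑ x : F, quadraticChar F ((x + b1) * (x + b2) * (x + b3) * (x + b4))) ^ 4 ≤
      512 * q ^ 3 := by
    intro c d e hde h
    simp_rw [h]
    exact small _ (quart_deg hF hde)
  by_cases h12 : b1 = b2
  · exact degen b1 b3 b4 (fun h => hp (by tauto)) (fun x => by rw [← h12]; ring)
  by_cases h13 : b1 = b3
  · exact degen b1 b2 b4 (fun h => hp (by tauto)) (fun x => by rw [← h13]; ring)
  by_cases h14 : b1 = b4
  · exact degen b1 b2 b3 (fun h => hp (by tauto)) (fun x => by rw [← h14]; ring)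
  by_cases h23 : b2 = b3
  · exact degen b2 b1 b4 (fun h => hp (by tauto)) (fun x => by rw [← h23]; ring)
  by_cases h24 : b2 = b4
  · exact degen b2 b1 b3 (fun h => hp (by tauto)) (fun x => by rw [← h24]; ring)
  have h0 : ∑ x : F, quadraticChar F ((x + b1) * (x + b2) * (x + b3) * (x + b4)) =
      ∑ x : F, quadraticChar F (x * (x + (b2 - b1)) * (x + (b3 - b1)) * (x + (b4 - b1))) :=
    Fintype.sum_equiv (Equiv.addRight b1) _ _ (fun y => by simp)
  rw [h0, quart_inv]
  have hb := g3_bound hF (c1 := b2 - b1) (c2 := b3 - b1) (c3 := b4 - b1)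
    (sub_ne_zero.2 (Ne.symm h12)) (sub_ne_zero.2 (Ne.symm h13)) (sub_ne_zero.2 (Ne.symm h14))
    (fun h => h23 (sub_left_injective h))
  rw [← hqd] at hb
  set S := ∑ y : F, quadraticChar F (g3 (b2 - b1) (b3 - b1) (b4 - b1) y)
  have hS4 : 0 ≤ S ^ 4 := by positivity
  have h1 : 4 * q ^ 2 ≤ 9 * (q - 1) ^ 2 := by nlinarith
  have h2 : 4 * q ^ 3 * S ^ 4 ≤ q ^ 3 * (243 * q ^ 3) := by
    have : 4 * q ^ 2 * (q * S ^ 4) ≤ 9 * (q - 1) ^ 2 * (q * S ^ 4) :=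
      mul_le_mul_of_nonneg_right h1 (by positivity)
    nlinarith
  have h3 : 4 * S ^ 4 ≤ 243 * q ^ 3 := by
    have : 0 < q ^ 3 := by positivity
    nlinarith
  have h4 : (S - 1) ^ 4 ≤ 8 * (S ^ 4 + 1) := by
    nlinarith [sq_nonneg (S + 1), sq_nonneg ((S + 1) ^ 2), sq_nonneg (S ^ 2 - 1),
      sq_nonneg (S * (S + 1)), sq_nonneg (S ^ 2 + S)]
  have h5 : (27 : ℤ) ≤ q ^ 3 := by
    calc (27 : ℤ) = 3 ^ 3 := by norm_num
      _ ≤ q ^ 3 := by gcongr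
  linarith

end CubicSums

end HB



set_option linter.unusedSectionVars false
set_option linter.deprecated false

namespace HB

lemma sum_range_mul_coprime {m n : ℕ} (hm : 0 < m) (hn : 0 < n) (h : m.Coprime n) (f : ℤ → ℤ)
    (hf : ∀ (k : ℕ) (x y : ℤ), x ≡ y [ZMOD k] → f x ≡ f y [ZMOD k]) :
    ∑ x ∈ Finset.range (m * n), jacobiSym (f x) (m * n) =
      (∑ x ∈ Finset.range m, jacobiSym (f x) m) * ∑ x ∈ Finset.range n, jacobiSym (f x) n := by
  have : NeZero m := ⟨hm.ne'⟩
  have : NeZero n := ⟨hn.ne'⟩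
  rw [Finset.sum_mul_sum, ← Finset.sum_product']
  refine Finset.sum_nbij (fun x => (x % m, x % n)) ?_ ?_ ?_ ?_
  · intro x _
    simp [Nat.mod_lt _ hm, Nat.mod_lt _ hn]
  · intro x hx y hy hxy
    simp only [Finset.coe_range, Set.mem_Iio] at hx hy
    simp only [Prod.mk.injEq] at hxy
    have := (Nat.modEq_and_modEq_iff_modEq_mul h).1 ⟨hxy.1, hxy.2⟩
    exact Nat.ModEq.eq_of_lt_of_lt this hx hy
  · intro ⟨a, b⟩ hab
    simp only [Finset.coe_product, Finset.coe_range, Set.mem_prod, Set.mem_Iio] at hab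
    obtain ⟨k, hk1, hk2⟩ := Nat.chineseRemainder h a b
    have hm' : m ∣ m * n := dvd_mul_right _ _
    have hn' : n ∣ m * n := dvd_mul_left _ _
    refine ⟨k % (m * n), by simp [Nat.mod_lt _ (Nat.mul_pos hm hn)], ?_⟩
    simp only [Prod.mk.injEq]
    rw [Nat.mod_mod_of_dvd _ hm', Nat.mod_mod_of_dvd _ hn']
    exact ⟨Eq.trans hk1 (Nat.mod_eq_of_lt hab.1), Eq.trans hk2 (Nat.mod_eq_of_lt hab.2)⟩
  · intro x _
    rw [jacobiSym.mul_right]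
    congr 1
    · apply jacobiSym.mod_left'
      apply hf
      push_cast
      exact (Int.mod_modEq _ _).symm
    · apply jacobiSym.mod_left'
      apply hf
      push_cast
      exact (Int.mod_modEq _ _).symm

lemma sum_range_prod (f : ℤ → ℤ)
    (hf : ∀ (k : ℕ) (x y : ℤ), x ≡ y [ZMOD k] → f x ≡ f y [ZMOD k]) (D : ℕ) :
    Squarefree D →
    ∑ x ∈ Finset.range D, jacobiSym (f x) D =
      ∏ p ∈ D.primeFactors, ∑ x ∈ Finset.range p, jacobiSym (f x) p := by
  induction D using Nat.recOnPosPrimePosCoprime with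
  | prime_pow p n hp hn =>
    intro hsq
    have : n = 1 := by
      by_contra hne
      have := (Nat.squarefree_pow_iff hp.ne_one (by omega)).1 hsq
      exact hne this.2
    subst this
    simp [hp.primeFactors]
  | zero => intro h; exact absurd h not_squarefree_zero
  | one => intro _; simp
  | coprime a b ha hb hab iha ihb =>
    intro hsq
    rw [sum_range_mul_coprime (by omega) (by omega) hab f hf, iha (hsq.squarefree_of_dvd (dvd_mul_right _ _)),
      ihb (hsq.squarefree_of_dvd (dvd_mul_left _ _)), hab.primeFactors_mul,
      Finset.prod_union hab.disjoint_primeFactors]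

/-- quartic polynomial -/
def q4 (b1 b2 b3 b4 x : ℤ) : ℤ := (x + b1) * (x + b2) * (x + b3) * (x + b4)

lemma q4_modEq (b1 b2 b3 b4 : ℤ) (k : ℕ) (x y : ℤ) (h : x ≡ y [ZMOD k]) :
    q4 b1 b2 b3 b4 x ≡ q4 b1 b2 b3 b4 y [ZMOD k] := by
  unfold q4
  exact (((h.add_right _).mul (h.add_right _)).mul (h.add_right _)).mul (h.add_right _)

/-- paired modulo n -/
def pairedMod (b1 b2 b3 b4 : ℤ) (n : ℤ) : Prop :=
  (n ∣ b1 - b2 ∧ n ∣ b3 - b4) ∨ (n ∣ b1 - b3 ∧ n ∣ b2 - b4) ∨ (n ∣ b1 - b4 ∧ n ∣ b2 - b3)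

lemma sum_range_prime (p : ℕ) [Fact p.Prime] (b1 b2 b3 b4 : ℤ) :
    ∑ x ∈ Finset.range p, jacobiSym (q4 b1 b2 b3 b4 x) p =
      ∑ x : ZMod p, quadraticChar (ZMod p) ((x + b1) * (x + b2) * (x + b3) * (x + b4)) := by
  refine Finset.sum_nbij' (fun x => (x : ZMod p)) (fun x => x.val) ?_ ?_ ?_ ?_ ?_
  · intro x _; exact Finset.mem_univ _
  · intro x _; exact Finset.mem_range.2 (ZMod.val_lt x)
  · intro x hx; exact ZMod.val_cast_of_lt (Finset.mem_range.1 hx)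
  · intro x _; exact ZMod.natCast_zmod_val x
  · intro x _
    rw [← jacobiSym.legendreSym.to_jacobiSym, legendreSym]
    simp [q4]

open Classical in
lemma prime_bound (p : ℕ) (hp : p.Prime) (hp2 : p ≠ 2) (b1 b2 b3 b4 : ℤ) :
    (∑ x ∈ Finset.range p, jacobiSym (q4 b1 b2 b3 b4 x) p) ^ 4 ≤
      512 * (p : ℤ) ^ 3 * (if pairedMod b1 b2 b3 b4 p then (p : ℤ) else 1) := by
  have := Fact.mk hp
  split_ifs with h
  · have h1 : |∑ x ∈ Finset.range p, jacobiSym (q4 b1 b2 b3 b4 x) p| ≤ p := by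
      refine (Finset.abs_sum_le_sum_abs _ _).trans ?_
      calc _ ≤ ∑ x ∈ Finset.range p, (1 : ℤ) := by
            refine Finset.sum_le_sum fun x _ => ?_
            rcases jacobiSym.trichotomy (q4 b1 b2 b3 b4 x) p with h | h | h <;> simp [h]
        _ = _ := by simp
    rw [← (show Even 4 by decide).pow_abs]
    calc _ ≤ (p : ℤ) ^ 4 := by gcongr
      _ ≤ _ := by
        have : (0 : ℤ) ≤ (p : ℤ) ^ 4 := by positivity
        linarith
  · rw [sum_range_prime, mul_one]
    have := quart_bound (F := ZMod p) (by rwa [ZMod.ringChar_zmod_n]) (b1 : ZMod p) b2 b3 b4 ?_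
    · rwa [ZMod.card] at this
    · intro h'
      apply h
      have key : ∀ a b : ℤ, ((a : ZMod p) = b) → (p : ℤ) ∣ a - b := by
        intro a b hab
        rw [← ZMod.intCast_zmod_eq_zero_iff_dvd]
        push_cast
        rw [hab, sub_self]
      unfold pairedMod
      rcases h' with ⟨h1, h2⟩ | ⟨h1, h2⟩ | ⟨h1, h2⟩
      · exact Or.inl ⟨key _ _ h1, key _ _ h2⟩
      · exact Or.inr (Or.inl ⟨key _ _ h1, key _ _ h2⟩)
      · exact Or.inr (Or.inr ⟨key _ _ h1, key _ _ h2⟩)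

lemma prod_primes_le {G : ℕ} (hG : G ≠ 0) (s : Finset ℕ) (hs : ∀ p ∈ s, p.Prime ∧ p ∣ G) :
    ∏ p ∈ s, p ≤ G := by
  refine Nat.le_of_dvd (Nat.pos_of_ne_zero hG) ?_
  exact Finset.prod_primes_dvd G (fun p hp => (hs p hp).1.prime) (fun p hp => (hs p hp).2)

open Classical in
lemma comp_bound {D : ℕ} (hD : Squarefree D) (hodd : D % 2 = 1) (b1 b2 b3 b4 : ℤ)
    (hp : ¬ ((b1 = b2 ∧ b3 = b4) ∨ (b1 = b3 ∧ b2 = b4) ∨ (b1 = b4 ∧ b2 = b3))) :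
    (∑ x ∈ Finset.range D, jacobiSym (q4 b1 b2 b3 b4 x) D) ^ 4 ≤
      512 ^ D.primeFactors.card * (D : ℤ) ^ 3 * (Int.gcd (b1 - b2) (b3 - b4) *
        Int.gcd (b1 - b3) (b2 - b4) * Int.gcd (b1 - b4) (b2 - b3)) := by
  rw [sum_range_prod _ (fun k x y h => q4_modEq b1 b2 b3 b4 k x y h) D hD, ← Finset.prod_pow]
  have hprod : (∏ p ∈ D.primeFactors, (p : ℤ)) = D := by
    rw [← Nat.cast_prod, Nat.prod_primeFactors_of_squarefree hD]
  have g1 : Int.gcd (b1 - b2) (b3 - b4) ≠ 0 := by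
    rw [Ne, Int.gcd_eq_zero_iff, sub_eq_zero, sub_eq_zero]; tauto
  have g2 : Int.gcd (b1 - b3) (b2 - b4) ≠ 0 := by
    rw [Ne, Int.gcd_eq_zero_iff, sub_eq_zero, sub_eq_zero]; tauto
  have g3 : Int.gcd (b1 - b4) (b2 - b3) ≠ 0 := by
    rw [Ne, Int.gcd_eq_zero_iff, sub_eq_zero, sub_eq_zero]; tauto
  set G1 := Int.gcd (b1 - b2) (b3 - b4)
  set G2 := Int.gcd (b1 - b3) (b2 - b4)
  set G3 := Int.gcd (b1 - b4) (b2 - b3)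
  calc _ ≤ ∏ p ∈ D.primeFactors, (512 * (p : ℤ) ^ 3 *
        (if pairedMod b1 b2 b3 b4 p then (p : ℤ) else 1)) := by
        refine Finset.prod_le_prod (fun p _ => by positivity) fun p hpD => ?_
        refine prime_bound p (Nat.prime_of_mem_primeFactors hpD) ?_ b1 b2 b3 b4
        rintro rfl
        have := Nat.dvd_of_mem_primeFactors hpD
        omega
    _ = 512 ^ D.primeFactors.card * (D : ℤ) ^ 3 *
        ∏ p ∈ D.primeFactors, (if pairedMod b1 b2 b3 b4 p then (p : ℤ) else 1) := by
        rw [Finset.prod_mul_distrib, Finset.prod_mul_distrib, Finset.prod_pow, hprod]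
        simp
    _ ≤ _ := by
        refine mul_le_mul_of_nonneg_left ?_ (by positivity)
        have h2 : (∏ p ∈ D.primeFactors, (if pairedMod b1 b2 b3 b4 p then p else 1)) ≤
            G1 * G2 * G3 := by
          have l1 : ∏ p ∈ D.primeFactors with p ∣ G1, p ≤ G1 :=
            prod_primes_le g1 _ (fun p hp => by
              simp only [Finset.mem_filter] at hp
              exact ⟨Nat.prime_of_mem_primeFactors hp.1, hp.2⟩)
          have l2 : ∏ p ∈ D.primeFactors with p ∣ G2, p ≤ G2 :=
            prod_primes_le g2 _ (fun p hp => by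
              simp only [Finset.mem_filter] at hp
              exact ⟨Nat.prime_of_mem_primeFactors hp.1, hp.2⟩)
          have l3 : ∏ p ∈ D.primeFactors with p ∣ G3, p ≤ G3 :=
            prod_primes_le g3 _ (fun p hp => by
              simp only [Finset.mem_filter] at hp
              exact ⟨Nat.prime_of_mem_primeFactors hp.1, hp.2⟩)
          refine le_trans ?_ (Nat.mul_le_mul (Nat.mul_le_mul l1 l2) l3)
          rw [Finset.prod_filter, Finset.prod_filter, Finset.prod_filter,
            ← Finset.prod_mul_distrib, ← Finset.prod_mul_distrib]
          refine Finset.prod_le_prod (fun p _ => by positivity) fun p hpD => ?_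
          have hp1 : 1 ≤ p := (Nat.prime_of_mem_primeFactors hpD).one_le
          have o1 : 1 ≤ (if p ∣ G1 then p else 1) := by split_ifs <;> omega
          have o2 : 1 ≤ (if p ∣ G2 then p else 1) := by split_ifs <;> omega
          have o3 : 1 ≤ (if p ∣ G3 then p else 1) := by split_ifs <;> omega
          by_cases hpm : pairedMod b1 b2 b3 b4 p
          · rw [if_pos hpm]
            have dv : ∀ a b : ℤ, (p : ℤ) ∣ a → (p : ℤ) ∣ b → p ∣ Int.gcd a b := by
              intro a b ha hb
              exact Int.natCast_dvd_natCast.1 (Int.dvd_coe_gcd ha hb)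
            rcases hpm with ⟨h1, h2⟩ | ⟨h1, h2⟩ | ⟨h1, h2⟩
            · rw [if_pos (dv _ _ h1 h2)]
              calc p = p * 1 * 1 := by ring
                _ ≤ _ := Nat.mul_le_mul (Nat.mul_le_mul le_rfl o2) o3
            · rw [if_pos (dv _ _ h1 h2)]
              calc p = 1 * p * 1 := by ring
                _ ≤ _ := Nat.mul_le_mul (Nat.mul_le_mul o1 le_rfl) o3
            · rw [if_pos (dv _ _ h1 h2)]
              calc p = 1 * 1 * p := by ring
                _ ≤ _ := Nat.mul_le_mul (Nat.mul_le_mul o1 o2) le_rfl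
          · rw [if_neg hpm]
            calc 1 = 1 * 1 * 1 := by ring
              _ ≤ _ := Nat.mul_le_mul (Nat.mul_le_mul o1 o2) o3
        calc (∏ p ∈ D.primeFactors, (if pairedMod b1 b2 b3 b4 p then (p : ℤ) else 1)) =
            ((∏ p ∈ D.primeFactors, (if pairedMod b1 b2 b3 b4 p then p else 1) : ℕ) : ℤ) := by
              push_cast; rfl
          _ ≤ ((G1 * G2 * G3 : ℕ) : ℤ) := by exact_mod_cast h2
          _ = _ := by push_cast; ring

end HB



set_option linter.unusedSectionVars false
set_option linter.deprecated false

namespace HB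

lemma card_modEq_le (M : ℤ) (N g : ℕ) (hg : 0 < g) (r : ℤ) :
    (((Finset.Ioc M (M + N)).filter (fun x => x ≡ r [ZMOD g])).card : ℝ) ≤ (N : ℝ) / g + 1 := by
  have h := Int.Ioc_filter_modEq_card M (M + N) (r := (g : ℤ)) (by exact_mod_cast hg) r
  have h1 : (⌊((M + N : ℤ) - r : ℚ) / (g : ℤ)⌋ : ℝ) - ⌊((M : ℤ) - r : ℚ) / (g : ℤ)⌋
      ≤ (N : ℝ) / g + 1 := by
    have a1 := Int.floor_le (((M + N : ℤ) - r : ℚ) / (g : ℤ))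
    have a2 := Int.lt_floor_add_one (((M : ℤ) - r : ℚ) / (g : ℤ))
    have hg' : (0 : ℚ) < g := by exact_mod_cast hg
    have : (⌊((M + N : ℤ) - r : ℚ) / (g : ℤ)⌋ : ℚ) - ⌊((M : ℤ) - r : ℚ) / (g : ℤ)⌋
      ≤ (N : ℚ) / g + 1 := by
      have e : ((M + N : ℤ) - r : ℚ) / (g : ℤ) = ((M : ℤ) - r : ℚ) / (g : ℤ) + (N : ℚ) / g := by
        push_cast; field_simp; ring
      rw [e] at a1 ⊢
      linarith
    revert this
    generalize ⌊((M + N : ℤ) - r : ℚ) / (g : ℤ)⌋ = z1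
    generalize ⌊((M : ℤ) - r : ℚ) / (g : ℤ)⌋ = z2
    intro this
    have t2 : (((z1 : ℚ) - z2 : ℚ) : ℝ) ≤ (((N : ℚ) / g + 1 : ℚ) : ℝ) := Rat.cast_le.2 this
    push_cast at t2
    exact t2
  have h2 : (((Finset.Ioc M (M + N)).filter (fun x => x ≡ r [ZMOD g])).card : ℝ) =
      ((((Finset.Ioc M (M + N)).filter (fun x => x ≡ r [ZMOD g])).card : ℤ) : ℝ) := by simp
  rw [h2, h, Int.cast_max]
  refine max_le ?_ (by simp; positivity)
  rw [Int.cast_sub]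
  exact h1

lemma gcd_le_sum (B : ℕ) (u v : ℤ) (hu : |u| < B) (hv : |v| < B) :
    Int.gcd u v ≤ ∑ g ∈ Finset.Icc 1 B, if (g : ℤ) ∣ u ∧ (g : ℤ) ∣ v then g else 0 := by
  by_cases h0 : Int.gcd u v = 0
  · rw [h0]; exact Nat.zero_le _
  have hle : Int.gcd u v ≤ B := by
    rw [Int.gcd_eq_zero_iff, not_and_or] at h0
    rcases h0 with h | h
    · have := Int.le_of_dvd (abs_pos.2 h) ((dvd_abs _ _).2 (Int.gcd_dvd_left u v))
      zify; linarith
    · have := Int.le_of_dvd (abs_pos.2 h) ((dvd_abs _ _).2 (Int.gcd_dvd_right u v))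
      zify; linarith
  have hm : Int.gcd u v ∈ Finset.Icc 1 B := Finset.mem_Icc.2 ⟨Nat.one_le_iff_ne_zero.2 h0, hle⟩
  refine le_trans ?_ (Finset.single_le_sum (f := fun g : ℕ => if (g : ℤ) ∣ u ∧ (g : ℤ) ∣ v then g
    else 0) (fun _ _ => Nat.zero_le _) hm)
  simp [Int.gcd_dvd_left, Int.gcd_dvd_right]

lemma sum_gcd_le (B : ℕ) :
    ∑ i ∈ Finset.Ioc (0 : ℤ) B, ∑ j ∈ Finset.Ioc (0 : ℤ) B, ∑ k ∈ Finset.Ioc (0 : ℤ) B,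
      ∑ l ∈ Finset.Ioc (0 : ℤ) B, (Int.gcd (i - j) (k - l) : ℝ) ≤
      4 * (B : ℝ) ^ 4 * (1 + Real.log B) := by
  set I := Finset.Ioc (0 : ℤ) B with hI
  have hc : ∀ g ∈ Finset.Icc 1 B, ∑ i ∈ I, ∑ j ∈ I, (if (g : ℤ) ∣ i - j then (1 : ℝ) else 0) ≤
      2 * (B : ℝ) ^ 2 / g := by
    intro g hg
    obtain ⟨hg1, hgB⟩ := Finset.mem_Icc.1 hg
    have hg0 : (0 : ℝ) < g := by exact_mod_cast hg1
    have : ∀ i ∈ I, ∑ j ∈ I, (if (g : ℤ) ∣ i - j then (1 : ℝ) else 0) ≤ 2 * (B : ℝ) / g := by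
      intro i _
      have h1 := card_modEq_le 0 B g hg1 i
      rw [← Finset.sum_filter, Finset.sum_const, nsmul_eq_mul, mul_one]
      have e : (I.filter (fun j => (g : ℤ) ∣ i - j)) =
          (Finset.Ioc (0 : ℤ) (0 + B)).filter (fun x => x ≡ i [ZMOD g]) := by
        ext j; simp [hI, Int.modEq_iff_dvd]
      rw [e]
      refine h1.trans ?_
      have : (1 : ℝ) ≤ B / g := by
        rw [le_div_iff₀ hg0]; simpa using (by exact_mod_cast hgB : (g : ℝ) ≤ B)
      have e2 : 2 * (B : ℝ) / g = B / g + B / g := by ring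
      linarith
    calc _ ≤ ∑ i ∈ I, 2 * (B : ℝ) / g := Finset.sum_le_sum this
      _ = _ := by simp [hI]; ring
  calc _ ≤ ∑ i ∈ I, ∑ j ∈ I, ∑ k ∈ I, ∑ l ∈ I, ∑ g ∈ Finset.Icc 1 B,
        ((g : ℝ) * ((if (g : ℤ) ∣ i - j then (1 : ℝ) else 0) *
          (if (g : ℤ) ∣ k - l then (1 : ℝ) else 0))) := by
        refine Finset.sum_le_sum fun i hi => Finset.sum_le_sum fun j hj =>
          Finset.sum_le_sum fun k hk => Finset.sum_le_sum fun l hl => ?_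
        simp only [hI, Finset.mem_Ioc] at hi hj hk hl
        have := gcd_le_sum B (i - j) (k - l) (by rw [abs_lt]; constructor <;> linarith)
          (by rw [abs_lt]; constructor <;> linarith)
        have h2 : (Int.gcd (i - j) (k - l) : ℝ) ≤ ((∑ g ∈ Finset.Icc 1 B,
          if (g : ℤ) ∣ (i - j) ∧ (g : ℤ) ∣ (k - l) then g else 0 : ℕ) : ℝ) := by
          exact_mod_cast this
        refine h2.trans (le_of_eq ?_)
        push_cast
        refine Finset.sum_congr rfl fun g _ => ?_
        by_cases h1 : (g : ℤ) ∣ i - j <;> by_cases h2 : (g : ℤ) ∣ k - l <;> simp [h1, h2]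
    _ = ∑ g ∈ Finset.Icc 1 B, (g : ℝ) *
        ((∑ i ∈ I, ∑ j ∈ I, (if (g : ℤ) ∣ i - j then (1 : ℝ) else 0)) *
        (∑ i ∈ I, ∑ j ∈ I, (if (g : ℤ) ∣ i - j then (1 : ℝ) else 0))) := by
        have e1 : ∀ F : ℤ → ℤ → ℤ → ℤ → ℕ → ℝ,
            ∑ i ∈ I, ∑ j ∈ I, ∑ k ∈ I, ∑ l ∈ I, ∑ g ∈ Finset.Icc 1 B, F i j k l g =
            ∑ g ∈ Finset.Icc 1 B, ∑ i ∈ I, ∑ j ∈ I, ∑ k ∈ I, ∑ l ∈ I, F i j k l g := by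
          intro F
          rw [Finset.sum_comm (s := Finset.Icc 1 B)]
          refine Finset.sum_congr rfl fun i _ => ?_
          rw [Finset.sum_comm (s := Finset.Icc 1 B)]
          refine Finset.sum_congr rfl fun j _ => ?_
          rw [Finset.sum_comm (s := Finset.Icc 1 B)]
          refine Finset.sum_congr rfl fun k _ => ?_
          rw [Finset.sum_comm (s := Finset.Icc 1 B)]
        rw [e1]
        refine Finset.sum_congr rfl fun g _ => ?_
        simp only [← Finset.mul_sum, ← Finset.sum_mul]
    _ ≤ ∑ g ∈ Finset.Icc 1 B, (g : ℝ) * ((2 * (B : ℝ) ^ 2 / g) * (2 * (B : ℝ) ^ 2 / g)) := by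
        refine Finset.sum_le_sum fun g hg => ?_
        refine mul_le_mul_of_nonneg_left ?_ (by positivity)
        exact mul_le_mul (hc g hg) (hc g hg) (Finset.sum_nonneg fun _ _ =>
          Finset.sum_nonneg fun _ _ => by positivity) (by positivity)
    _ = 4 * (B : ℝ) ^ 4 * ∑ g ∈ Finset.Icc 1 B, (g : ℝ)⁻¹ := by
        rw [Finset.mul_sum]
        refine Finset.sum_congr rfl fun g hg => ?_
        have : (g : ℝ) ≠ 0 := by
          have := (Finset.mem_Icc.1 hg).1
          positivity
        field_simp; ring
    _ ≤ _ := by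
        refine mul_le_mul_of_nonneg_left ?_ (by positivity)
        have := harmonic_le_one_add_log B
        rw [harmonic_eq_sum_Icc] at this
        push_cast at this
        exact this

lemma abs_jacobi_le (a : ℤ) (b : ℕ) : |jacobiSym a b| ≤ 1 := by
  rcases jacobiSym.trichotomy a b with h | h | h <;> simp [h]

lemma comp_bound_real {D : ℕ} (hD : Squarefree D) (hodd : D % 2 = 1) (b1 b2 b3 b4 : ℤ) :
    ((∑ x ∈ Finset.range D, jacobiSym (q4 b1 b2 b3 b4 x) D : ℤ) : ℝ) ≤
      D * ((if b1 = b2 ∧ b3 = b4 then 1 else 0) +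
        (if b1 = b3 ∧ b2 = b4 then 1 else 0) + (if b1 = b4 ∧ b2 = b3 then 1 else 0)) +
      512 ^ D.primeFactors.card * (D : ℝ) ^ ((3 : ℝ) / 4) * (Int.gcd (b1 - b2) (b3 - b4) +
        Int.gcd (b1 - b3) (b2 - b4) + Int.gcd (b1 - b4) (b2 - b3)) := by
  by_cases hp : (b1 = b2 ∧ b3 = b4) ∨ (b1 = b3 ∧ b2 = b4) ∨ (b1 = b4 ∧ b2 = b3)
  · have h1 : ((∑ x ∈ Finset.range D, jacobiSym (q4 b1 b2 b3 b4 x) D : ℤ) : ℝ) ≤ D := by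
      have : ∑ x ∈ Finset.range D, jacobiSym (q4 b1 b2 b3 b4 x) D ≤ D := by
        calc _ ≤ ∑ x ∈ Finset.range D, (1 : ℤ) :=
              Finset.sum_le_sum fun x _ => (le_abs_self _).trans (abs_jacobi_le _ _)
          _ = _ := by simp
      exact_mod_cast this
    refine h1.trans (le_trans ?_ (le_add_of_nonneg_right (by positivity)))
    refine le_mul_of_one_le_right (by positivity) ?_
    rcases hp with h | h | h
    · rw [if_pos h]; split_ifs <;> norm_num
    · rw [if_pos h]; split_ifs <;> norm_num
    · rw [if_pos h]; split_ifs <;> norm_num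
  · have h := comp_bound hD hodd b1 b2 b3 b4 hp
    set T := ∑ x ∈ Finset.range D, jacobiSym (q4 b1 b2 b3 b4 x) D
    have g1 : 1 ≤ Int.gcd (b1 - b2) (b3 - b4) := by
      rw [Nat.one_le_iff_ne_zero, Ne, Int.gcd_eq_zero_iff, sub_eq_zero, sub_eq_zero]; tauto
    set G1 := Int.gcd (b1 - b2) (b3 - b4)
    set G2 := Int.gcd (b1 - b3) (b2 - b4)
    set G3 := Int.gcd (b1 - b4) (b2 - b3)
    have h' : (T : ℝ) ^ 4 ≤ 512 ^ D.primeFactors.card * (D : ℝ) ^ 3 * (G1 * G2 * G3) := by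
      exact_mod_cast h
    have hD4 : ((D : ℝ) ^ ((3 : ℝ) / 4)) ^ 4 = (D : ℝ) ^ 3 := by
      rw [← Real.rpow_natCast, ← Real.rpow_mul (by positivity)]
      norm_num
    have hG : (G1 * G2 * G3 : ℝ) ≤ (G1 + G2 + G3 : ℝ) ^ 4 := by
      have r1 : (1 : ℝ) ≤ G1 := by exact_mod_cast g1
      have r2 : (0 : ℝ) ≤ G2 := by positivity
      have r3 : (0 : ℝ) ≤ G3 := by positivity
      calc (G1 * G2 * G3 : ℝ) ≤ (G1 + G2 + G3) * (G1 + G2 + G3) * (G1 + G2 + G3) := by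
            gcongr <;> linarith
        _ = (G1 + G2 + G3 : ℝ) ^ 3 := by ring
        _ ≤ _ := pow_le_pow_right₀ (by linarith) (by norm_num)
    have hK : (512 : ℝ) ^ D.primeFactors.card ≤ (512 ^ D.primeFactors.card) ^ 4 :=
      le_self_pow₀ (one_le_pow₀ (by norm_num)) (by norm_num)
    have : (T : ℝ) ^ 4 ≤ (512 ^ D.primeFactors.card * (D : ℝ) ^ ((3 : ℝ) / 4) *
        (G1 + G2 + G3)) ^ 4 := by
      refine h'.trans ?_
      rw [mul_pow, mul_pow, hD4]
      gcongr
    have h2 : (T : ℝ) ≤ 512 ^ D.primeFactors.card * (D : ℝ) ^ ((3 : ℝ) / 4) *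
        (G1 + G2 + G3) := by
      by_contra hlt
      push Not at hlt
      exact absurd this (not_le.2 (pow_lt_pow_left₀ hlt (by positivity) (by norm_num)))
    refine h2.trans (le_add_of_nonneg_left (by positivity))

/-- the fourth moment bound -/
lemma fourth_moment {D : ℕ} (hD : Squarefree D) (hodd : D % 2 = 1) (B : ℕ) :
    ∑ x ∈ Finset.range D, ((∑ b ∈ Finset.Ioc (0 : ℤ) B, jacobiSym (x + b) D : ℤ) : ℝ) ^ 4 ≤
      3 * (B : ℝ) ^ 2 * D + 512 ^ D.primeFactors.card * (D : ℝ) ^ ((3 : ℝ) / 4) *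
        (12 * (B : ℝ) ^ 4 * (1 + Real.log B)) := by
  set I := Finset.Ioc (0 : ℤ) B with hI
  have hcard : (I.card : ℝ) = B := by simp [hI]
  set K : ℝ := 512 ^ D.primeFactors.card * (D : ℝ) ^ ((3 : ℝ) / 4) with hK
  have e1 : ∑ x ∈ Finset.range D, ((∑ b ∈ I, jacobiSym (x + b) D : ℤ) : ℝ) ^ 4 =
      ∑ i ∈ I, ∑ j ∈ I, ∑ k ∈ I, ∑ l ∈ I,
        ((∑ x ∈ Finset.range D, jacobiSym (q4 i j k l x) D : ℤ) : ℝ) := by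
    have : ∑ x ∈ Finset.range D, (∑ b ∈ I, jacobiSym (x + b) D) ^ 4 =
      ∑ i ∈ I, ∑ j ∈ I, ∑ k ∈ I, ∑ l ∈ I,
        (∑ x ∈ Finset.range D, jacobiSym (q4 i j k l x) D) := by
      simp_rw [sum_pow_four]
      rw [Finset.sum_comm]
      refine Finset.sum_congr rfl fun i _ => ?_
      rw [Finset.sum_comm]
      refine Finset.sum_congr rfl fun j _ => ?_
      rw [Finset.sum_comm]
      refine Finset.sum_congr rfl fun k _ => ?_
      rw [Finset.sum_comm]
      refine Finset.sum_congr rfl fun l _ => Finset.sum_congr rfl fun x _ => ?_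
      simp only [q4, jacobiSym.mul_left]
    exact_mod_cast this
  rw [e1]
  have b1 := sum_gcd_le B
  have b2 : ∑ i ∈ I, ∑ j ∈ I, ∑ k ∈ I, ∑ l ∈ I, (Int.gcd (i - k) (j - l) : ℝ) ≤
      4 * (B : ℝ) ^ 4 * (1 + Real.log B) := by
    refine le_trans (le_of_eq ?_) b1
    refine Finset.sum_congr rfl fun i _ => ?_
    rw [Finset.sum_comm]
  have b3 : ∑ i ∈ I, ∑ j ∈ I, ∑ k ∈ I, ∑ l ∈ I, (Int.gcd (i - l) (j - k) : ℝ) ≤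
      4 * (B : ℝ) ^ 4 * (1 + Real.log B) := by
    refine le_trans (le_of_eq ?_) b1
    refine Finset.sum_congr rfl fun i _ => ?_
    have : ∀ j ∈ I, ∑ k ∈ I, ∑ l ∈ I, (Int.gcd (i - l) (j - k) : ℝ) =
      ∑ l ∈ I, ∑ k ∈ I, (Int.gcd (i - l) (j - k) : ℝ) := fun j _ => Finset.sum_comm
    rw [Finset.sum_congr rfl this, Finset.sum_comm]
  calc _ ≤ ∑ i ∈ I, ∑ j ∈ I, ∑ k ∈ I, ∑ l ∈ I,
        ((D : ℝ) * ((if i = j ∧ k = l then 1 else 0) +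
        (if i = k ∧ j = l then 1 else 0) + (if i = l ∧ j = k then 1 else 0)) +
      K * (Int.gcd (i - j) (k - l) + Int.gcd (i - k) (j - l) + Int.gcd (i - l) (j - k))) := by
        refine Finset.sum_le_sum fun i _ => Finset.sum_le_sum fun j _ =>
          Finset.sum_le_sum fun k _ => Finset.sum_le_sum fun l _ => ?_
        exact comp_bound_real hD hodd i j k l
    _ = (D : ℝ) * (∑ i ∈ I, ∑ j ∈ I, ∑ k ∈ I, ∑ l ∈ I, ((if i = j ∧ k = l then (1 : ℝ) else 0) +
        (if i = k ∧ j = l then 1 else 0) + (if i = l ∧ j = k then 1 else 0))) +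
        K * (∑ i ∈ I, ∑ j ∈ I, ∑ k ∈ I, ∑ l ∈ I, (Int.gcd (i - j) (k - l) : ℝ) +
          ∑ i ∈ I, ∑ j ∈ I, ∑ k ∈ I, ∑ l ∈ I, (Int.gcd (i - k) (j - l) : ℝ) +
          ∑ i ∈ I, ∑ j ∈ I, ∑ k ∈ I, ∑ l ∈ I, (Int.gcd (i - l) (j - k) : ℝ)) := by
        simp only [Finset.sum_add_distrib, ← Finset.mul_sum, mul_add]
    _ ≤ (D : ℝ) * (3 * (B : ℝ) ^ 2) + K * (4 * (B : ℝ) ^ 4 * (1 + Real.log B) +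
          4 * (B : ℝ) ^ 4 * (1 + Real.log B) + 4 * (B : ℝ) ^ 4 * (1 + Real.log B)) := by
        have hd : ∑ i ∈ I, ∑ j ∈ I, ∑ k ∈ I, ∑ l ∈ I, ((if i = j ∧ k = l then (1 : ℝ) else 0) +
          (if i = k ∧ j = l then 1 else 0) + (if i = l ∧ j = k then 1 else 0)) =
            3 * (B : ℝ) ^ 2 := by
          simp only [Finset.sum_add_distrib]
          have s1 : ∑ i ∈ I, ∑ j ∈ I, ∑ k ∈ I, ∑ l ∈ I, (if i = j ∧ k = l then (1 : ℝ) else 0) =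
              (B : ℝ) ^ 2 := by
            have : ∀ i ∈ I, ∑ j ∈ I, ∑ k ∈ I, ∑ l ∈ I, (if i = j ∧ k = l then (1 : ℝ) else 0)
                = B := by
              intro i hi
              simp_rw [ite_and]
              rw [Finset.sum_eq_single_of_mem i hi (fun j _ hj => by simp [hj.symm])]
              simp [hcard]
            rw [Finset.sum_congr rfl this]; simp [hcard]; ring
          have s2 : ∑ i ∈ I, ∑ j ∈ I, ∑ k ∈ I, ∑ l ∈ I, (if i = k ∧ j = l then (1 : ℝ) else 0) =
              (B : ℝ) ^ 2 := by
            rw [← s1]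
            refine Finset.sum_congr rfl fun i _ => ?_
            rw [Finset.sum_comm]
          have s3 : ∑ i ∈ I, ∑ j ∈ I, ∑ k ∈ I, ∑ l ∈ I, (if i = l ∧ j = k then (1 : ℝ) else 0) =
              (B : ℝ) ^ 2 := by
            rw [← s1]
            refine Finset.sum_congr rfl fun i _ => ?_
            have : ∀ j ∈ I, ∑ k ∈ I, ∑ l ∈ I, (if i = l ∧ j = k then (1 : ℝ) else 0) =
              ∑ l ∈ I, ∑ k ∈ I, (if i = l ∧ j = k then (1 : ℝ) else 0) :=
                fun j _ => Finset.sum_comm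
            rw [Finset.sum_congr rfl this, Finset.sum_comm]
          rw [s1, s2, s3]; ring
        rw [hd]
        have hK0 : 0 ≤ K := by positivity
        gcongr
    _ = _ := by ring

end HB



set_option linter.unusedSectionVars false
set_option linter.deprecated false

namespace HB

lemma sum_Ioc_shift_one (f : ℤ → ℤ) (M : ℤ) (N : ℕ) :
    ∑ n ∈ Finset.Ioc (M + 1) (M + 1 + N), f n =
      ∑ n ∈ Finset.Ioc M (M + N), f n + f (M + 1 + N) - f (M + 1) := by
  have h1 : Finset.Ioc M (M + 1 + N) = insert (M + 1 + N) (Finset.Ioc M (M + N)) := by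
    ext x; simp only [Finset.mem_Ioc, Finset.mem_insert]; omega
  have h2 : Finset.Ioc M (M + 1 + N) = insert (M + 1) (Finset.Ioc (M + 1) (M + 1 + N)) := by
    ext x; simp only [Finset.mem_Ioc, Finset.mem_insert]; omega
  have e1 : ∑ n ∈ Finset.Ioc M (M + 1 + N), f n = f (M + 1 + N) + ∑ n ∈ Finset.Ioc M (M + N), f n := by
    rw [h1, Finset.sum_insert (by simp only [Finset.mem_Ioc]; omega)]
  have e2 : ∑ n ∈ Finset.Ioc M (M + 1 + N), f n =
      f (M + 1) + ∑ n ∈ Finset.Ioc (M + 1) (M + 1 + N), f n := by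
    rw [h2, Finset.sum_insert (by simp only [Finset.mem_Ioc]; omega)]
  linarith

lemma sum_Ioc_shift (f : ℤ → ℤ) (hf : ∀ x, |f x| ≤ 1) (M : ℤ) (N h : ℕ) :
    |∑ n ∈ Finset.Ioc M (M + N), f n - ∑ n ∈ Finset.Ioc M (M + N), f (n + h)| ≤ 2 * h := by
  have hs : ∀ h : ℕ, ∑ n ∈ Finset.Ioc M (M + N), f (n + h) =
      ∑ n ∈ Finset.Ioc (M + h) (M + h + N), f n := by
    intro h
    refine Finset.sum_nbij' (fun x => x + h) (fun x => x - h) ?_ ?_ ?_ ?_ ?_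
    · intro x; simp only [Finset.mem_Ioc]; omega
    · intro x; simp only [Finset.mem_Ioc]; omega
    · intro x _; ring
    · intro x _; ring
    · intro x _; rfl
  rw [hs]
  induction h with
  | zero => simp
  | succ k ih =>
    have e := sum_Ioc_shift_one f (M + k) N
    have e2 : (M + ((k + 1 : ℕ) : ℤ)) = M + k + 1 := by push_cast; ring
    rw [e2, e]
    have h1 := abs_le.1 (hf (M + k + 1 + N))
    have h2 := abs_le.1 (hf (M + k + 1))
    have h3 := abs_le.1 ih
    push_cast
    rw [abs_le]
    constructor <;> linarith [h1.1, h1.2, h2.1, h2.2, h3.1, h3.2]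

/-- primes up to `A` not dividing `D` -/
def PA (A D : ℕ) : Finset ℕ := (Finset.Icc 1 A).filter (fun p => p.Prime ∧ ¬ p ∣ D)

lemma mem_PA {A D a : ℕ} : a ∈ PA A D ↔ a ≤ A ∧ a.Prime ∧ ¬ a ∣ D := by
  simp only [PA, Finset.mem_filter, Finset.mem_Icc]
  constructor
  · rintro ⟨⟨_, h⟩, h2⟩; exact ⟨h, h2⟩
  · rintro ⟨h, h2⟩; exact ⟨⟨h2.1.one_lt.le, h⟩, h2⟩

/-- the residue of `n / a` modulo `D` -/
def yy (D : ℕ) (a : ℕ) (n : ℤ) : ℕ := ((a : ZMod D)⁻¹ * (n : ZMod D)).val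

lemma yy_lt {D : ℕ} (hD : 0 < D) (a : ℕ) (n : ℤ) : yy D a n < D := by
  have : NeZero D := ⟨hD.ne'⟩
  exact ZMod.val_lt _

lemma coprime_of_PA {A D a : ℕ} (ha : a ∈ PA A D) : Nat.Coprime a D :=
  ((mem_PA.1 ha).2.1.coprime_iff_not_dvd).2 (mem_PA.1 ha).2.2

lemma yy_spec {A D a : ℕ} (hD : 0 < D) (ha : a ∈ PA A D) (n : ℤ) :
    ((a : ℤ) * yy D a n : ℤ) ≡ n [ZMOD D] := by
  have : NeZero D := ⟨hD.ne'⟩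
  rw [← ZMod.intCast_eq_intCast_iff]
  push_cast
  rw [yy, ZMod.natCast_val, ZMod.cast_id', id, ← mul_assoc,
    ZMod.coe_mul_inv_eq_one _ (coprime_of_PA ha), one_mul]

lemma jacobi_congr {D : ℕ} {x y : ℤ} (h : x ≡ y [ZMOD D]) : jacobiSym x D = jacobiSym y D := by
  rw [jacobiSym.mod_left x, jacobiSym.mod_left y, h]

/-- inner sum -/
noncomputable def gB (D B : ℕ) (x : ℕ) : ℤ := ∑ b ∈ Finset.Ioc (0 : ℤ) B, jacobiSym (x + b) D

lemma burgess_step1 {A B D : ℕ} (hD : 0 < D) (M : ℤ) (N : ℕ) (a : ℕ) (ha : a ∈ PA A D) :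
    (B : ℤ) * |∑ n ∈ Finset.Ioc M (M + N), jacobiSym n D| ≤
      ∑ n ∈ Finset.Ioc M (M + N), |gB D B (yy D a n)| + B * (2 * A * B) := by
  set W := ∑ n ∈ Finset.Ioc M (M + N), jacobiSym n D with hW
  have h1 : ∀ b ∈ Finset.Ioc (0 : ℤ) B,
      |W - ∑ n ∈ Finset.Ioc M (M + N), jacobiSym (n + a * b) D| ≤ 2 * A * B := by
    intro b hb
    obtain ⟨hb0, hb1⟩ := Finset.mem_Ioc.1 hb
    obtain ⟨c, rfl⟩ := Int.eq_ofNat_of_zero_le hb0.le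
    have := sum_Ioc_shift (fun n => jacobiSym n D) (fun x => abs_jacobi_le x D) M N (a * c)
    push_cast at this
    refine this.trans ?_
    have h2 : (a : ℤ) ≤ A := by exact_mod_cast (mem_PA.1 ha).1
    have h3 : (a : ℤ) * c ≤ A * B := mul_le_mul h2 hb1 hb0.le (by positivity)
    linarith
  have h2 : |(B : ℤ) * W - ∑ b ∈ Finset.Ioc (0 : ℤ) B, ∑ n ∈ Finset.Ioc M (M + N),
      jacobiSym (n + a * b) D| ≤ B * (2 * A * B) := by
    have e : (B : ℤ) * W = ∑ b ∈ Finset.Ioc (0 : ℤ) B, W := by simp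
    rw [e, ← Finset.sum_sub_distrib]
    refine (Finset.abs_sum_le_sum_abs _ _).trans ((Finset.sum_le_sum h1).trans ?_)
    simp
  have h3 : |∑ b ∈ Finset.Ioc (0 : ℤ) B, ∑ n ∈ Finset.Ioc M (M + N),
      jacobiSym (n + a * b) D| ≤ ∑ n ∈ Finset.Ioc M (M + N), |gB D B (yy D a n)| := by
    rw [Finset.sum_comm]
    refine (Finset.abs_sum_le_sum_abs _ _).trans (Finset.sum_le_sum fun n _ => ?_)
    have e : ∑ b ∈ Finset.Ioc (0 : ℤ) B, jacobiSym (n + a * b) D =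
        jacobiSym a D * gB D B (yy D a n) := by
      rw [gB, Finset.mul_sum]
      refine Finset.sum_congr rfl fun b _ => ?_
      rw [← jacobiSym.mul_left]
      refine jacobi_congr ?_
      rw [mul_add]
      exact ((yy_spec hD ha n).symm).add_right _
    rw [e, abs_mul]
    calc _ ≤ 1 * |gB D B (yy D a n)| :=
          mul_le_mul_of_nonneg_right (abs_jacobi_le _ _) (abs_nonneg _)
      _ = _ := one_mul _
  have h4 : (B : ℤ) * |W| = |(B : ℤ) * W| := by rw [abs_mul, abs_of_nonneg (by positivity : (0:ℤ) ≤ B)]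
  rw [h4]
  have := abs_sub_abs_le_abs_sub ((B : ℤ) * W) (∑ b ∈ Finset.Ioc (0 : ℤ) B,
    ∑ n ∈ Finset.Ioc M (M + N), jacobiSym (n + a * b) D)
  linarith

lemma sum_fiber_holder {ι : Type*} (s : Finset ι) (y : ι → ℕ) (D : ℕ) (hy : ∀ i ∈ s, y i < D)
    (g : ℕ → ℝ) (hg : ∀ x, 0 ≤ g x) (V : ℝ)
    (hV : ∑ i ∈ s, ((s.filter (fun j => y j = y i)).card : ℝ) ≤ V) :
    (∑ i ∈ s, g (y i)) ^ 4 ≤ (s.card : ℝ) ^ 2 * V * ∑ x ∈ Finset.range D, g x ^ 4 := by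
  classical
  have c1 : (∑ i ∈ s, g (y i)) ^ 2 ≤ s.card * ∑ i ∈ s, g (y i) ^ 2 :=
    sq_sum_le_card_mul_sum_sq
  set ν : ℕ → ℝ := fun x => ((s.filter (fun j => y j = x)).card : ℝ) with hν
  have fib : ∀ F : ℕ → ℝ, ∑ i ∈ s, F (y i) = ∑ x ∈ Finset.range D, ν x * F x := by
    intro F
    rw [← Finset.sum_fiberwise_of_maps_to (t := Finset.range D) (g := y)
      (fun i hi => Finset.mem_range.2 (hy i hi))]
    refine Finset.sum_congr rfl fun x _ => ?_
    rw [Finset.sum_congr rfl (g := fun _ => F x)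
      (fun i hi => by rw [(Finset.mem_filter.1 hi).2]), Finset.sum_const, nsmul_eq_mul]
  have hVν : ∑ x ∈ Finset.range D, ν x ^ 2 ≤ V := by
    refine le_trans (le_of_eq ?_) hV
    rw [fib ν]
    exact Finset.sum_congr rfl fun x _ => by ring
  have c2 : (∑ i ∈ s, g (y i) ^ 2) ^ 2 ≤ V * ∑ x ∈ Finset.range D, g x ^ 4 := by
    rw [fib (fun x => g x ^ 2)]
    refine (Finset.sum_mul_sq_le_sq_mul_sq _ _ _).trans ?_
    have e : ∑ x ∈ Finset.range D, (g x ^ 2) ^ 2 = ∑ x ∈ Finset.range D, g x ^ 4 :=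
      Finset.sum_congr rfl fun x _ => by ring
    rw [e]
    exact mul_le_mul_of_nonneg_right hVν (Finset.sum_nonneg fun x _ => by positivity)
  calc _ = ((∑ i ∈ s, g (y i)) ^ 2) ^ 2 := by ring
    _ ≤ (s.card * ∑ i ∈ s, g (y i) ^ 2) ^ 2 := pow_le_pow_left₀ (sq_nonneg _) c1 2
    _ = (s.card : ℝ) ^ 2 * (∑ i ∈ s, g (y i) ^ 2) ^ 2 := by ring
    _ ≤ (s.card : ℝ) ^ 2 * (V * ∑ x ∈ Finset.range D, g x ^ 4) :=
        mul_le_mul_of_nonneg_left c2 (by positivity)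
    _ = _ := by ring

lemma pair_count {A D : ℕ} (M : ℤ) (N : ℕ) (hAN : 2 * A * N ≤ D) (hA : 1 ≤ A) (hN : 1 ≤ N)
    {a1 a2 : ℕ} (h1 : a1 ∈ PA A D) (h2 : a2 ∈ PA A D) :
    ((((Finset.Ioc M (M + N)) ×ˢ (Finset.Ioc M (M + N))).filter
      (fun p => yy D a2 p.2 = yy D a1 p.1)).card : ℝ) ≤
      (if a1 = a2 then (N : ℝ) else 0) + (N : ℝ) / a1 + 1 := by
  have hD : 0 < D := by
    have : 0 < 2 * A * N := by positivity
    omega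
  have hND : (N : ℤ) < D := by
    have h1 : N < 2 * A * N := by nlinarith
    exact_mod_cast lt_of_lt_of_le h1 hAN
  have small : ∀ z : ℤ, (D : ℤ) ∣ z → |z| < D → z = 0 := fun z hz hl =>
    Int.eq_zero_of_abs_lt_dvd hz hl
  set I := Finset.Ioc M (M + N) with hI
  set S := (I ×ˢ I).filter (fun p => yy D a2 p.2 = yy D a1 p.1) with hS
  have hspec : ∀ p ∈ S, p.1 ∈ I ∧ p.2 ∈ I ∧ (D : ℤ) ∣ a2 * p.1 - a1 * p.2 := by
    intro p hp
    obtain ⟨hp1, hp2⟩ := Finset.mem_filter.1 hp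
    obtain ⟨hp3, hp4⟩ := Finset.mem_product.1 hp1
    refine ⟨hp3, hp4, ?_⟩
    have s1 := (yy_spec hD h1 p.1).symm.dvd
    have s2 := (yy_spec hD h2 p.2).symm.dvd
    rw [hp2] at s2
    have := (dvd_sub (s2.mul_left a1) (s1.mul_left a2))
    have e : (a1 : ℤ) * (a2 * (yy D a1 p.1 : ℕ) - p.2) - a2 * (a1 * (yy D a1 p.1 : ℕ) - p.1) =
      a2 * p.1 - a1 * p.2 := by ring
    rwa [e] at this
  have hinj : Set.InjOn Prod.fst (S : Set (ℤ × ℤ)) := by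
    rintro ⟨x1, x2⟩ hx ⟨z1, z2⟩ hz (hxz : x1 = z1)
    subst hxz
    obtain ⟨_, q2, q3⟩ := hspec _ (Finset.mem_coe.1 hx)
    obtain ⟨_, r2, r3⟩ := hspec _ (Finset.mem_coe.1 hz)
    have := dvd_sub q3 r3
    have e : ((a2 : ℤ) * x1 - a1 * x2) - (a2 * x1 - a1 * z2) = a1 * (z2 - x2) := by ring
    simp only at this
    rw [e] at this
    have c : IsCoprime (D : ℤ) (a1 : ℤ) :=
      (Nat.isCoprime_iff_coprime.2 (coprime_of_PA h1)).symm
    have d := c.dvd_of_dvd_mul_left this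
    simp only [hI, Finset.mem_Ioc] at q2 r2
    have := small _ d (by rw [abs_lt]; constructor <;> linarith [q2.1, q2.2, r2.1, r2.2])
    rw [show x2 = z2 by linarith]
  have hcard : S.card = (S.image Prod.fst).card := (Finset.card_image_of_injOn hinj).symm
  by_cases ha : a1 = a2
  · rw [if_pos ha, hcard]
    have : (S.image Prod.fst).card ≤ I.card := Finset.card_le_card fun x hx => by
      obtain ⟨p, hp, rfl⟩ := Finset.mem_image.1 hx
      exact (hspec p hp).1
    have h3 : I.card = N := by simp [hI]
    rw [h3] at this
    have : ((S.image Prod.fst).card : ℝ) ≤ N := by exact_mod_cast this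
    have : (0 : ℝ) ≤ (N : ℝ) / a1 := by positivity
    linarith
  · rw [if_neg ha, zero_add, hcard]
    rcases S.eq_empty_or_nonempty with h0 | ⟨p, hp⟩
    · rw [h0]; simp; positivity
    have hsub : S.image Prod.fst ⊆ I.filter (fun x => x ≡ p.1 [ZMOD a1]) := by
      intro x hx
      obtain ⟨q, hq, rfl⟩ := Finset.mem_image.1 hx
      obtain ⟨p1, p2, p3⟩ := hspec p hp
      obtain ⟨q1, q2, q3⟩ := hspec q hq
      refine Finset.mem_filter.2 ⟨q1, ?_⟩
      have := dvd_sub p3 q3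
      have e : ((a2 : ℤ) * p.1 - a1 * p.2) - (a2 * q.1 - a1 * q.2) =
        a2 * (p.1 - q.1) + a1 * (q.2 - p.2) := by ring
      rw [e] at this
      simp only [hI, Finset.mem_Ioc] at p1 p2 q1 q2
      have A1 : (a1 : ℤ) ≤ A := by exact_mod_cast (mem_PA.1 h1).1
      have A2 : (a2 : ℤ) ≤ A := by exact_mod_cast (mem_PA.1 h2).1
      have A3 : (0 : ℤ) < a1 := by exact_mod_cast (mem_PA.1 h1).2.1.pos
      have A4 : (0 : ℤ) < a2 := by exact_mod_cast (mem_PA.1 h2).2.1.pos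
      have AN : 2 * (A : ℤ) * N ≤ D := by exact_mod_cast hAN
      have b1 : |(a2 : ℤ) * (p.1 - q.1)| < A * N := by
        rw [abs_mul, abs_of_pos A4]
        have : |p.1 - q.1| < N := by rw [abs_lt]; constructor <;> linarith
        calc _ < (a2 : ℤ) * N := mul_lt_mul_of_pos_left this A4
          _ ≤ _ := mul_le_mul_of_nonneg_right A2 (by positivity)
      have b2 : |(a1 : ℤ) * (q.2 - p.2)| < A * N := by
        rw [abs_mul, abs_of_pos A3]
        have : |q.2 - p.2| < N := by rw [abs_lt]; constructor <;> linarith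
        calc _ < (a1 : ℤ) * N := mul_lt_mul_of_pos_left this A3
          _ ≤ _ := mul_le_mul_of_nonneg_right A1 (by positivity)
      have z := small _ this (by
        refine (abs_add_le _ _).trans_lt ?_
        linarith)
      have d : (a1 : ℤ) ∣ a2 * (p.1 - q.1) := ⟨-(q.2 - p.2), by linarith⟩
      have c : IsCoprime (a1 : ℤ) (a2 : ℤ) := Nat.isCoprime_iff_coprime.2
        ((Nat.coprime_primes (mem_PA.1 h1).2.1 (mem_PA.1 h2).2.1).2 ha)
      exact Int.modEq_iff_dvd.2 (c.dvd_of_dvd_mul_left d)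
    refine le_trans ?_ (card_modEq_le M N a1 (mem_PA.1 h1).2.1.pos p.1)
    exact_mod_cast Finset.card_le_card hsub

lemma burgess_abstract {A B D : ℕ} (hD : Squarefree D) (hodd : D % 2 = 1) (M : ℤ) (N : ℕ)
    (hAN : 2 * A * N ≤ D) (hA : 1 ≤ A) (hN : A ≤ N) (X F L : ℝ) 
    (hF : 3 * (B : ℝ) ^ 2 * D + 512 ^ D.primeFactors.card * (D : ℝ) ^ ((3 : ℝ) / 4) *
        (12 * (B : ℝ) ^ 4 * (1 + Real.log B)) ≤ F) (hL : 3 + Real.log A ≤ L)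
    (hX0 : 0 ≤ X)
    (hX : (N : ℝ) ^ 3 * L * F < (PA A D).card * (B : ℝ) ^ 4 * X ^ 4) :
    |((∑ n ∈ Finset.Ioc M (M + N), jacobiSym n D : ℤ) : ℝ)| ≤ X + 2 * A * B := by
  have hN1 : 1 ≤ N := hA.trans hN
  have hD0 : 0 < D := Nat.pos_of_ne_zero hD.ne_zero
  by_contra hcon
  push Not at hcon
  set W := ∑ n ∈ Finset.Ioc M (M + N), jacobiSym n D with hW
  set P := PA A D with hP
  set I := Finset.Ioc M (M + N) with hI
  have hIc : I.card = N := by simp [hI]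
  have hPA : P.card ≤ A := by
    have : P.card ≤ (Finset.Icc 1 A).card := Finset.card_le_card (Finset.filter_subset _ _)
    simpa using this
  have hlogA : 0 ≤ Real.log A := Real.log_natCast_nonneg A
  have h1 : (P.card : ℝ) * (B * |(W : ℝ)|) ≤
      ∑ p ∈ P ×ˢ I, |((gB D B (yy D p.1 p.2) : ℤ) : ℝ)| + P.card * (B * (2 * A * B)) := by
    have : (P.card : ℤ) * (B * |W|) ≤
        ∑ p ∈ P ×ˢ I, |gB D B (yy D p.1 p.2)| + P.card * (B * (2 * A * B)) := by
      rw [Finset.sum_product]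
      calc (P.card : ℤ) * (B * |W|) = ∑ a ∈ P, ((B : ℤ) * |W|) := by simp
        _ ≤ ∑ a ∈ P, (∑ n ∈ I, |gB D B (yy D a n)| + B * (2 * A * B)) :=
            Finset.sum_le_sum fun a ha => burgess_step1 hD0 M N a ha
        _ = _ := by rw [Finset.sum_add_distrib]; simp
    exact_mod_cast this
  have hV : ∑ p ∈ P ×ˢ I, (((P ×ˢ I).filter (fun q => yy D q.1 q.2 = yy D p.1 p.2)).card : ℝ) ≤
      P.card * N * L := by
    have e : ∑ p ∈ P ×ˢ I, (((P ×ˢ I).filter (fun q => yy D q.1 q.2 = yy D p.1 p.2)).card : ℝ) =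
        ∑ a1 ∈ P, ∑ a2 ∈ P, (((I ×ˢ I).filter (fun p => yy D a2 p.2 = yy D a1 p.1)).card : ℝ) := by
      simp only [Finset.card_filter, Nat.cast_sum, Finset.sum_product]
      refine Finset.sum_congr rfl fun a1 _ => ?_
      rw [Finset.sum_comm]
    rw [e]
    calc _ ≤ ∑ a1 ∈ P, ∑ a2 ∈ P, ((if a1 = a2 then (N : ℝ) else 0) + (N : ℝ) / a1 + 1) :=
          Finset.sum_le_sum fun a1 h1 => Finset.sum_le_sum fun a2 h2 =>
            pair_count M N hAN hA hN1 h1 h2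
      _ = P.card * N + P.card * (N * ∑ a ∈ P, (a : ℝ)⁻¹) + P.card * P.card := by
          simp only [Finset.sum_add_distrib, Finset.sum_const, nsmul_eq_mul, mul_one]
          congr 2
          · rw [Finset.sum_congr rfl (g := fun _ => (N : ℝ)) (fun a ha => by
              rw [Finset.sum_ite_eq, if_pos ha])]
            simp
          · simp only [div_eq_mul_inv, Finset.mul_sum]
      _ ≤ P.card * N + P.card * (N * (1 + Real.log A)) + P.card * N := by
          have a1 : ∑ a ∈ P, (a : ℝ)⁻¹ ≤ 1 + Real.log A := by
            have := harmonic_le_one_add_log A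
            rw [harmonic_eq_sum_Icc] at this
            push_cast at this
            refine le_trans ?_ this
            exact Finset.sum_le_sum_of_subset_of_nonneg (Finset.filter_subset _ _)
              (fun _ _ _ => by positivity)
          have a2 : (P.card : ℝ) ≤ N := by exact_mod_cast hPA.trans hN
          gcongr
      _ = P.card * N * (3 + Real.log A) := by ring
      _ ≤ _ := by gcongr
  have h4 := sum_fiber_holder (P ×ˢ I) (fun p => yy D p.1 p.2) D (fun p _ => yy_lt hD0 _ _)
    (fun x => |((gB D B x : ℤ) : ℝ)|) (fun _ => abs_nonneg _) _ hV
  have h5 : ∑ x ∈ Finset.range D, |((gB D B x : ℤ) : ℝ)| ^ 4 ≤ F := by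
    refine le_trans (le_of_eq ?_) ((fourth_moment hD hodd B).trans hF)
    refine Finset.sum_congr rfl fun x _ => ?_
    rw [gB, Even.pow_abs (by decide)]
  set G := ∑ p ∈ P ×ˢ I, |((gB D B (yy D p.1 p.2) : ℤ) : ℝ)| with hG
  have hL0 : 0 ≤ L := by linarith
  have h6 : G ^ 4 ≤ (P.card : ℝ) ^ 3 * ((N : ℝ) ^ 3 * L * F) := by
    refine h4.trans ?_
    rw [Finset.card_product, hIc]
    push_cast
    calc _ ≤ ((P.card : ℝ) * N) ^ 2 * (P.card * N * L) * F :=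
          mul_le_mul_of_nonneg_left h5 (by positivity)
      _ = _ := by ring
  have hF0 : 0 ≤ F := le_trans (Finset.sum_nonneg fun _ _ => by positivity) h5
  have hPB : 0 < (P.card : ℝ) * (B : ℝ) ^ 4 * X ^ 4 := lt_of_le_of_lt (by positivity) hX
  have hP0 : (0 : ℝ) < P.card := by
    rcases Nat.eq_zero_or_pos P.card with h | h
    · rw [h] at hPB; simp at hPB
    · exact_mod_cast h
  have hB0 : (0 : ℝ) < B := by
    rcases Nat.eq_zero_or_pos B with h | h
    · rw [h] at hPB; simp at hPB
    · exact_mod_cast h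
  have h7 : (P.card : ℝ) * B * X ≤ G := by
    have : (P.card : ℝ) * B * (X + 2 * A * B) ≤ P.card * B * |(W : ℝ)| :=
      mul_le_mul_of_nonneg_left hcon.le (by positivity)
    nlinarith
  have h8 : (P.card : ℝ) ^ 3 * (P.card * (B : ℝ) ^ 4 * X ^ 4) ≤
      (P.card : ℝ) ^ 3 * ((N : ℝ) ^ 3 * L * F) := by
    calc _ = ((P.card : ℝ) * B * X) ^ 4 := by ring
      _ ≤ G ^ 4 := pow_le_pow_left₀ (by positivity) h7 4
      _ ≤ _ := h6
  have := le_of_mul_le_mul_left h8 (by positivity)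
  linarith

end HB



set_option linter.unusedSectionVars false
set_option linter.deprecated false

namespace HB

open Filter

lemma ev_const (c : ℝ) {ε : ℝ} (hε : 0 < ε) : ∀ᶠ D : ℕ in atTop, c ≤ (D : ℝ) ^ ε :=
  ((tendsto_rpow_atTop hε).comp tendsto_natCast_atTop_atTop).eventually_ge_atTop c

lemma ev_log (c : ℝ) (hc : 0 < c) {ε : ℝ} (hε : 0 < ε) :
    ∀ᶠ D : ℕ in atTop, c * (1 + Real.log D) ≤ (D : ℝ) ^ ε := by
  have h := (isLittleO_log_rpow_atTop hε).comp_tendsto tendsto_natCast_atTop_atTop (α := ℝ) (k := fun n : ℕ => (n : ℝ))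
  have h1 := h.def (c := 1 / (2 * c)) (by positivity)
  filter_upwards [h1, ev_const (2 * c) hε] with D h2 h3
  simp only [Function.comp, Real.norm_eq_abs] at h2
  have h4 : Real.log D ≤ 1 / (2 * c) * (D : ℝ) ^ ε := by
    refine (le_abs_self _).trans (h2.trans (le_of_eq ?_))
    rw [abs_of_nonneg (by positivity)]
  have h5 : c * Real.log D ≤ c * (1 / (2 * c) * (D : ℝ) ^ ε) := mul_le_mul_of_nonneg_left h4 hc.le
  have h6 : c * (1 / (2 * c) * (D : ℝ) ^ ε) = (D : ℝ) ^ ε / 2 := by field_simp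
  linarith

lemma pow_omega_le (K : ℝ) (hK : 1 ≤ K) {ε : ℝ} (hε : 0 < ε) :
    ∃ C : ℝ, 0 < C ∧ ∀ D : ℕ, D ≠ 0 → K ^ D.primeFactors.card ≤ C * (D : ℝ) ^ ε := by
  set T : ℕ := ⌈K ^ (1 / ε)⌉₊ with hT
  refine ⟨K ^ T, by positivity, fun D hD => ?_⟩
  have h1 : ∀ p ∈ D.primeFactors, K ≤ (if p < T then K else 1) * (p : ℝ) ^ ε := by
    intro p hp
    have hp1 : (1 : ℝ) ≤ p := by exact_mod_cast (Nat.prime_of_mem_primeFactors hp).one_lt.le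
    split_ifs with h
    · exact le_mul_of_one_le_right (by linarith) (Real.one_le_rpow hp1 hε.le)
    · rw [one_mul]
      push Not at h
      have : K ^ (1 / ε) ≤ p := (Nat.le_ceil _).trans (by exact_mod_cast h)
      calc K = (K ^ (1 / ε)) ^ ε := by
            rw [← Real.rpow_mul (by linarith), one_div, inv_mul_cancel₀ hε.ne', Real.rpow_one]
        _ ≤ _ := Real.rpow_le_rpow (by positivity) this hε.le
  calc K ^ D.primeFactors.card = ∏ p ∈ D.primeFactors, K := by simp
    _ ≤ ∏ p ∈ D.primeFactors, ((if p < T then K else 1) * (p : ℝ) ^ ε) :=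
        Finset.prod_le_prod (fun _ _ => by linarith) h1
    _ = (∏ p ∈ D.primeFactors, (if p < T then K else 1)) * ∏ p ∈ D.primeFactors, (p : ℝ) ^ ε :=
        Finset.prod_mul_distrib
    _ ≤ K ^ T * (D : ℝ) ^ ε := by
        refine mul_le_mul ?_ ?_ (Finset.prod_nonneg fun _ _ => by positivity) (by positivity)
        · rw [← Finset.prod_filter, Finset.prod_const]
          refine pow_le_pow_right₀ hK ?_
          calc _ ≤ (Finset.range T).card := Finset.card_le_card fun p hp =>
                Finset.mem_range.2 (Finset.mem_filter.1 hp).2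
            _ = T := by simp
        · rw [Real.finsetProd_rpow _ _ (fun _ _ => by positivity)]
          refine Real.rpow_le_rpow (Finset.prod_nonneg fun _ _ => by positivity) ?_ hε.le
          have := Nat.le_of_dvd (Nat.pos_of_ne_zero hD) (Nat.prod_primeFactors_dvd D)
          calc (∏ p ∈ D.primeFactors, (p : ℝ)) = ((∏ p ∈ D.primeFactors, p : ℕ) : ℝ) := by
                push_cast; rfl
            _ ≤ _ := by exact_mod_cast this

lemma ev_omega (K : ℝ) (hK : 1 ≤ K) {ε : ℝ} (hε : 0 < ε) :
    ∀ᶠ D : ℕ in atTop, K ^ D.primeFactors.card ≤ (D : ℝ) ^ ε := by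
  obtain ⟨C, hC, h⟩ := pow_omega_le K hK (half_pos hε)
  filter_upwards [ev_const C (half_pos hε), eventually_gt_atTop 0] with D h1 h2
  refine (h D h2.ne').trans ?_
  have h3 : (0 : ℝ) < D := by exact_mod_cast h2
  calc _ ≤ (D : ℝ) ^ (ε / 2) * (D : ℝ) ^ (ε / 2) := by gcongr
    _ = _ := by rw [← Real.rpow_add h3]; congr 1; ring

lemma ev_pi {ε : ℝ} (hε : 0 < ε) : ∀ᶠ n : ℕ in atTop, (n : ℝ) ^ (1 - ε) ≤ Nat.primeCounting n := by
  filter_upwards [ev_log 10 (by norm_num) (show (0 : ℝ) < 1 by norm_num),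
    ev_log 4 (by norm_num) hε, eventually_gt_atTop 10] with n h1 h2 h3
  have hn : (10 : ℝ) < n := by exact_mod_cast h3
  have hp := Chebyshev.pi_ge n
  refine le_trans ?_ hp
  have hl : 0 < Real.log n := Real.log_pos (by linarith)
  rw [le_div_iff₀ hl]
  have e1 : Real.log (n + 1) ≤ 1 + Real.log n := by
    have hq : (n : ℝ) + 1 ≤ 2 * (n : ℝ) := by clear h1 h2 hp hl; linarith
    have : Real.log ((n : ℝ) + 1) ≤ Real.log (2 * (n : ℝ)) := Real.log_le_log (by positivity) hq
    rw [Real.log_mul (by norm_num) (by positivity)] at this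
    have := Real.log_two_lt_d9
    linarith
  rw [Real.rpow_one] at h1
  have e2 : Real.log (n + 1) ≤ n / 10 := by linarith
  have e3 := Real.log_two_gt_d9
  have e4 : (n : ℝ) ^ (1 - ε) * Real.log n ≤ n / 4 := by
    rw [Real.rpow_sub (by linarith), Real.rpow_one, div_mul_eq_mul_div, div_le_div_iff₀ (by positivity) (by norm_num)]
    have : 4 * Real.log n ≤ (n : ℝ) ^ ε := by linarith
    nlinarith
  nlinarith

lemma card_PA_ge (A D : ℕ) (hD : D ≠ 0) :
    (Nat.primeCounting A : ℝ) - D.primeFactors.card ≤ (PA A D).card := by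
  have h : Nat.primeCounting A ≤ (PA A D).card + D.primeFactors.card := by
    have e : Nat.primeCounting A = ((Finset.Icc 1 A).filter Nat.Prime).card := by
      rw [Nat.primeCounting, Nat.primeCounting', Nat.count_eq_card_filter_range]
      congr 1
      ext p
      simp only [Finset.mem_filter, Finset.mem_range, Finset.mem_Icc]
      constructor
      · rintro ⟨h1, h2⟩; exact ⟨⟨h2.one_lt.le, by omega⟩, h2⟩
      · rintro ⟨h1, h2⟩; exact ⟨by omega, h2⟩
    rw [e]
    refine le_trans (Finset.card_le_card ?_) (Finset.card_union_le _ _)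
    intro p hp
    obtain ⟨h1, h2⟩ := Finset.mem_filter.1 hp
    by_cases hd : p ∣ D
    · exact Finset.mem_union_right _ (Nat.mem_primeFactors.2 ⟨h2, hd, hD⟩)
    · exact Finset.mem_union_left _ (Finset.mem_filter.2 ⟨h1, h2, hd⟩)
  have : (Nat.primeCounting A : ℝ) ≤ (PA A D).card + D.primeFactors.card := by exact_mod_cast h
  linarith

lemma half_le_floor {x : ℝ} (hx : 1 ≤ x) : x / 2 ≤ (⌊x⌋₊ : ℝ) := by
  have h1 := Nat.lt_floor_add_one x
  have h2 : (1 : ℝ) ≤ (⌊x⌋₊ : ℝ) := by exact_mod_cast Nat.one_le_floor_iff x |>.2 hx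
  linarith

lemma ev_floor {f : ℝ} (hf : 0 < f) {P : ℕ → Prop} (h : ∀ᶠ n in atTop, P n) :
    ∀ᶠ D : ℕ in atTop, P ⌊(D : ℝ) ^ f⌋₊ :=
  (tendsto_nat_floor_atTop.comp
    ((tendsto_rpow_atTop hf).comp tendsto_natCast_atTop_atTop)).eventually h

lemma burgess_block : ∀ᶠ D : ℕ in atTop, Squarefree D → D % 2 = 1 → ∀ M : ℤ,
    |((∑ n ∈ Finset.Ioc M (M + ⌊(D : ℝ) ^ ((4 : ℝ) / 9)⌋₊), jacobiSym n D : ℤ) : ℝ)| ≤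
      3 * (D : ℝ) ^ ((4 : ℝ) / 9 - 1 / 720) := by
  have hα : (0 : ℝ) < 4 / 9 - 1 / 8 - 1 / 720 := by norm_num
  have hα' : (0 : ℝ) < 1 / 8 := by norm_num
  filter_upwards [ev_const 16 (show (0 : ℝ) < 1 / 1000 by norm_num),
    ev_log 12 (by norm_num) (show (0 : ℝ) < 1 / 2000 by norm_num),
    ev_omega 512 (by norm_num) (show (0 : ℝ) < 1 / 2000 by norm_num),
    ev_floor hα (ev_pi (show (0 : ℝ) < 1 / 2000 by norm_num)),
    ev_const 2 (show (0 : ℝ) < 1 / 10 by norm_num), 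
    ev_const 2 (show (0 : ℝ) < 1 / 2000 by norm_num), eventually_gt_atTop 1] with D e1 e2 e3 e4 e5 e5' e6
  intro hD hodd M
  have hD1 : (1 : ℝ) < D := by exact_mod_cast e6
  have hD0 : (0 : ℝ) < D := by linarith
  have mono : ∀ {a b : ℝ}, a ≤ b → (D : ℝ) ^ a ≤ (D : ℝ) ^ b := fun h =>
    Real.rpow_le_rpow_of_exponent_le hD1.le h
  set N := ⌊(D : ℝ) ^ ((4 : ℝ) / 9)⌋₊ with hN
  set A := ⌊(D : ℝ) ^ ((4 : ℝ) / 9 - 1 / 8 - 1 / 720)⌋₊ with hA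
  set B := ⌊(D : ℝ) ^ ((1 : ℝ) / 8)⌋₊ with hB
  have hNle : (N : ℝ) ≤ (D : ℝ) ^ ((4 : ℝ) / 9) := Nat.floor_le (by positivity)
  have hAle : (A : ℝ) ≤ (D : ℝ) ^ ((4 : ℝ) / 9 - 1 / 8 - 1 / 720) := Nat.floor_le (by positivity)
  have hBle : (B : ℝ) ≤ (D : ℝ) ^ ((1 : ℝ) / 8) := Nat.floor_le (by positivity)
  have hA1 : 1 ≤ A := (Nat.one_le_floor_iff _).2 (Real.one_le_rpow hD1.le (by norm_num))
  have hB1 : 1 ≤ B := (Nat.one_le_floor_iff _).2 (Real.one_le_rpow hD1.le (by norm_num))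
  have hAN : A ≤ N := Nat.floor_le_floor (mono (by norm_num))
  have hBge : (D : ℝ) ^ ((1 : ℝ) / 8) / 2 ≤ B := half_le_floor (Real.one_le_rpow hD1.le (by norm_num))
  have hAge : (D : ℝ) ^ ((4 : ℝ) / 9 - 1 / 8 - 1 / 720) / 2 ≤ A :=
    half_le_floor (Real.one_le_rpow hD1.le (by norm_num))
  have h2AN : 2 * A * N ≤ D := by
    have : (2 * A * N : ℝ) ≤ D := by
      calc (2 * A * N : ℝ) ≤ (D : ℝ) ^ ((1 : ℝ) / 10) * (D : ℝ) ^ ((4 : ℝ) / 9 - 1 / 8 - 1 / 720) *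
            (D : ℝ) ^ ((4 : ℝ) / 9) := by gcongr
        _ = (D : ℝ) ^ ((1 : ℝ) / 10 + (4 / 9 - 1 / 8 - 1 / 720) + 4 / 9) := by
            rw [← Real.rpow_add hD0, ← Real.rpow_add hD0]
        _ ≤ (D : ℝ) ^ (1 : ℝ) := mono (by norm_num)
        _ = D := Real.rpow_one _
    exact_mod_cast this
  have hlogD : 0 < Real.log D := Real.log_pos hD1
  have hlogA : Real.log A ≤ Real.log D := by
    refine Real.log_le_log (by exact_mod_cast hA1) (hAle.trans ?_)
    calc _ ≤ (D : ℝ) ^ (1 : ℝ) := mono (by norm_num)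
      _ = D := Real.rpow_one _
  have hlogB : Real.log B ≤ Real.log D := by
    refine Real.log_le_log (by exact_mod_cast hB1) (hBle.trans ?_)
    calc _ ≤ (D : ℝ) ^ (1 : ℝ) := mono (by norm_num)
      _ = D := Real.rpow_one _
  have hL : 3 + Real.log A ≤ (D : ℝ) ^ ((1 : ℝ) / 2000) := by linarith
  have hB2 : (B : ℝ) ^ 2 ≤ (D : ℝ) ^ ((1 : ℝ) / 4) := by
    calc _ ≤ ((D : ℝ) ^ ((1 : ℝ) / 8)) ^ 2 := by gcongr
      _ = _ := by rw [← Real.rpow_natCast, ← Real.rpow_mul hD0.le]; norm_num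
  have hB4 : (B : ℝ) ^ 4 ≤ (D : ℝ) ^ ((1 : ℝ) / 2) := by
    calc _ ≤ ((D : ℝ) ^ ((1 : ℝ) / 8)) ^ 4 := by gcongr
      _ = _ := by rw [← Real.rpow_natCast, ← Real.rpow_mul hD0.le]; norm_num
  have hB4' : (D : ℝ) ^ ((1 : ℝ) / 2 - 1 / 1000) ≤ (B : ℝ) ^ 4 := by
    calc (D : ℝ) ^ ((1 : ℝ) / 2 - 1 / 1000) ≤ (D : ℝ) ^ ((1 : ℝ) / 2) / 16 := by
          rw [Real.rpow_sub hD0]; gcongr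
      _ = ((D : ℝ) ^ ((1 : ℝ) / 8) / 2) ^ 4 := by
          rw [div_pow, ← Real.rpow_natCast ((D : ℝ) ^ ((1 : ℝ) / 8)), ← Real.rpow_mul hD0.le]; norm_num
      _ ≤ _ := by gcongr
  have hF : 3 * (B : ℝ) ^ 2 * D + 512 ^ D.primeFactors.card * (D : ℝ) ^ ((3 : ℝ) / 4) *
        (12 * (B : ℝ) ^ 4 * (1 + Real.log B)) ≤ (D : ℝ) ^ ((5 : ℝ) / 4 + 2 / 1000) := by
    have f1 : 3 * (B : ℝ) ^ 2 * D ≤ 3 * (D : ℝ) ^ ((5 : ℝ) / 4 + 1 / 1000) := by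
      calc _ ≤ 3 * (D : ℝ) ^ ((1 : ℝ) / 4) * (D : ℝ) ^ (1 : ℝ) := by rw [Real.rpow_one]; gcongr
        _ = 3 * (D : ℝ) ^ ((1 : ℝ) / 4 + 1) := by rw [mul_assoc, ← Real.rpow_add hD0]
        _ ≤ _ := by gcongr 3 * ?_; exact mono (by norm_num)
    have f2 : 512 ^ D.primeFactors.card * (D : ℝ) ^ ((3 : ℝ) / 4) *
        (12 * (B : ℝ) ^ 4 * (1 + Real.log B)) ≤ (D : ℝ) ^ ((5 : ℝ) / 4 + 1 / 1000) := by
      have : 12 * (B : ℝ) ^ 4 * (1 + Real.log B) ≤ (D : ℝ) ^ ((1 : ℝ) / 2) * (D : ℝ) ^ ((1 : ℝ) / 2000) := by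
        calc _ = (B : ℝ) ^ 4 * (12 * (1 + Real.log B)) := by ring
          _ ≤ _ := by
            gcongr
            linarith
      calc _ ≤ (D : ℝ) ^ ((1 : ℝ) / 2000) * (D : ℝ) ^ ((3 : ℝ) / 4) *
            ((D : ℝ) ^ ((1 : ℝ) / 2) * (D : ℝ) ^ ((1 : ℝ) / 2000)) := by
            gcongr
        _ = _ := by
            rw [← Real.rpow_add hD0, ← Real.rpow_add hD0, ← Real.rpow_add hD0]; norm_num
    calc _ ≤ 3 * (D : ℝ) ^ ((5 : ℝ) / 4 + 1 / 1000) + (D : ℝ) ^ ((5 : ℝ) / 4 + 1 / 1000) := add_le_add f1 f2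
      _ = 4 * (D : ℝ) ^ ((5 : ℝ) / 4 + 1 / 1000) := by ring
      _ ≤ (D : ℝ) ^ ((1 : ℝ) / 1000) * (D : ℝ) ^ ((5 : ℝ) / 4 + 1 / 1000) := by
          gcongr; linarith
      _ = _ := by rw [← Real.rpow_add hD0]; norm_num
  have hPA : (D : ℝ) ^ ((4 : ℝ) / 9 - 1 / 8 - 1 / 720 - 3 / 1000) ≤ (PA A D).card := by
    refine le_trans ?_ (card_PA_ge A D (by omega))
    have w1 : (D.primeFactors.card : ℝ) ≤ (D : ℝ) ^ ((1 : ℝ) / 2000) := by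
      refine le_trans ?_ e3
      have : D.primeFactors.card ≤ 512 ^ D.primeFactors.card := (Nat.lt_pow_self (by norm_num)).le
      exact_mod_cast this
    have w2 : (D : ℝ) ^ ((4 : ℝ) / 9 - 1 / 8 - 1 / 720 - 2 / 1000) ≤ Nat.primeCounting A := by
      refine le_trans ?_ e4
      set u := (D : ℝ) ^ ((4 : ℝ) / 9 - 1 / 8 - 1 / 720) with hu
      have hu1 : 1 ≤ u := Real.one_le_rpow hD1.le (by norm_num)
      calc _ ≤ (D : ℝ) ^ (((4 : ℝ) / 9 - 1 / 8 - 1 / 720 - 1 / 1000) * (1 - 1 / 2000)) := mono (by norm_num)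
        _ = ((D : ℝ) ^ ((4 : ℝ) / 9 - 1 / 8 - 1 / 720 - 1 / 1000)) ^ ((1 : ℝ) - 1 / 2000) := by
            rw [Real.rpow_mul hD0.le]
        _ ≤ (A : ℝ) ^ ((1 : ℝ) - 1 / 2000) := by
            refine Real.rpow_le_rpow (by positivity) ?_ (by norm_num)
            rw [Real.rpow_sub hD0 _ (1 / 1000)]
            refine le_trans ?_ hAge
            gcongr
            linarith
    have w3 : (D : ℝ) ^ ((4 : ℝ) / 9 - 1 / 8 - 1 / 720 - 3 / 1000) ≤
        (D : ℝ) ^ ((4 : ℝ) / 9 - 1 / 8 - 1 / 720 - 2 / 1000) / 16 := by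
      rw [show (4 : ℝ) / 9 - 1 / 8 - 1 / 720 - 3 / 1000 = ((4 : ℝ) / 9 - 1 / 8 - 1 / 720 - 2 / 1000) - 1 / 1000 by norm_num,
        Real.rpow_sub hD0 _ (1 / 1000)]
      gcongr
    have w4 : (D : ℝ) ^ ((1 : ℝ) / 2000) ≤ (D : ℝ) ^ ((4 : ℝ) / 9 - 1 / 8 - 1 / 720 - 3 / 1000) := mono (by norm_num)
    have w5 : 0 < (D : ℝ) ^ ((4 : ℝ) / 9 - 1 / 8 - 1 / 720 - 2 / 1000) := by positivity
    linarith
  have hX : (N : ℝ) ^ 3 * (D : ℝ) ^ ((1 : ℝ) / 2000) * (D : ℝ) ^ ((5 : ℝ) / 4 + 2 / 1000) <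
      (PA A D).card * (B : ℝ) ^ 4 * ((D : ℝ) ^ ((4 : ℝ) / 9 - 1 / 720)) ^ 4 := by
    calc _ ≤ ((D : ℝ) ^ ((4 : ℝ) / 9)) ^ 3 * (D : ℝ) ^ ((1 : ℝ) / 2000) * (D : ℝ) ^ ((5 : ℝ) / 4 + 2 / 1000) := by gcongr
      _ = (D : ℝ) ^ ((4 : ℝ) / 3 + 1 / 2000 + (5 / 4 + 2 / 1000)) := by
          rw [← Real.rpow_natCast, ← Real.rpow_mul hD0.le, ← Real.rpow_add hD0, ← Real.rpow_add hD0]; norm_num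
      _ < (D : ℝ) ^ ((4 : ℝ) / 9 - 1 / 8 - 1 / 720 - 3 / 1000 + (1 / 2 - 1 / 1000) + (4 / 9 - 1 / 720) * 4) :=
          Real.rpow_lt_rpow_of_exponent_lt hD1 (by norm_num)
      _ = (D : ℝ) ^ ((4 : ℝ) / 9 - 1 / 8 - 1 / 720 - 3 / 1000) * (D : ℝ) ^ ((1 : ℝ) / 2 - 1 / 1000) *
          ((D : ℝ) ^ ((4 : ℝ) / 9 - 1 / 720)) ^ 4 := by
          rw [← Real.rpow_natCast ((D : ℝ) ^ ((4 : ℝ) / 9 - 1 / 720)), ← Real.rpow_mul hD0.le, ← Real.rpow_add hD0, ← Real.rpow_add hD0]; norm_num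
      _ ≤ _ := by gcongr
  have := burgess_abstract hD hodd M N h2AN hA1 hAN _ _ _ hF hL (by positivity) hX
  refine this.trans ?_
  have h3 : (A * B : ℝ) ≤ (D : ℝ) ^ ((4 : ℝ) / 9 - 1 / 720) := by
    calc (A * B : ℝ) ≤ (D : ℝ) ^ ((4 : ℝ) / 9 - 1 / 8 - 1 / 720) * (D : ℝ) ^ ((1 : ℝ) / 8) := by gcongr
      _ = _ := by rw [← Real.rpow_add hD0]; norm_num
  linarith

lemma chunk (f : ℤ → ℤ) (hf : ∀ x, |f x| ≤ 1) (N : ℕ) (hN : 0 < N) (X : ℝ) (hX : 0 ≤ X)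
    (h : ∀ M : ℤ, |((∑ n ∈ Finset.Ioc M (M + N), f n : ℤ) : ℝ)| ≤ X) (n : ℕ) :
    ∀ M : ℤ, |((∑ n ∈ Finset.Ioc M (M + n), f n : ℤ) : ℝ)| ≤ (n : ℝ) / N * X + N := by
  induction n using Nat.strong_induction_on with
  | _ n ih =>
    intro M
    rcases lt_or_ge n N with hlt | hge
    · have : |∑ n ∈ Finset.Ioc M (M + n), f n| ≤ n := by
        refine (Finset.abs_sum_le_sum_abs _ _).trans ((Finset.sum_le_sum fun x _ => hf x).trans ?_)
        simp
      have h2 : |((∑ n ∈ Finset.Ioc M (M + n), f n : ℤ) : ℝ)| ≤ n := by exact_mod_cast this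
      have h3 : (n : ℝ) ≤ N := by exact_mod_cast hlt.le
      have : 0 ≤ (n : ℝ) / N * X := by positivity
      linarith
    · obtain ⟨m, rfl⟩ := Nat.exists_eq_add_of_le hge
      have e : ∑ k ∈ Finset.Ioc M (M + ((N + m : ℕ) : ℤ)), f k =
          ∑ k ∈ Finset.Ioc M (M + N), f k + ∑ k ∈ Finset.Ioc (M + N) (M + N + m), f k := by
        rw [← Finset.sum_union]
        · congr 1
          ext x; simp only [Finset.mem_Ioc, Finset.mem_union]; push_cast; omega
        · rw [Finset.disjoint_left]; intro x; simp only [Finset.mem_Ioc]; omega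
      rw [e, Int.cast_add]
      have h1 := h M
      have h2 := ih m (by omega) (M + N)
      have hN' : (0 : ℝ) < N := by exact_mod_cast hN
      have e2 : ((N + m : ℕ) : ℝ) / N * X = X + (m : ℝ) / N * X := by
        push_cast; field_simp
      rw [e2]
      exact (abs_add_le _ _).trans (by linarith)

lemma burgess : ∃ D0 : ℕ, ∀ D : ℕ, D0 < D → Squarefree D → D % 2 = 1 → ∀ (M : ℤ) (n : ℕ),
    |((∑ n ∈ Finset.Ioc M (M + n), jacobiSym n D : ℤ) : ℝ)| ≤
      6 * n * (D : ℝ) ^ (-(1 / 720 : ℝ)) + (D : ℝ) ^ ((4 : ℝ) / 9) := by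
  obtain ⟨D0, h0⟩ := eventually_atTop.1 burgess_block
  refine ⟨D0 + 1, fun D hD hs ho M n => ?_⟩
  have hD1 : (1 : ℝ) < D := by exact_mod_cast (by omega : 1 < D)
  have hD0 : (0 : ℝ) < D := by linarith
  have h1 : 1 ≤ (D : ℝ) ^ ((4 : ℝ) / 9) := Real.one_le_rpow hD1.le (by norm_num)
  have hN : 0 < ⌊(D : ℝ) ^ ((4 : ℝ) / 9)⌋₊ := (Nat.one_le_floor_iff _).2 h1
  have := chunk (fun n => jacobiSym n D) (fun x => abs_jacobi_le x D) _ hN _ (by positivity)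
    (h0 D (by omega) hs ho) n M
  refine this.trans (add_le_add ?_ (Nat.floor_le (by positivity)))
  have h2 := half_le_floor h1
  calc _ ≤ (n : ℝ) / ((D : ℝ) ^ ((4 : ℝ) / 9) / 2) * (3 * (D : ℝ) ^ ((4 : ℝ) / 9 - 1 / 720)) := by
        gcongr
    _ = _ := by
        rw [Real.rpow_sub hD0, Real.rpow_neg hD0.le]
        field_simp
        ring

end HB



set_option linter.unusedSectionVars false
set_option linter.deprecated false

namespace HB

open Filter Topology Complex
open scoped ComplexOrder Nat

/-- the entire function `(s-1) ζ(s)` -/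
noncomputable def ZZ : ℂ → ℂ := DirichletCharacter.LFunctionTrivChar₁ 1

lemma ZZ_diff : Differentiable ℂ ZZ := DirichletCharacter.differentiable_LFunctionTrivChar₁ 1

lemma ZZ_one : ZZ 1 = 1 := by simp [ZZ, DirichletCharacter.LFunctionTrivChar₁]

lemma ZZ_ne {s : ℂ} (hs : s ≠ 1) : ZZ s = (s - 1) * riemannZeta s := by
  simp [ZZ, DirichletCharacter.LFunctionTrivChar₁, Function.update_of_ne hs,
    DirichletCharacter.LFunctionTrivChar]

lemma iteratedDeriv_inv_sub_one (m : ℕ) (l : ℂ) :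
    iteratedDeriv m (fun s : ℂ => l * (s - 1)⁻¹) 2 = (-1) ^ m * m ! * l := by
  have h := congrFun (iter_deriv_inv_linear_sub (𝕜 := ℂ) m 1 1) 2
  rw [← iteratedDeriv_eq_iterate] at h
  simp only [one_mul, one_pow, mul_one] at h
  rw [iteratedDeriv_const_mul_field, h]
  norm_num
  ring

lemma estermann_series (Φ : ℂ → ℂ) (hΦ : Differentiable ℂ Φ) (a : ℕ → ℂ) (ha : 0 ≤ a)
    (ha1 : a 1 = 1) (hab : LSeries.abscissaOfAbsConv a ≤ 1)
    (hL : ∀ s : ℂ, 1 < s.re → LSeries a s = riemannZeta s * Φ s)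
    (C1 : ℝ) (hC1 : ∀ s ∈ Metric.closedBall (2 : ℂ) (4 / 3), ‖ZZ s‖ ≤ C1)
    (M : ℝ) (hM : ∀ s ∈ Metric.closedBall (2 : ℂ) (4 / 3), ‖Φ s‖ ≤ M)
    (β : ℝ) (hβ : 15 / 16 ≤ β) (hβ1 : β < 1) (hneg : (riemannZeta β * Φ β).re ≤ 0) (K : ℕ) (hK : 0 < K) :
    1 ≤ (Φ 1).re * (2 - β) ^ K / (1 - β) + 15 * (C1 + 1) * M * (4 / 5) ^ K := by
  set H : ℂ → ℂ := fun s => ZZ s * Φ s with hH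
  have hHd : Differentiable ℂ H := ZZ_diff.mul hΦ
  set G : ℂ → ℂ := dslope H 1 with hG
  have hGd : Differentiable ℂ G := by
    rw [← differentiableOn_univ, hG, Complex.differentiableOn_dslope Filter.univ_mem]
    exact hHd.differentiableOn
  have hH1 : H 1 = Φ 1 := by simp [hH, ZZ_one]
  have hGs : ∀ s : ℂ, s ≠ 1 → G s = (s - 1)⁻¹ * (H s - Φ 1) := by
    intro s hs
    rw [hG, dslope_of_ne _ hs, slope_def_field, hH1, div_eq_inv_mul]
  have hF : ∀ s : ℂ, s ≠ 1 → riemannZeta s * Φ s = G s + Φ 1 * (s - 1)⁻¹ := by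
    intro s hs
    have h0 : s - 1 ≠ 0 := sub_ne_zero.2 hs
    rw [hGs s hs]
    simp only [hH, ZZ_ne hs]
    field_simp
    ring
  set lam := (Φ 1).re with hlam
  -- Taylor coefficients
  have hopen : IsOpen {s : ℂ | 1 < s.re} := continuous_re.isOpen_preimage _ isOpen_Ioi
  have h2mem : (2 : ℂ) ∈ {s : ℂ | 1 < s.re} := by simp
  have hcoef : ∀ m : ℕ, iteratedDeriv m (LSeries a) 2 =
      iteratedDeriv m G 2 + (-1) ^ m * m ! * Φ 1 := by
    intro m
    have e : Set.EqOn (LSeries a) (fun s => G s + Φ 1 * (s - 1)⁻¹) {s : ℂ | 1 < s.re} := by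
      intro s hs
      have hs1 : (1 : ℝ) < s.re := hs
      have : s ≠ 1 := by rintro rfl; simp at hs1
      simp only [hL s hs1, hF s this]
    rw [e.iteratedDeriv_of_isOpen hopen m h2mem, ← iteratedDeriv_inv_sub_one]
    have hc : ContDiffAt ℂ m (fun s : ℂ => Φ 1 * (s - 1)⁻¹) 2 := by
      refine contDiffAt_const.mul (ContDiffAt.inv (by fun_prop) (by norm_num))
    have := iteratedDeriv_add (n := m) (x := (2 : ℂ)) (hGd.contDiff.contDiffAt) hc
    exact this
  have hpos : ∀ m : ℕ, 0 ≤ ((-1) ^ m * iteratedDeriv m (LSeries a) 2).re := by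
    intro m
    have := LSeries.iteratedDeriv_alternating ha (x := 2)
      (lt_of_le_of_lt hab (by norm_cast)) m
    rw [ofReal_ofNat] at this
    exact (Complex.le_def.1 this).1
  have h20 : 1 ≤ (LSeries a 2).re := by
    have hs : LSeriesSummable a 2 := LSeriesSummable_of_abscissaOfAbsConv_lt_re
      (lt_of_le_of_lt hab (by norm_num; norm_cast))
    have h1 := hs.le_tsum 1 (fun n _ => by
      have := LSeries.term_nonneg (ha n) 2
      simpa using this)
    have h2 : LSeries.term a 2 1 = 1 := by simp [ha1]
    rw [h2] at h1
    have := (Complex.le_def.1 h1).1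
    simpa [LSeries] using this
  -- Cauchy
  have hM0 : 0 ≤ M := (norm_nonneg _).trans (hM 2 (by simp; norm_num))
  have hC10 : 0 ≤ C1 := (norm_nonneg _).trans (hC1 2 (by simp; norm_num))
  have hone : ‖Φ 1‖ ≤ M := hM 1 (by simp [dist_eq_norm]; norm_num)
  have hsph : ∀ z ∈ Metric.sphere (2 : ℂ) (4 / 3), ‖G z‖ ≤ 3 * (C1 + 1) * M := by
    intro z hz
    have hz' : ‖z - 2‖ = 4 / 3 := by simpa [dist_eq_norm] using hz
    have hb : z ∈ Metric.closedBall (2 : ℂ) (4 / 3) := Metric.sphere_subset_closedBall hz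
    have hd : 1 / 3 ≤ ‖z - 1‖ := by
      have := norm_sub_norm_le (z - 2) (-1)
      have e : z - 2 - -1 = z - 1 := by ring
      rw [e, norm_neg, norm_one, hz'] at this
      linarith
    have hz1 : z ≠ 1 := by rintro rfl; simp at hd; norm_num at hd
    rw [hGs z hz1, norm_mul, norm_inv]
    have h1 : ‖z - 1‖⁻¹ ≤ 3 := by
      rw [inv_le_comm₀ (by linarith) (by norm_num)]; linarith
    have h2 : ‖H z - Φ 1‖ ≤ C1 * M + M := by
      refine (norm_sub_le _ _).trans (add_le_add ?_ hone)
      simp only [hH, norm_mul]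
      exact mul_le_mul (hC1 z hb) (hM z hb) (norm_nonneg _) hC10
    calc _ ≤ 3 * (C1 * M + M) := mul_le_mul h1 h2 (norm_nonneg _) (by norm_num)
      _ = _ := by ring
  have hcauchy : ∀ m : ℕ, ‖iteratedDeriv m G 2‖ ≤ m ! * (3 * (C1 + 1) * M) / (4 / 3) ^ m :=
    fun m => Complex.norm_iteratedDeriv_le_of_forall_mem_sphere_norm_le m (by norm_num)
      hGd.diffContOnCl hsph
  -- the series
  have hsum := Complex.hasSum_taylorSeries_of_entire hGd 2 (β : ℂ)
  set t : ℕ → ℝ := fun m => ((m ! : ℂ)⁻¹ • ((β : ℂ) - 2) ^ m • iteratedDeriv m G 2).re with ht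
  have hsumt : HasSum t (G β).re := Complex.hasSum_re hsum
  have hte : ∀ m, t m = (2 - β) ^ m * ((m ! : ℝ)⁻¹ * ((-1) ^ m * iteratedDeriv m G 2).re) := by
    intro m
    have : (m ! : ℂ)⁻¹ • ((β : ℂ) - 2) ^ m • iteratedDeriv m G 2 =
        (((2 - β) ^ m * (m ! : ℝ)⁻¹ : ℝ) : ℂ) * ((-1) ^ m * iteratedDeriv m G 2) := by
      simp only [smul_eq_mul]
      push_cast
      have e : ((β : ℂ) - 2) ^ m = (-1) ^ m * (2 - β) ^ m := by rw [← mul_pow]; ring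
      rw [e]; ring
    simp only [ht, this, Complex.re_ofReal_mul]
    ring
  have hq : 0 < 2 - β := by linarith
  have hlow : ∀ m, (2 - β) ^ m * (-lam) ≤ t m := by
    intro m
    rw [hte m]
    refine mul_le_mul_of_nonneg_left ?_ (by positivity)
    have h1 := hpos m
    rw [hcoef m, mul_add] at h1
    have e : (-1 : ℂ) ^ m * ((-1) ^ m * m ! * Φ 1) = ((m ! : ℝ) : ℂ) * Φ 1 := by
      rw [← mul_assoc, ← mul_assoc, ← mul_pow]; simp
    rw [e, add_re, Complex.re_ofReal_mul] at h1
    have hm : (0 : ℝ) < m ! := by positivity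
    rw [inv_mul_eq_div, le_div_iff₀ hm]
    linarith
  have hlow0 : 1 - lam ≤ t 0 := by
    rw [hte 0]
    have h1 := hcoef 0
    simp only [iteratedDeriv_zero, pow_zero, Nat.factorial_zero, Nat.cast_one, one_mul] at h1
    simp only [iteratedDeriv_zero, pow_zero, Nat.factorial_zero, Nat.cast_one, one_mul, inv_one]
    rw [h1, add_re] at h20
    linarith
  have htail : ∀ m, -(3 * (C1 + 1) * M) * (4 / 5) ^ m ≤ t m := by
    intro m
    have h1 : ‖(m ! : ℂ)⁻¹ • ((β : ℂ) - 2) ^ m • iteratedDeriv m G 2‖ ≤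
        (3 * (C1 + 1) * M) * (4 / 5) ^ m := by
      have hb : ‖(β : ℂ) - 2‖ = 2 - β := by
        rw [← ofReal_ofNat, ← ofReal_sub, Complex.norm_real, Real.norm_eq_abs, abs_of_neg (by linarith)]
        ring
      rw [norm_smul, norm_smul, norm_pow, hb, norm_inv, Complex.norm_natCast]
      have hm : (0 : ℝ) < m ! := by positivity
      calc _ ≤ (m ! : ℝ)⁻¹ * ((2 - β) ^ m * (m ! * (3 * (C1 + 1) * M) / (4 / 3) ^ m)) := by
            gcongr; exact hcauchy m
        _ = (3 * (C1 + 1) * M) * ((2 - β) * (3 / 4)) ^ m := by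
            rw [mul_pow, show ((3 : ℝ) / 4) = (4 / 3)⁻¹ by norm_num, inv_pow]
            field_simp
        _ ≤ _ := by
            gcongr
            linarith
    have := (abs_le.1 ((Complex.abs_re_le_norm _).trans h1)).1
    simp only [ht]
    linarith
  have hsplit := hsumt.summable.sum_add_tsum_nat_add K
  rw [hsumt.tsum_eq] at hsplit
  have hgeo : HasSum (fun m : ℕ => -(3 * (C1 + 1) * M) * (4 / 5 : ℝ) ^ (m + K))
      (-(15 * (C1 + 1) * M) * (4 / 5) ^ K) := by
    have := (hasSum_geometric_of_lt_one (r := (4 / 5 : ℝ)) (by norm_num) (by norm_num)).mul_left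
      (-(3 * (C1 + 1) * M) * (4 / 5) ^ K)
    convert! this using 1
    · ext m; rw [pow_add]; ring
    · norm_num; ring
  have hT : -(15 * (C1 + 1) * M) * (4 / 5) ^ K ≤ ∑' m, t (m + K) := by
    rw [← hgeo.tsum_eq]
    exact hgeo.summable.tsum_le_tsum (fun m => htail (m + K))
      ((summable_nat_add_iff K).2 hsumt.summable)
  have hP : 1 - lam * (((2 - β) ^ K - 1) / (1 - β)) ≤ ∑ m ∈ Finset.range K, t m := by
    obtain ⟨k, rfl⟩ : ∃ k, K = k + 1 := ⟨K - 1, by omega⟩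
    have hg : ∑ m ∈ Finset.range (k + 1), (2 - β) ^ m = ((2 - β) ^ (k + 1) - 1) / (1 - β) := by
      rw [geom_sum_eq (by linarith)]; congr 1; ring
    rw [← hg, Finset.sum_range_succ' t, Finset.sum_range_succ' (fun m => (2 - β) ^ m)]
    have : ∑ m ∈ Finset.range k, (2 - β) ^ (m + 1) * (-lam) ≤ ∑ m ∈ Finset.range k, t (m + 1) :=
      Finset.sum_le_sum fun m _ => hlow (m + 1)
    rw [← Finset.sum_mul] at this
    rw [pow_zero]
    linarith
  have hFβ := hF β (by exact_mod_cast hβ1.ne)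
  rw [hFβ, add_re] at hneg
  have e : (Φ 1 * ((β : ℂ) - 1)⁻¹).re = - (lam / (1 - β)) := by
    have e0 : ((β : ℂ) - 1)⁻¹ = (((β - 1)⁻¹ : ℝ) : ℂ) := by push_cast; rfl
    rw [e0, Complex.re_mul_ofReal, ← hlam, ← neg_sub 1 β, inv_neg]
    rw [div_eq_mul_inv]; ring
  rw [e] at hneg
  have e2 : lam * (2 - β) ^ K / (1 - β) = lam * (((2 - β) ^ K - 1) / (1 - β)) + lam / (1 - β) := by
    ring
  rw [e2]
  linarith

lemma estermann : ∃ C2 : ℝ, 0 < C2 ∧ ∀ (Φ : ℂ → ℂ) (_ : Differentiable ℂ Φ) (a : ℕ → ℂ) (_ : 0 ≤ a)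
    (_ : a 1 = 1) (_ : LSeries.abscissaOfAbsConv a ≤ 1)
    (_ : ∀ s : ℂ, 1 < s.re → LSeries a s = riemannZeta s * Φ s)
    (M : ℝ) (_ : 1 ≤ M) (_ : ∀ s ∈ Metric.closedBall (2 : ℂ) (4 / 3), ‖Φ s‖ ≤ M)
    (β : ℝ) (_ : 15 / 16 ≤ β) (_ : β < 1) (_ : (riemannZeta β * Φ β).re ≤ 0),
    1 - β ≤ C2 * M ^ (5 * (1 - β)) * (Φ 1).re := by
  obtain ⟨C1, hC1⟩ := (isCompact_closedBall (2 : ℂ) (4 / 3)).exists_bound_of_continuousOn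
    ZZ_diff.continuous.continuousOn
  have hC10 : 0 ≤ C1 := (norm_nonneg _).trans (hC1 2 (by simp; norm_num))
  set C3 : ℝ := 30 * (C1 + 1) with hC3
  have hC31 : 1 ≤ C3 := by rw [hC3]; linarith
  refine ⟨2 * (Real.exp 1 * C3 ^ 5), by positivity, ?_⟩
  intro Φ hΦ a ha ha1 hab hL M hM1 hM β hβ hβ1 hneg
  set K : ℕ := ⌈5 * Real.log (C3 * M)⌉₊ + 1 with hK
  have h := estermann_series Φ hΦ a ha ha1 hab hL C1 hC1 M hM β hβ hβ1 hneg K (by omega)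
  have hCM : 1 ≤ C3 * M := one_le_mul_of_one_le_of_one_le hC31 hM1
  have hlog0 : 0 ≤ Real.log (C3 * M) := Real.log_nonneg hCM
  have hK1 : 5 * Real.log (C3 * M) ≤ K := by
    rw [hK]; push_cast
    linarith [Nat.le_ceil (5 * Real.log (C3 * M))]
  have hK2 : (K : ℝ) ≤ 5 * Real.log (C3 * M) + 2 := by
    rw [hK]; push_cast
    linarith [Nat.ceil_lt_add_one (show 0 ≤ 5 * Real.log (C3 * M) by positivity)]
  have ht : 15 * (C1 + 1) * M * (4 / 5) ^ K ≤ 1 / 2 := by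
    have h1 : ((4 : ℝ) / 5) ^ K ≤ (C3 * M)⁻¹ := by
      rw [← Real.exp_log (show (0 : ℝ) < C3 * M by linarith), ← Real.exp_neg]
      have h2 : (4 / 5 : ℝ) ≤ Real.exp (-(1 / 5)) := by
        have := Real.add_one_le_exp (-(1 / 5) : ℝ)
        linarith
      calc ((4 : ℝ) / 5) ^ K ≤ (Real.exp (-(1 / 5))) ^ K := by gcongr
        _ = Real.exp (K * (-(1 / 5))) := by rw [Real.exp_nat_mul]
        _ ≤ _ := by
            apply Real.exp_le_exp.2
            linarith
    have e : 15 * (C1 + 1) * M = (C3 * M) / 2 := by rw [hC3]; ring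
    rw [e]
    calc _ ≤ C3 * M / 2 * (C3 * M)⁻¹ := by gcongr
      _ = 1 / 2 := by field_simp
  have h1 : 1 / 2 ≤ (Φ 1).re * (2 - β) ^ K / (1 - β) := by linarith
  have hb : 0 < 1 - β := by linarith
  have hlam : 0 < (Φ 1).re := by
    by_contra hcon
    push Not at hcon
    have : (Φ 1).re * (2 - β) ^ K / (1 - β) ≤ 0 :=
      div_nonpos_of_nonpos_of_nonneg (mul_nonpos_of_nonpos_of_nonneg hcon (pow_nonneg (by linarith) _)) hb.le
    linarith
  have hpw : (2 - β) ^ K ≤ Real.exp 1 * C3 ^ 5 * M ^ (5 * (1 - β)) := by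
    calc (2 - β) ^ K ≤ (Real.exp (1 - β)) ^ K := by
          have := Real.add_one_le_exp (1 - β)
          refine pow_le_pow_left₀ (by linarith) (by linarith) K
      _ = Real.exp (K * (1 - β)) := by rw [Real.exp_nat_mul]
      _ ≤ Real.exp (1 + Real.log (C3 * M) * (5 * (1 - β))) := by
          apply Real.exp_le_exp.2
          nlinarith
      _ = Real.exp 1 * (C3 * M) ^ (5 * (1 - β)) := by
          rw [Real.exp_add, Real.rpow_def_of_pos (by linarith)]
      _ = Real.exp 1 * (C3 ^ (5 * (1 - β)) * M ^ (5 * (1 - β))) := by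
          rw [Real.mul_rpow (by linarith) (by linarith)]
      _ ≤ Real.exp 1 * (C3 ^ (5 : ℝ) * M ^ (5 * (1 - β))) := by
          gcongr
          linarith
      _ = _ := by
          rw [show (5 : ℝ) = ((5 : ℕ) : ℝ) by norm_num, Real.rpow_natCast]
          ring
  rw [div_le_div_iff₀ (by norm_num) hb] at h1
  calc 1 - β ≤ 2 * ((Φ 1).re * (2 - β) ^ K) := by linarith
    _ ≤ 2 * ((Φ 1).re * (Real.exp 1 * C3 ^ 5 * M ^ (5 * (1 - β)))) := by gcongr
    _ = _ := by ring

end HB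


set_option linter.unusedSectionVars false
set_option linter.deprecated false

namespace HB
open Filter Topology Complex DirichletCharacter MeasureTheory

variable {q : ℕ} [NeZero q] (χ : DirichletCharacter ℂ q)

lemma char_sum_period (hχ : χ ≠ 1) (c : ℕ) : ∑ k ∈ Finset.range q, χ ((c + k : ℕ) : ZMod q) = 0 := by
  induction c with
  | zero =>
    rw [← MulChar.sum_eq_zero_of_ne_one hχ]
    refine Finset.sum_nbij' (fun k => (k : ZMod q)) ZMod.val ?_ ?_ ?_ ?_ ?_
    · simp
    · intro a _; simpa using ZMod.val_lt a
    · intro a ha; exact ZMod.val_cast_of_lt (by simpa using ha)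
    · intro a _; simp
    · intro a _; simp
  | succ c ih =>
    have h1 := Finset.sum_range_succ (fun k => χ ((c + k : ℕ) : ZMod q)) q
    have h2 := Finset.sum_range_succ' (fun k => χ ((c + k : ℕ) : ZMod q)) q
    rw [h1, ih] at h2
    have : ∀ k, c + 1 + k = c + (k + 1) := by intro k; ring
    simp only [this]
    have h3 : χ ((c + q : ℕ) : ZMod q) = χ ((c + 0 : ℕ) : ZMod q) := by simp
    rw [h3] at h2
    have := add_right_cancel h2
    exact this.symm

noncomputable def SS (n : ℕ) : ℂ := ∑ k ∈ Finset.Icc 1 n, χ (k : ZMod q)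

lemma SS_eq (n : ℕ) : SS χ n = ∑ k ∈ Finset.range n, χ ((1 + k : ℕ) : ZMod q) := by
  unfold SS
  induction n with
  | zero => simp
  | succ n ih => rw [Finset.sum_Icc_succ_top (by omega), Finset.sum_range_succ, ih, add_comm n 1]

lemma norm_SS_le (n : ℕ) : ‖SS χ n‖ ≤ n := by
  unfold SS
  refine (norm_sum_le _ _).trans ?_
  refine (Finset.sum_le_sum (fun k _ => norm_le_one χ _)).trans ?_
  simp

lemma norm_SS_le_q (hχ : χ ≠ 1) (n : ℕ) : ‖SS χ n‖ ≤ q := by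
  induction n using Nat.strong_induction_on with
  | _ n ih =>
    by_cases h : n < q
    · exact (norm_SS_le χ n).trans (by exact_mod_cast h.le)
    · push Not at h
      obtain ⟨m, rfl⟩ := Nat.exists_eq_add_of_le' h
      have hq : 0 < q := Nat.pos_of_ne_zero (NeZero.ne q)
      have : SS χ (m + q) = SS χ m := by
        rw [SS_eq, SS_eq, Finset.sum_range_add]
        have := char_sum_period χ hχ (1 + m)
        simp only [← add_assoc]
        rw [this, add_zero]
      rw [this]
      exact ih m (by omega)

noncomputable def gS (t : ℝ) : ℂ := Set.indicator (Set.Ioi 1) (fun t => SS χ ⌊t⌋₊) t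

lemma gS_meas : Measurable (gS χ) := by
  unfold gS
  apply Measurable.indicator _ measurableSet_Ioi
  exact (measurable_from_nat (f := SS χ)).comp Nat.measurable_floor

lemma gS_norm_le (hχ : χ ≠ 1) (t : ℝ) : ‖gS χ t‖ ≤ q := by
  unfold gS
  rw [Set.indicator]
  split_ifs
  · exact norm_SS_le_q χ hχ _
  · simp

lemma mellin_gS (s : ℂ) : mellin (gS χ) (-s) = ∫ t in Set.Ioi (1:ℝ), SS χ ⌊t⌋₊ * (t:ℂ) ^ (-(s+1)) := by
  unfold mellin gS
  have h1 : ∀ t : ℝ, (t:ℂ)^(-s-1) • (Set.Ioi (1:ℝ)).indicator (fun t => SS χ ⌊t⌋₊) t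
      = (Set.Ioi (1:ℝ)).indicator (fun t => SS χ ⌊t⌋₊ * (t:ℂ) ^ (-(s+1))) t := by
    intro t
    simp only [Set.indicator]
    split_ifs
    · rw [smul_eq_mul, mul_comm]; congr 2; ring
    · simp
  simp only [h1]
  rw [setIntegral_indicator measurableSet_Ioi]
  congr 2
  ext t; simp

lemma mellin_gS_diff (hχ : χ ≠ 1) (s : ℂ) (hs : 0 < s.re) : DifferentiableAt ℂ (mellin (gS χ)) (-s) := by
  refine mellin_differentiableAt_of_isBigO_rpow (a := 0) (b := -s.re - 1) ?_ ?_ ?_ ?_ ?_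
  · refine LocallyIntegrable.locallyIntegrableOn ?_ _
    have : LocallyIntegrable (fun _ : ℝ => (q:ℝ)) := continuous_const.locallyIntegrable
    refine this.mono (gS_meas χ).aestronglyMeasurable (Eventually.of_forall ?_)
    intro t
    simpa using gS_norm_le χ hχ t
  · simp only [neg_zero, Real.rpow_zero]
    refine Asymptotics.IsBigO.of_bound q (Eventually.of_forall ?_)
    intro t; simpa using gS_norm_le χ hχ t
  · simpa using hs
  · refine Asymptotics.IsBigO.of_bound 1 ?_
    have : Set.Ioo (0:ℝ) 1 ∈ 𝓝[>] (0:ℝ) := Ioo_mem_nhdsGT (by norm_num)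
    filter_upwards [this] with t ht
    have : gS χ t = 0 := by
      unfold gS; rw [Set.indicator_of_notMem]; simp; exact ht.2.le
    rw [this]; simp
  · simp

lemma LFunction_eq_integral (hχ : χ ≠ 1) (s : ℂ) (hs : 0 < s.re) :
    LFunction χ s = s * ∫ t in Set.Ioi (1:ℝ), SS χ ⌊t⌋₊ * (t:ℂ) ^ (-(s+1)) := by
  rw [← mellin_gS]
  have hU : IsOpen {s : ℂ | 0 < s.re} := isOpen_lt continuous_const Complex.continuous_re
  have hA : AnalyticOnNhd ℂ (LFunction χ) {s : ℂ | 0 < s.re} :=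
    (differentiable_LFunction hχ).differentiableOn.analyticOnNhd hU
  have hB : AnalyticOnNhd ℂ (fun s => s * mellin (gS χ) (-s)) {s : ℂ | 0 < s.re} := by
    refine DifferentiableOn.analyticOnNhd ?_ hU
    intro s hs
    refine DifferentiableAt.differentiableWithinAt ?_
    refine differentiableAt_id.mul ?_
    exact DifferentiableAt.comp (g := mellin (gS χ)) s (mellin_gS_diff χ hχ s hs) differentiableAt_id.neg
  have hP : IsPreconnected {s : ℂ | 0 < s.re} := (convex_halfSpace_re_gt 0).isPreconnected
  refine hA.eqOn_of_preconnected_of_eventuallyEq hB hP (z₀ := 2) (by simp) ?_ hs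
  have hV : IsOpen {s : ℂ | 1 < s.re} := isOpen_lt continuous_const Complex.continuous_re
  filter_upwards [hV.mem_nhds (show (2:ℂ) ∈ {s : ℂ | 1 < s.re} by simp)] with s hs
  have hs : 1 < s.re := hs
  rw [LFunction_eq_LSeries χ hs, mellin_gS]
  rw [LSeries_eq_mul_integral' _ zero_le_one hs]
  · rfl
  · refine Asymptotics.IsBigO.of_bound 1 (Eventually.of_forall ?_)
    intro n
    simp only [Real.rpow_one, one_mul]
    rw [Real.norm_of_nonneg (Finset.sum_nonneg (fun _ _ => norm_nonneg _)), Real.norm_natCast]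
    refine (Finset.sum_le_sum (fun k _ => norm_le_one χ _)).trans ?_
    simp

lemma norm_LFunction_le (hχ : χ ≠ 1) (s : ℂ) (hs : 0 < s.re) :
    ‖LFunction χ s‖ ≤ ‖s‖ * (q / s.re) := by
  rw [LFunction_eq_integral χ hχ s hs, norm_mul]
  refine mul_le_mul_of_nonneg_left ?_ (norm_nonneg _)
  have hI : IntegrableOn (fun t : ℝ => (q:ℝ) * t ^ (-(s.re + 1))) (Set.Ioi 1) :=
    (integrableOn_Ioi_rpow_of_lt (by linarith) one_pos).const_mul _
  refine (norm_integral_le_of_norm_le hI ?_).trans ?_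
  · filter_upwards [ae_restrict_mem measurableSet_Ioi] with t ht
    have ht : (1:ℝ) < t := ht
    rw [norm_mul, Complex.norm_cpow_eq_rpow_re_of_pos (by linarith)]
    have : (-(s+1)).re = -(s.re+1) := by simp
    rw [this]
    exact mul_le_mul_of_nonneg_right (norm_SS_le_q χ hχ _) (by positivity)
  · rw [integral_const_mul, integral_Ioi_rpow_of_lt (by linarith) one_pos]
    simp [div_eq_mul_inv]

end HB


set_option linter.unusedSectionVars false
set_option linter.deprecated false

namespace HB
open Filter Topology Complex DirichletCharacter MeasureTheory

variable {q : ℕ} [NeZero q] (χ : DirichletCharacter ℂ q)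

lemma chi_zero (hχ : χ ≠ 1) : χ ((0:ℕ) : ZMod q) = 0 := by
  have hq : q ≠ 1 := by
    rintro rfl
    exact hχ (level_one χ)
  have : Nontrivial (ZMod q) := by
    have h0 := NeZero.ne q
    exact ZMod.nontrivial_iff.mpr hq
  simp
  exact χ.map_nonunit not_isUnit_zero

lemma sum_Icc_zero (hχ : χ ≠ 1) (n : ℕ) : ∑ k ∈ Finset.Icc 0 n, χ (k : ZMod q) = SS χ n := by
  rw [SS, ← Finset.sum_Ioc_add_eq_sum_Icc (Nat.zero_le n), chi_zero χ hχ, add_zero]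
  rfl

lemma tendsto_L_one (hχ : χ ≠ 1) :
    Tendsto (fun n : ℕ => ∑ k ∈ Finset.Icc 1 n, (k:ℂ)⁻¹ * χ (k : ZMod q)) atTop (𝓝 (LFunction χ 1)) := by
  have hder : ∀ t : ℝ, t ≠ 0 → HasDerivAt (fun t : ℝ => (t:ℂ)⁻¹) (-((t:ℂ)^2)⁻¹) t := by
    intro t ht
    have := (hasDerivAt_inv (show (t:ℂ) ≠ 0 by exact_mod_cast ht)).comp_ofReal
    exact this
  have hderiv : ∀ t : ℝ, t ≠ 0 → deriv (fun t : ℝ => (t:ℂ)⁻¹) t = -((t:ℂ)^2)⁻¹ := fun t ht => (hder t ht).deriv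
  have key := tendsto_sum_mul_atTop_nhds_one_sub_integral₀ (𝕜 := ℂ) (f := fun t : ℝ => (t:ℂ)⁻¹)
    (c := fun k => χ (k : ZMod q)) (l := 0) (g := fun t => t ^ (-2:ℝ)) (chi_zero χ hχ) ?_ ?_ ?_ ?_ ?_
  · have e1 : (fun n : ℕ => ∑ k ∈ Finset.Icc 0 n, (((k:ℝ):ℂ))⁻¹ * χ (k : ZMod q)) =
      fun n : ℕ => ∑ k ∈ Finset.Icc 1 n, (k:ℂ)⁻¹ * χ (k : ZMod q) := by
      ext n
      rw [← Finset.sum_Ioc_add_eq_sum_Icc (Nat.zero_le n)]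
      simp
      rfl
    rw [e1] at key
    convert! key using 2
    rw [LFunction_eq_integral χ hχ 1 (by simp), one_mul, zero_sub, ← integral_neg]
    refine setIntegral_congr_fun measurableSet_Ioi ?_
    intro t ht
    have ht : (1:ℝ) < t := ht
    simp only
    rw [sum_Icc_zero χ hχ, hderiv t (by linarith), show (-(1+1):ℂ) = ((-2:ℤ):ℂ) by norm_num, cpow_intCast]
    rw [zpow_neg]
    simp [mul_comm]
  · intro t ht
    have ht : (1:ℝ) ≤ t := ht
    exact (hder t (by linarith)).differentiableAt
  · refine ContinuousOn.locallyIntegrableOn ?_ measurableSet_Ici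
    have : ContinuousOn (fun t : ℝ => -((t:ℂ)^2)⁻¹) (Set.Ici 1) := by
      refine ContinuousOn.neg (ContinuousOn.inv₀ (by fun_prop) ?_)
      intro t ht
      have ht : (1:ℝ) ≤ t := ht
      have : (t:ℂ) ≠ 0 := by exact_mod_cast (by linarith : t ≠ 0)
      positivity
    refine this.congr ?_
    intro t ht
    have ht : (1:ℝ) ≤ t := ht
    exact hderiv t (by linarith)
  · rw [tendsto_zero_iff_norm_tendsto_zero]
    have h0 : Tendsto (fun n : ℕ => (q:ℝ) / n) atTop (𝓝 0) := tendsto_const_div_atTop_nhds_zero_nat _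
    refine squeeze_zero (fun _ => norm_nonneg _) ?_ h0
    intro n
    rw [sum_Icc_zero χ hχ, norm_mul, norm_inv, mul_comm, div_eq_mul_inv]
    refine mul_le_mul (norm_SS_le_q χ hχ n) ?_ (by positivity) (by positivity)
    simp
  · refine Asymptotics.IsBigO.of_bound q ?_
    filter_upwards [eventually_ge_atTop 1] with t ht
    rw [sum_Icc_zero χ hχ, hderiv t (by linarith), norm_mul, norm_neg, norm_inv, mul_comm]
    refine mul_le_mul (norm_SS_le_q χ hχ _) ?_ (by positivity) (by positivity)
    rw [Real.rpow_neg (by linarith)]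
    simp
  · refine ⟨Set.Ioi 1, Ioi_mem_atTop 1, ?_⟩
    exact integrableOn_Ioi_rpow_of_lt (by norm_num) one_pos

/-- discrete Abel summation bound -/
lemma abel_bound (c : ℕ → ℂ) (N : ℕ) (hN : 1 ≤ N) (θ B : ℝ) (hθ : 0 ≤ θ) (hB : 0 ≤ B)
    (h : ∀ m, N ≤ m → ‖∑ k ∈ Finset.Ioc N m, c k‖ ≤ θ * (m - N) + B) (M : ℕ) (hM : N ≤ M) :
    ‖∑ k ∈ Finset.Ioc N M, (k:ℂ)⁻¹ * c k‖ ≤ B / N + θ * ∑ k ∈ Finset.Ioc N M, (k:ℝ)⁻¹ := by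
  have e : ∀ M, N ≤ M → ‖∑ k ∈ Finset.Ioc N M, (k:ℂ)⁻¹ * c k - ((M:ℂ)+1)⁻¹ * ∑ k ∈ Finset.Ioc N M, c k‖
      ≤ B * ((N:ℝ)⁻¹ - ((M:ℝ)+1)⁻¹) + θ * (∑ k ∈ Finset.Ioc N M, (k:ℝ)⁻¹ - (M - N)*((M:ℝ)+1)⁻¹) := by
    intro M hM
    induction M, hM using Nat.le_induction with
    | base =>
      simp
      apply mul_nonneg hB
      have : (0:ℝ) < N := by exact_mod_cast hN
      rw [sub_nonneg]
      exact inv_anti₀ this (by linarith)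
    | succ M hM ih =>
      rw [Finset.sum_Ioc_succ_top hM, Finset.sum_Ioc_succ_top hM, Finset.sum_Ioc_succ_top hM]
      have hMp : (0:ℝ) < M := by exact_mod_cast (by omega : 0 < M)
      have hs := h (M+1) (by omega)
      rw [Finset.sum_Ioc_succ_top hM] at hs
      set A := ∑ k ∈ Finset.Ioc N M, (k:ℂ)⁻¹ * c k
      set S := ∑ k ∈ Finset.Ioc N M, c k
      set H := ∑ k ∈ Finset.Ioc N M, (k:ℝ)⁻¹
      have e1 : A + (((M+1:ℕ)):ℂ)⁻¹ * c (M+1) - ((((M+1:ℕ)):ℂ)+1)⁻¹ * (S + c (M+1))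
        = (A - ((M:ℂ)+1)⁻¹ * S) + ((((M:ℝ)+1)⁻¹ - ((M:ℝ)+2)⁻¹ : ℝ):ℂ) * (S + c (M+1)) := by
        push_cast
        rw [show ((M:ℂ)+1+1) = M + 2 by ring]
        ring
      rw [e1]
      refine (norm_add_le _ _).trans ?_
      have hd : (0:ℝ) ≤ ((M:ℝ)+1)⁻¹ - ((M:ℝ)+2)⁻¹ := by
        rw [sub_nonneg]; exact inv_anti₀ (by linarith) (by linarith)
      rw [norm_mul, Complex.norm_real, Real.norm_of_nonneg hd]
      have h2 := mul_le_mul_of_nonneg_left hs hd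
      refine (add_le_add ih h2).trans (le_of_eq ?_)
      push_cast
      rw [show ((M:ℝ)+1+1) = M + 2 by ring]
      have h1 : (M:ℝ)+1 ≠ 0 := by positivity
      have h2 : (M:ℝ)+2 ≠ 0 := by positivity
      have h3 : (N:ℝ) ≠ 0 := by exact_mod_cast (by omega)
      field_simp
      ring
  have h1 := e M hM
  have h2 := h M hM
  have hMp : (0:ℝ) < M := by exact_mod_cast (by omega : 0 < M)
  have h3 : ‖((M:ℂ)+1)⁻¹ * ∑ k ∈ Finset.Ioc N M, c k‖ ≤ ((M:ℝ)+1)⁻¹ * (θ * (M - N) + B) := by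
    rw [norm_mul, norm_inv]
    have : ‖(M:ℂ)+1‖ = (M:ℝ)+1 := by
      rw [show (M:ℂ)+1 = ((M+1:ℕ):ℂ) by push_cast; rfl, Complex.norm_natCast]; push_cast; rfl
    rw [this]
    exact mul_le_mul_of_nonneg_left h2 (by positivity)
  have h4 := norm_add_le (∑ k ∈ Finset.Ioc N M, (k:ℂ)⁻¹ * c k - ((M:ℂ)+1)⁻¹ * ∑ k ∈ Finset.Ioc N M, c k) (((M:ℂ)+1)⁻¹ * ∑ k ∈ Finset.Ioc N M, c k)
  rw [sub_add_cancel] at h4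
  refine h4.trans ((add_le_add h1 h3).trans (le_of_eq ?_))
  rw [div_eq_mul_inv]
  ring

lemma L_one_tail (hχ : χ ≠ 1) (N : ℕ) (hN : 1 ≤ N) :
    ‖LFunction χ 1 - ∑ k ∈ Finset.Icc 1 N, (k:ℂ)⁻¹ * χ (k : ZMod q)‖ ≤ 2 * q / N := by
  have h := (tendsto_L_one χ hχ).sub_const (∑ k ∈ Finset.Icc 1 N, (k:ℂ)⁻¹ * χ (k : ZMod q))
  refine le_of_tendsto h.norm ?_
  filter_upwards [eventually_ge_atTop N] with M hM
  have e1 : ∀ f : ℕ → ℂ, ∀ m, N ≤ m → ∑ k ∈ Finset.Icc 1 m, f k - ∑ k ∈ Finset.Icc 1 N, f k = ∑ k ∈ Finset.Ioc N m, f k := by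
    intro f m hm
    rw [sub_eq_iff_eq_add, add_comm]
    exact (Finset.sum_Ioc_consecutive f (Nat.zero_le N) hm).symm
  rw [e1 _ M hM]
  have := abel_bound (fun k => χ (k : ZMod q)) N hN 0 (2*q) le_rfl (by positivity) ?_ M hM
  · simpa using this
  · intro m hm
    rw [← e1 _ m hm]
    have h1 := norm_SS_le_q χ hχ m
    have h2 := norm_SS_le_q χ hχ N
    have := norm_sub_le (SS χ m) (SS χ N)
    rw [zero_mul, zero_add]
    unfold SS at *
    linarith

lemma sum_inv_le (N : ℕ) (hN : 1 ≤ N) : ∑ k ∈ Finset.Icc 1 N, (k:ℝ)⁻¹ ≤ 1 + Real.log N := by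
  have := harmonic_le_one_add_log N
  rw [harmonic_eq_sum_Icc] at this
  push_cast at this
  exact this

lemma norm_L_one_le (hχ : χ ≠ 1) : ‖LFunction χ 1‖ ≤ 3 + Real.log q := by
  have hq : 1 ≤ q := Nat.pos_of_ne_zero (NeZero.ne q)
  have h1 := L_one_tail χ hχ q hq
  have h2 : ‖∑ k ∈ Finset.Icc 1 q, (k:ℂ)⁻¹ * χ (k : ZMod q)‖ ≤ 1 + Real.log q := by
    refine (norm_sum_le _ _).trans (le_trans ?_ (sum_inv_le q hq))
    refine Finset.sum_le_sum fun k _ => ?_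
    rw [norm_mul, norm_inv, Complex.norm_natCast]
    exact mul_le_of_le_one_right (by positivity) (norm_le_one χ _)
  have h3 : (2 * q / q : ℝ) = 2 := by
    have : (q:ℝ) ≠ 0 := by exact_mod_cast NeZero.ne q
    field_simp
  rw [h3] at h1
  have h4 := norm_add_le (LFunction χ 1 - ∑ k ∈ Finset.Icc 1 q, (k:ℂ)⁻¹ * χ (k : ZMod q)) (∑ k ∈ Finset.Icc 1 q, (k:ℂ)⁻¹ * χ (k : ZMod q))
  rw [sub_add_cancel] at h4
  linarith

end HB


set_option linter.unusedSectionVars false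
set_option linter.deprecated false

namespace HB
open Filter Topology Complex DirichletCharacter MeasureTheory
open scoped ComplexOrder

section
variable {q : ℕ} [NeZero q] {χ : DirichletCharacter ℂ q}

lemma quad_star (h2 : χ ^ 2 = 1) (a : ZMod q) : (starRingEnd ℂ) (χ a) = χ a := by
  rcases MulChar.isQuadratic_iff_sq_eq_one.mpr h2 a with h | h | h <;> simp [h]

lemma L_conj (hχ : χ ≠ 1) (h2 : χ ^ 2 = 1) (s : ℝ) (hs : 0 < s) :
    (starRingEnd ℂ) (LFunction χ s) = LFunction χ s := by
  rw [LFunction_eq_integral χ hχ s (by simpa using hs), map_mul, ← integral_conj, conj_ofReal]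
  congr 1
  refine setIntegral_congr_fun measurableSet_Ioi ?_
  intro t ht
  have ht : (1:ℝ) < t := ht
  simp only [map_mul]
  congr 1
  · unfold SS
    rw [map_sum]
    exact Finset.sum_congr rfl (fun k _ => quad_star h2 _)
  · rw [show (-((s:ℂ)+1)) = ((-(s+1):ℝ):ℂ) by push_cast; rfl, ← ofReal_cpow (by linarith), conj_ofReal]

lemma L_im (hχ : χ ≠ 1) (h2 : χ ^ 2 = 1) (s : ℝ) (hs : 0 < s) : (LFunction χ s).im = 0 :=
  conj_eq_iff_im.mp (L_conj hχ h2 s hs)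

lemma L_zero_of_nonpos (hχ : χ ≠ 1) (h2 : χ ^ 2 = 1) (s : ℝ) (hs : 0 < s) (h : (LFunction χ s).re ≤ 0) :
    ∃ β : ℝ, s ≤ β ∧ β < 1 ∧ LFunction χ β = 0 := by
  have hc : Continuous (fun x : ℝ => (LFunction χ x).re) :=
    Complex.continuous_re.comp ((differentiable_LFunction hχ).continuous.comp continuous_ofReal)
  have hlim : Tendsto (fun x : ℝ => LSeries (fun n : ℕ => χ (n : ZMod q)) x) atTop (𝓝 (χ ((1:ℕ) : ZMod q))) := by
    refine LSeries.tendsto_atTop ?_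
    refine lt_of_le_of_lt (b := ((1:ℝ):EReal)) ?_ (EReal.coe_lt_top 1)
    refine LSeries.abscissaOfAbsConv_le_of_forall_lt_LSeriesSummable ?_
    intro y hy
    exact ZMod.LSeriesSummable_of_one_lt_re χ (by simpa using hy)
  have hre := (Complex.continuous_re.tendsto _).comp hlim
  simp at hre
  have hev := (hre.eventually (lt_mem_nhds (show (0:ℝ) < 1 by norm_num)))
  obtain ⟨x, hx1, hx2, hx3⟩ := (hev.and ((eventually_gt_atTop 1).and (eventually_gt_atTop s))).exists
  have hx4 : 0 < (LFunction χ x).re := by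
    rw [LFunction_eq_LSeries χ (by simpa using hx2)]; exact hx1
  obtain ⟨β, hβ, hβ2⟩ := intermediate_value_Icc hx3.le hc.continuousOn (show (0:ℝ) ∈ Set.Icc _ _ from ⟨h, hx4.le⟩)
  have hz : LFunction χ β = 0 := Complex.ext hβ2 (L_im hχ h2 β (lt_of_lt_of_le hs hβ.1))
  refine ⟨β, hβ.1, ?_, hz⟩
  by_contra hcon
  push Not at hcon
  exact LFunction_ne_zero_of_one_le_re χ (.inl hχ) (by simpa using hcon) hz

lemma L_one_pos (hχ : χ ≠ 1) (h2 : χ ^ 2 = 1) : 0 < (LFunction χ 1).re := by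
  by_contra hcon
  push Not at hcon
  obtain ⟨β, h1, h2, _⟩ := L_zero_of_nonpos hχ h2 1 one_pos (by simpa using hcon)
  linarith

lemma L_one_eq (hχ : χ ≠ 1) (h2 : χ ^ 2 = 1) : LFunction χ 1 = ((LFunction χ 1).re : ℂ) := by
  have := L_im hχ h2 1 one_pos
  apply Complex.ext <;> simp
  simpa using this

lemma ball_bound (hχ : χ ≠ 1) (s : ℂ) (hs : s ∈ Metric.closedBall (2:ℂ) (4/3)) : ‖LFunction χ s‖ ≤ 5 * q := by
  rw [Metric.mem_closedBall, dist_eq_norm] at hs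
  have h1 : |(s-2).re| ≤ 4/3 := (Complex.abs_re_le_norm _).trans hs
  have h2 : 2/3 ≤ s.re := by
    have := (abs_le.mp h1).1; simp at this; linarith
  have h3 : ‖s‖ ≤ 10/3 := by
    have := norm_add_le (s-2) 2
    rw [sub_add_cancel] at this
    have h : ‖(2:ℂ)‖ = 2 := by simp
    linarith
  refine (norm_LFunction_le χ hχ s (by linarith)).trans ?_
  have hq : (0:ℝ) ≤ q := by positivity
  calc ‖s‖ * (q / s.re) ≤ (10/3) * (q / (2/3)) := by gcongr
    _ = 5 * q := by ring

lemma abs_le_one_of_summable (f : ℕ → ℂ) (h : ∀ s : ℂ, 1 < s.re → LSeriesSummable f s) :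
    LSeries.abscissaOfAbsConv f ≤ 1 := by
  have := LSeries.abscissaOfAbsConv_le_of_forall_lt_LSeriesSummable (f := f) (x := 1)
    (fun y hy => h y (by simpa using hy))
  simpa using this

lemma LSeries_char (s : ℂ) (hs : 1 < s.re) :
    LSeriesSummable (toArithmeticFunction (χ ·)) s ∧ LSeries (toArithmeticFunction (χ ·)) s = LFunction χ s := by
  constructor
  · exact (LSeriesSummable_congr _ fun h ↦ (χ.apply_eq_toArithmeticFunction_apply h).symm).mpr <|
      ZMod.LSeriesSummable_of_one_lt_re χ hs
  · rw [LFunction_eq_LSeries χ hs]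
    exact (LSeries_congr χ.apply_eq_toArithmeticFunction_apply s).symm

lemma LSeries_zetaMul (s : ℂ) (hs : 1 < s.re) : LSeries χ.zetaMul s = riemannZeta s * LFunction χ s := by
  rw [zetaMul, ← ArithmeticFunction.coe_mul, LSeries_convolution', (LSeries_char s hs).2]
  · congr 1
    simp_rw [← ArithmeticFunction.LSeries_zeta_eq_riemannZeta hs, ← ArithmeticFunction.natCoe_apply]
  · exact ArithmeticFunction.LSeriesSummable_zeta_iff.mpr hs
  · exact (LSeries_char s hs).1

end

lemma siegel_one : ∃ C2 : ℝ, 0 < C2 ∧ ∀ (q : ℕ) [NeZero q] (χ : DirichletCharacter ℂ q), χ ≠ 1 → χ ^ 2 = 1 →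
    ∀ β : ℝ, 15/16 ≤ β → β < 1 → (riemannZeta β).re ≤ 0 → 0 ≤ (LFunction χ β).re →
    1 - β ≤ C2 * (5 * q : ℝ) ^ (5 * (1 - β)) * (LFunction χ 1).re := by
  obtain ⟨C2, hC2, H⟩ := estermann
  refine ⟨C2, hC2, ?_⟩
  intro q _ χ hχ h2 β hβ1 hβ2 hz hL
  have hq : (1:ℝ) ≤ q := by exact_mod_cast Nat.pos_of_ne_zero (NeZero.ne q)
  refine H (LFunction χ) (differentiable_LFunction hχ) χ.zetaMul (zetaMul_nonneg h2) 
    χ.isMultiplicative_zetaMul.map_one (abs_le_one_of_summable _ fun s hs => LSeriesSummable_zetaMul χ hs)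
    (fun s hs => LSeries_zetaMul s hs) (5 * q) (by linarith) (fun s hs => ball_bound hχ s hs) β hβ1 hβ2 ?_
  rw [Complex.mul_re, L_im hχ h2 β (by linarith), mul_zero, sub_zero]
  exact mul_nonpos_of_nonpos_of_nonneg hz hL

section two
variable {q q1 m : ℕ} [NeZero q] [NeZero q1] [NeZero m] {χ : DirichletCharacter ℂ q} {χ1 : DirichletCharacter ℂ q1}
  {ψ : DirichletCharacter ℂ m}


lemma AF_apply (χ : DirichletCharacter ℂ q) (n : ℕ) (hn : n ≠ 0) :
    (toArithmeticFunction (χ ·) : ArithmeticFunction ℂ) n = χ n :=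
  (χ.apply_eq_toArithmeticFunction_apply hn).symm

lemma twist_eq (hψ : ∀ n : ℕ, ψ n = χ1 n * χ n) (n : ℕ) (hn : n ≠ 0) :
    ((toArithmeticFunction (χ ·) : ArithmeticFunction ℂ) * (toArithmeticFunction (ψ ·) : ArithmeticFunction ℂ)) n
      = χ n * zetaMul χ1 n := by
  rw [zetaMul, ArithmeticFunction.mul_apply, ArithmeticFunction.mul_apply, Finset.mul_sum]
  refine Finset.sum_congr rfl ?_
  intro x hx
  rw [Nat.mem_divisorsAntidiagonal] at hx
  have h1 : x.1 ≠ 0 := by rintro h; rw [h] at hx; simp at hx; omega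
  have h2 : x.2 ≠ 0 := by rintro h; rw [h] at hx; simp at hx; omega
  rw [AF_apply χ _ h1, AF_apply ψ _ h2, AF_apply χ1 _ h2, hψ, ArithmeticFunction.natCoe_apply,
    ArithmeticFunction.zeta_apply_ne h1, ← hx.1]
  push_cast
  rw [map_mul]
  ring

lemma chi_zetaMul (h1 : χ1 ^ 2 = 1) (n : ℕ) : 0 ≤ χ1 n * zetaMul χ1 n := by
  have hz := zetaMul_nonneg h1 n
  rcases MulChar.isQuadratic_iff_sq_eq_one.mpr h1 n with h | h | h
  · rw [h]; simp
  · rw [h]; simpa using hz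
  · have : χ1 n * zetaMul χ1 n = zetaMul χ1 n := by
      rcases eq_or_ne n 0 with rfl | hn
      · simp
      rw [zetaMul, ArithmeticFunction.coe_zeta_mul_apply]
      conv_rhs => rw [← Nat.sum_div_divisors]
      rw [Finset.mul_sum]
      refine Finset.sum_congr rfl ?_
      intro d hd
      rw [Nat.mem_divisors] at hd
      obtain ⟨e, rfl⟩ := hd.1
      have hd0 : d ≠ 0 := by rintro rfl; simp at hd
      have he0 : e ≠ 0 := by rintro rfl; simp at hd
      rw [Nat.mul_div_cancel_left _ (Nat.pos_of_ne_zero hd0), AF_apply χ1 _ hd0, AF_apply χ1 _ he0]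
      rw [Nat.cast_mul, map_mul] at h ⊢
      rcases MulChar.isQuadratic_iff_sq_eq_one.mpr h1 d with h' | h' | h' <;>
      rcases MulChar.isQuadratic_iff_sq_eq_one.mpr h1 e with h'' | h'' | h'' <;> simp [h', h''] at h ⊢
    rw [this]; exact hz

noncomputable def a4 (χ : DirichletCharacter ℂ q) (χ1 : DirichletCharacter ℂ q1) (ψ : DirichletCharacter ℂ m) :
    ArithmeticFunction ℂ := zetaMul χ1 * (toArithmeticFunction (χ ·) * toArithmeticFunction (ψ ·))

lemma a4_mult : (a4 χ χ1 ψ).IsMultiplicative :=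
  χ1.isMultiplicative_zetaMul.mul ((isMultiplicative_toArithmeticFunction χ).mul (isMultiplicative_toArithmeticFunction ψ))

lemma a4_symm : a4 χ χ1 ψ = a4 χ1 χ ψ := by
  unfold a4 zetaMul; ring

lemma a4_pp (hψ : ∀ n : ℕ, ψ n = χ1 n * χ n) (h1 : χ1 ^ 2 = 1) (p k : ℕ) (hp : p.Prime)
    (hc : ∀ j, 0 ≤ χ (p ^ j : ℕ) * zetaMul χ1 (p ^ j)) : 0 ≤ a4 χ χ1 ψ (p ^ k) := by
  rw [a4, ArithmeticFunction.mul_apply]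
  refine Finset.sum_nonneg ?_
  intro x hx
  refine mul_nonneg (zetaMul_nonneg h1 _) ?_
  rw [Nat.mem_divisorsAntidiagonal] at hx
  have h2 : x.2 ≠ 0 := by
    rintro h; rw [h, mul_zero] at hx; exact hx.2 hx.1.symm
  rw [twist_eq hψ _ h2]
  obtain ⟨j, _, hj⟩ := (Nat.dvd_prime_pow hp).mp (Dvd.intro_left _ hx.1)
  rw [hj]
  exact hc j

lemma a4_nonneg (hψ : ∀ n : ℕ, ψ n = χ1 n * χ n) (h1 : χ1 ^ 2 = 1) (h2 : χ ^ 2 = 1) (n : ℕ) : 0 ≤ a4 χ χ1 ψ n := by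
  have hpp : ∀ p k : ℕ, p.Prime → 0 ≤ a4 χ χ1 ψ (p ^ k) := by
    intro p k hp
    have good : ∀ {q q1 : ℕ} [NeZero q] [NeZero q1] {χ : DirichletCharacter ℂ q} {χ1 : DirichletCharacter ℂ q1},
        χ1 ^ 2 = 1 → (χ p = 0 ∨ χ p = 1) → ∀ j, 0 ≤ χ (p ^ j : ℕ) * zetaMul χ1 (p ^ j) := by
      intro q q1 _ _ χ χ1 h1 h j
      refine mul_nonneg ?_ (zetaMul_nonneg h1 _)
      rw [Nat.cast_pow, map_pow]
      rcases h with h | h <;> simp [h]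
    have hψ' : ∀ n : ℕ, ψ n = χ n * χ1 n := fun n => by rw [hψ, mul_comm]
    rcases MulChar.isQuadratic_iff_sq_eq_one.mpr h2 p with h | h | h
    · exact a4_pp hψ h1 p k hp (good h1 (.inl h))
    · exact a4_pp hψ h1 p k hp (good h1 (.inr h))
    · rcases MulChar.isQuadratic_iff_sq_eq_one.mpr h1 p with h' | h' | h'
      · rw [a4_symm]; exact a4_pp hψ' h2 p k hp (good h2 (.inl h'))
      · rw [a4_symm]; exact a4_pp hψ' h2 p k hp (good h2 (.inr h'))
      · refine a4_pp hψ h1 p k hp ?_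
        intro j
        have : χ (p ^ j : ℕ) = χ1 (p ^ j : ℕ) := by
          rw [Nat.cast_pow, map_pow, Nat.cast_pow, map_pow, h, h']
        rw [this]
        exact chi_zetaMul h1 _
  rcases eq_or_ne n 0 with rfl | hn
  · simp only [ArithmeticFunction.map_zero, le_refl]
  · simpa only [a4_mult.multiplicative_factorization _ hn] using!
      Finset.prod_nonneg fun p hp ↦ hpp p _ (Nat.prime_of_mem_primeFactors hp)

end two

lemma siegel_two : ∃ C2 : ℝ, 0 < C2 ∧ ∀ (q q1 m : ℕ) [NeZero q] [NeZero q1] [NeZero m] (χ : DirichletCharacter ℂ q) 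
    (χ1 : DirichletCharacter ℂ q1) (ψ : DirichletCharacter ℂ m), χ ≠ 1 → χ ^ 2 = 1 → χ1 ≠ 1 → χ1 ^ 2 = 1 →
    ψ ≠ 1 → (∀ n : ℕ, ψ n = χ1 n * χ n) → 
    ∀ β : ℝ, 15/16 ≤ β → β < 1 → LFunction χ1 β = 0 →
    1 - β ≤ C2 * ((5 * q1) * (5 * q) * (5 * m) : ℝ) ^ (5 * (1 - β)) * (‖LFunction χ1 1‖ * ‖LFunction ψ 1‖ * (LFunction χ 1).re) := by
  obtain ⟨C2, hC2, H⟩ := estermann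
  refine ⟨C2, hC2, ?_⟩
  intro q q1 m _ _ _ χ χ1 ψ hχ h2 hχ1 h1 hψ1 hψ β hβ1 hβ2 hz
  have hq : (1:ℝ) ≤ q := by exact_mod_cast Nat.pos_of_ne_zero (NeZero.ne q)
  have hq1 : (1:ℝ) ≤ q1 := by exact_mod_cast Nat.pos_of_ne_zero (NeZero.ne q1)
  have hm : (1:ℝ) ≤ m := by exact_mod_cast Nat.pos_of_ne_zero (NeZero.ne m)
  have hsum : ∀ s : ℂ, 1 < s.re → LSeriesSummable (toArithmeticFunction (χ ·) * toArithmeticFunction (ψ ·) : ArithmeticFunction ℂ) s :=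
    fun s hs => ArithmeticFunction.LSeriesSummable_mul (LSeries_char s hs).1 (LSeries_char s hs).1
  have := H (fun s => LFunction χ1 s * (LFunction χ s * LFunction ψ s))
    ((differentiable_LFunction hχ1).mul ((differentiable_LFunction hχ).mul (differentiable_LFunction hψ1)))
    (a4 χ χ1 ψ) (a4_nonneg hψ h1 h2) a4_mult.map_one 
    (abs_le_one_of_summable _ fun s hs => 
      ArithmeticFunction.LSeriesSummable_mul (LSeriesSummable_zetaMul χ1 hs) (hsum s hs))
    (fun s hs => by
      rw [a4, ArithmeticFunction.LSeries_mul' (LSeriesSummable_zetaMul χ1 hs) (hsum s hs),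
        ArithmeticFunction.LSeries_mul' (LSeries_char s hs).1 (LSeries_char s hs).1,
        (LSeries_char s hs).2, (LSeries_char s hs).2, LSeries_zetaMul s hs]
      ring) ((5 * q1) * (5 * q) * (5 * m)) 
      (one_le_mul_of_one_le_of_one_le (one_le_mul_of_one_le_of_one_le (by linarith) (by linarith)) (by linarith))
      (fun s hs => by
        rw [norm_mul, norm_mul, mul_assoc (5 * (q1:ℝ))]
        have a := ball_bound hχ s hs
        have b := ball_bound hχ1 s hs
        have c := ball_bound hψ1 s hs
        gcongr) β hβ1 hβ2 (by simp [hz])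
  refine this.trans (mul_le_mul_of_nonneg_left ?_ (by positivity))
  refine (Complex.re_le_norm _).trans ?_
  rw [norm_mul, norm_mul, L_one_eq hχ h2, Complex.norm_real, Real.norm_of_nonneg (L_one_pos hχ h2).le, ofReal_re]
  apply le_of_eq; ring

end HB


set_option linter.unusedSectionVars false
set_option linter.deprecated false

namespace HB
open Filter Topology Complex DirichletCharacter MeasureTheory

lemma jac_cast_eq (D : ℕ) [NeZero D] (a : ℤ) : jacobiSym (((a : ZMod D).val : ℕ) : ℤ) D = jacobiSym a D := by
  rw [ZMod.val_intCast, ← jacobiSym.mod_left]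

noncomputable def chiD (D : ℕ) [NeZero D] : DirichletCharacter ℂ D where
  toFun x := ((jacobiSym (x.val : ℤ) D : ℤ) : ℂ)
  map_one' := by
    have := jac_cast_eq D 1
    rw [Int.cast_one] at this
    simp only [this]; simp
  map_mul' := by
    intro x y
    have hx : x * y = (((x.val * y.val : ℕ) : ℤ) : ZMod D) := by simp
    have := jac_cast_eq D ((x.val * y.val : ℕ) : ℤ)
    rw [← hx] at this
    simp only [this]
    push_cast
    rw [jacobiSym.mul_left]; push_cast; rfl
  map_nonunit' := by
    intro x hx
    have : jacobiSym (x.val : ℤ) D = 0 := by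
      rw [jacobiSym.eq_zero_iff_not_coprime]
      intro h
      apply hx
      have h1 : Nat.Coprime x.val D := by rwa [Int.gcd_natCast_natCast] at h
      have := (ZMod.isUnit_iff_coprime x.val D).mpr h1
      simpa using this
    simp only [this, Int.cast_zero]

lemma chiD_nat (D : ℕ) [NeZero D] (n : ℕ) : chiD D (n : ZMod D) = ((jacobiSym (n:ℤ) D : ℤ) : ℂ) := by
  have := jac_cast_eq D n
  rw [← this, Int.cast_natCast]
  rfl

lemma chiD_sq (D : ℕ) [NeZero D] : (chiD D) ^ 2 = 1 := by
  apply MulChar.isQuadratic_iff_sq_eq_one.mp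
  intro x
  have h : chiD D x = chiD D ((x.val : ℕ) : ZMod D) := by simp
  rw [h, chiD_nat]
  rcases jacobiSym.trichotomy (x.val : ℤ) D with h | h | h <;> rw [h] <;> simp

lemma exists_neg_one (D D1 : ℕ) (hD : Squarefree D) (hodd : D % 2 = 1) (h1 : 0 < D1) (hnd : ¬ D ∣ D1) :
    ∃ n : ℕ, jacobiSym n D = -1 ∧ jacobiSym n D1 = 1 := by
  have hp : ∃ p, p.Prime ∧ p ∣ D ∧ ¬ p ∣ D1 := by
    by_contra hcon
    push Not at hcon
    apply hnd
    rw [← Nat.prod_primeFactors_of_squarefree hD]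
    refine Finset.prod_primes_dvd D1 (fun p hp => (Nat.prime_of_mem_primeFactors hp).prime) ?_
    intro p hp
    exact hcon p (Nat.prime_of_mem_primeFactors hp) (Nat.dvd_of_mem_primeFactors hp)
  obtain ⟨p, hp, hpD, hpD1⟩ := hp
  obtain ⟨m, rfl⟩ := hpD
  have : Fact p.Prime := ⟨hp⟩
  have hp2 : p ≠ 2 := by rintro rfl; omega
  have hpm : Nat.Coprime p m := Nat.coprime_of_squarefree_mul hD
  have hcop : Nat.Coprime p (m * D1) := Nat.Coprime.mul_right hpm ((Nat.Prime.coprime_iff_not_dvd hp).mpr hpD1)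
  obtain ⟨a, ha⟩ := quadraticChar_exists_neg_one (F := ZMod p) (by rw [ZMod.ringChar_zmod_n]; exact hp2)
  obtain ⟨n, hn1, hn2⟩ := Nat.chineseRemainder hcop a.val 1
  have j1 : ∀ b, b ∣ m * D1 → jacobiSym n b = 1 := by
    intro b hb
    have : (n:ℤ) % b = 1 % b := by
      have := (hn2.of_dvd hb)
      exact_mod_cast this
    rw [jacobiSym.mod_left, this, ← jacobiSym.mod_left, jacobiSym.one_left]
  refine ⟨n, ?_, j1 D1 (Dvd.intro_left _ rfl)⟩
  rw [jacobiSym.mul_right' _ hp.ne_zero (by rintro rfl; simp at hodd), j1 m (Dvd.intro _ rfl), mul_one]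
  rw [← jacobiSym.legendreSym.to_jacobiSym, legendreSym]
  have : ((n:ℤ) : ZMod p) = a := by
    have := (ZMod.natCast_eq_natCast_iff n a.val p).mpr hn1
    simpa using this
  rw [this, ha]

lemma chiD_ne_one (D : ℕ) [NeZero D] (hD : Squarefree D) (hodd : D % 2 = 1) (h1 : 1 < D) : chiD D ≠ 1 := by
  intro h
  obtain ⟨n, hn, -⟩ := exists_neg_one D 1 hD hodd one_pos (by intro h; have := Nat.le_of_dvd one_pos h; omega)
  have h2 := chiD_nat D n
  rw [h, hn] at h2
  by_cases hu : IsUnit (n : ZMod D)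
  · rw [MulChar.one_apply hu] at h2; norm_num at h2
  · rw [MulChar.map_nonunit _ hu] at h2; norm_num at h2

lemma chiD_mul_ne_one (D D1 : ℕ) [NeZero (D * D1)] (hD : Squarefree D) (hodd : D % 2 = 1) (h1 : 0 < D1) (hlt : D1 < D) : chiD (D * D1) ≠ 1 := by
  intro h
  obtain ⟨n, hn, hn1⟩ := exists_neg_one D D1 hD hodd h1 (by intro h; have := Nat.le_of_dvd h1 h; omega)
  have h2 := chiD_nat (D * D1) n
  rw [h, jacobiSym.mul_right' _ (by omega) (by omega), hn, hn1] at h2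
  by_cases hu : IsUnit (n : ZMod (D * D1))
  · rw [MulChar.one_apply hu] at h2; norm_num at h2
  · rw [MulChar.map_nonunit _ hu] at h2; norm_num at h2

lemma zeta_neg (ε : ℝ) (hε : 0 < ε) : ∃ e : ℝ, 0 < e ∧ e ≤ ε ∧ (riemannZeta ((1 - e : ℝ) : ℂ)).re ≤ 0 := by
  have h := riemannZeta_residue_one
  have hmap : Tendsto (fun e : ℝ => ((1 - e : ℝ) : ℂ)) (𝓝[>] 0) (𝓝[≠] 1) := by
    rw [tendsto_nhdsWithin_iff]
    constructor
    · have : Continuous (fun e : ℝ => ((1 - e : ℝ) : ℂ)) := by fun_prop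
      have := this.tendsto 0
      simp only [sub_zero, ofReal_one] at this
      exact this.mono_left nhdsWithin_le_nhds
    · filter_upwards [self_mem_nhdsWithin] with e he
      have he : 0 < e := he
      simp only [Set.mem_compl_iff, Set.mem_singleton_iff]
      intro hh
      have : (1 - e : ℝ) = 1 := by exact_mod_cast hh
      linarith
  have h2 := (Complex.continuous_re.tendsto _).comp (h.comp hmap)
  have h3 := h2.eventually (lt_mem_nhds (show (0:ℝ) < (1:ℂ).re by simp))
  have h4 : ∀ᶠ e in 𝓝[>] (0:ℝ), e ∈ Set.Ioo 0 ε := Ioo_mem_nhdsGT hε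
  obtain ⟨e, he1, he2⟩ := (h3.and h4).exists
  refine ⟨e, he2.1, he2.2.le, ?_⟩
  simp only [Function.comp_apply] at he1
  have : (((1 - e : ℝ) : ℂ) - 1) = ((-e : ℝ) : ℂ) := by push_cast; ring
  rw [this, Complex.re_ofReal_mul] at he1
  have := he2.1
  by_contra hcon
  push Not at hcon
  have := mul_pos this hcon
  linarith

theorem siegel (ε : ℝ) (hε : 0 < ε) : ∃ c : ℝ, 0 < c ∧ ∃ D0 : ℕ, ∀ (D : ℕ) [NeZero D], D0 < D → Squarefree D → D % 2 = 1 →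
    c * (D:ℝ) ^ (-ε) ≤ (LFunction (chiD D) 1).re := by
  obtain ⟨e, he0, he1, hz⟩ := zeta_neg (min (1/16) (ε/20)) (by positivity)
  have he2 : e ≤ 1/16 := he1.trans (min_le_left _ _)
  have he3 : e ≤ ε/20 := he1.trans (min_le_right _ _)
  by_cases hA : ∃ D1 : ℕ, ∃ _ : NeZero D1, 1 < D1 ∧ Squarefree D1 ∧ D1 % 2 = 1 ∧ (LFunction (chiD D1) ((1 - e : ℝ) : ℂ)).re ≤ 0
  · obtain ⟨D1, _, hD1, hsq1, hodd1, hL1⟩ := hA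
    have hne1 := chiD_ne_one D1 hsq1 hodd1 hD1
    obtain ⟨β, hb1, hb2, hb3⟩ := L_zero_of_nonpos hne1 (chiD_sq D1) (1-e) (by linarith) hL1
    obtain ⟨C2, hC2, H⟩ := siegel_two
    have hK : 0 < ‖LFunction (chiD D1) 1‖ := by
      rw [norm_pos_iff]; intro h
      have := L_one_pos hne1 (chiD_sq D1)
      rw [h] at this; simp at this
    set K := ‖LFunction (chiD D1) 1‖
    have hD1r : (1:ℝ) < D1 := by exact_mod_cast hD1
    have hlog1 : 0 < Real.log D1 := Real.log_pos hD1r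
    obtain ⟨D0, hD0⟩ := eventually_atTop.mp (ev_log (3 + Real.log D1) (by linarith) (show 0 < ε/2 by linarith))
    set Q := C2 * (125 * (D1:ℝ)^2)^(5*(1-β)) * K
    have hQ : 0 < Q := by positivity
    refine ⟨(1-β)/Q, div_pos (by linarith) hQ, max D0 D1, ?_⟩
    intro D _ hD hsq hodd
    have hDD0 : D0 ≤ D := (le_max_left _ _).trans hD.le
    have hDD1 : D1 < D := lt_of_le_of_lt (le_max_right _ _) hD
    have hDr : (1:ℝ) < D := by exact_mod_cast hD1.trans hDD1
    have hlogD : 0 < Real.log D := Real.log_pos hDr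
    have : NeZero (D * D1) := ⟨Nat.mul_ne_zero (by omega) (by omega)⟩
    have hne := chiD_ne_one D hsq hodd (hD1.trans hDD1)
    have hneψ := chiD_mul_ne_one D D1 hsq hodd (by omega) hDD1
    have h1 := H D D1 (D*D1) (chiD D) (chiD D1) (chiD (D*D1)) hne (chiD_sq D) hne1 (chiD_sq D1) hneψ
      (fun n => by
        rw [chiD_nat, chiD_nat, chiD_nat, jacobiSym.mul_right' _ (by omega) (by omega)]
        push_cast; ring) β (by linarith) hb2 hb3
    have h2 := norm_L_one_le (chiD (D*D1)) hneψ
    have h3 := hD0 D hDD0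
    have h4 : ‖LFunction (chiD (D*D1)) 1‖ ≤ (D:ℝ)^(ε/2) := by
      refine h2.trans (le_trans ?_ h3)
      push_cast
      rw [Real.log_mul (by positivity) (by positivity)]
      nlinarith
    have hpos := L_one_pos hne (chiD_sq D)
    set L := (LFunction (chiD D) 1).re
    have h5 : ((5 * D1) * (5 * D) * (5 * ((D*D1 : ℕ):ℝ)) : ℝ) ^ (5 * (1 - β)) ≤ (125 * (D1:ℝ)^2)^(5*(1-β)) * (D:ℝ)^(ε/2) := by
      have : ((5 * D1) * (5 * D) * (5 * ((D*D1 : ℕ):ℝ)) : ℝ) = (125 * (D1:ℝ)^2) * (D:ℝ)^(2:ℝ) := by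
        push_cast; rw [Real.rpow_two]; ring
      rw [this, Real.mul_rpow (by positivity) (by positivity)]
      refine mul_le_mul_of_nonneg_left ?_ (by positivity)
      rw [← Real.rpow_mul (by positivity)]
      apply Real.rpow_le_rpow_of_exponent_le hDr.le
      linarith
    have h6 : 1 - β ≤ Q * (D:ℝ)^ε * L := by
      calc 1 - β ≤ _ := h1
        _ ≤ C2 * ((125 * (D1:ℝ)^2)^(5*(1-β)) * (D:ℝ)^(ε/2)) * (K * (D:ℝ)^(ε/2) * L) := by gcongr
        _ = Q * ((D:ℝ)^(ε/2) * (D:ℝ)^(ε/2)) * L := by ring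
        _ = Q * (D:ℝ)^ε * L := by rw [← Real.rpow_add (by positivity)]; ring_nf
    rw [Real.rpow_neg (by positivity), ← div_eq_mul_inv, div_le_iff₀ (by positivity), div_le_iff₀ hQ]
    linarith
  · push Not at hA
    obtain ⟨C2, hC2, H⟩ := siegel_one
    set Q := C2 * (5:ℝ)^(5*e)
    have hQ : 0 < Q := by positivity
    refine ⟨e/Q, by positivity, 1, ?_⟩
    intro D _ hD hsq hodd
    have hDr : (1:ℝ) < D := by exact_mod_cast hD
    have hne := chiD_ne_one D hsq hodd hD
    have h0 := hA D inferInstance hD hsq hodd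
    have h1 := H D (chiD D) hne (chiD_sq D) (1-e) (by linarith) (by linarith) hz h0.le
    have hpos := L_one_pos hne (chiD_sq D)
    set L := (LFunction (chiD D) 1).re
    rw [sub_sub_cancel, Real.mul_rpow (by positivity) (by positivity)] at h1
    have h5 : (D:ℝ)^(5*e) ≤ (D:ℝ)^ε := Real.rpow_le_rpow_of_exponent_le hDr.le (by linarith)
    have h6 : e ≤ Q * (D:ℝ)^ε * L := by
      calc e ≤ _ := h1
        _ = Q * (D:ℝ)^(5*e) * L := by ring
        _ ≤ _ := by gcongr
    rw [Real.rpow_neg (by positivity), ← div_eq_mul_inv, div_le_iff₀ (by positivity), div_le_iff₀ hQ]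
    linarith

end HB


set_option linter.unusedSectionVars false
set_option linter.deprecated false
set_option linter.unusedVariables false

namespace HB
open Filter Topology DirichletCharacter

/-- the Jacobi symbol as an arithmetic function -/
def JA (D : ℕ) : ArithmeticFunction ℤ := ⟨fun n => if n = 0 then 0 else jacobiSym n D, by simp⟩

lemma JA_apply (D n : ℕ) (hn : n ≠ 0) : JA D n = jacobiSym n D := by simp [JA, hn]

/-- r = 1 * χ -/
noncomputable def rr (D : ℕ) : ArithmeticFunction ℤ := JA D * (ArithmeticFunction.zeta : ArithmeticFunction ℤ)

noncomputable def RR (D N : ℕ) : ℤ := ∑ n ∈ Finset.Ioc 0 N, rr D n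

lemma RR_eq (D N : ℕ) : RR D N = ∑ d ∈ Finset.Ioc 0 N, jacobiSym d D * ((N / d : ℕ) : ℤ) := by
  unfold RR rr
  rw [ArithmeticFunction.sum_Ioc_mul_zeta_eq_sum]
  refine Finset.sum_congr rfl ?_
  intro d hd
  rw [Finset.mem_Ioc] at hd
  rw [JA_apply D d (by omega)]

lemma burgess_nat (D : ℕ) (θ B : ℝ) (hθ : 0 ≤ θ) (hB : 0 ≤ B)
    (hb : ∀ (M : ℤ) (n : ℕ), |((∑ n ∈ Finset.Ioc M (M+n), jacobiSym n D : ℤ):ℝ)| ≤ θ * n + B)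
    (Z M : ℕ) : |((∑ d ∈ Finset.Ioc Z M, jacobiSym (d:ℤ) D : ℤ):ℝ)| ≤ θ * ((M - Z : ℕ):ℝ) + B := by
  by_cases h : Z ≤ M
  · have h1 := hb Z (M - Z)
    have : (Z:ℤ) + ((M - Z : ℕ):ℤ) = M := by omega
    have im : Finset.Ioc (Z:ℤ) M = (Finset.Ioc Z M).image (fun n : ℕ => (n:ℤ)) := by
      ext x
      simp only [Finset.mem_image, Finset.mem_Ioc]
      constructor
      · intro hx; exact ⟨x.toNat, by omega, by omega⟩
      · rintro ⟨y, hy, rfl⟩; omega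
    rw [this, im, Finset.sum_image (by intro a _ b _ h; simpa using h)] at h1
    exact h1
  · rw [Finset.Ioc_eq_empty (by omega)]
    simp; positivity

lemma second_part (D : ℕ) (θ B : ℝ) (hθ : 0 ≤ θ) (hB : 0 ≤ B)
    (hb : ∀ (M : ℤ) (n : ℕ), |((∑ n ∈ Finset.Ioc M (M+n), jacobiSym n D : ℤ):ℝ)| ≤ θ * n + B)
    (Z N : ℕ) (hZ : 1 ≤ Z) (hZN : Z ≤ N) :
    |((∑ d ∈ Finset.Ioc Z N, jacobiSym (d:ℤ) D * ((N / d : ℕ) : ℤ) : ℤ):ℝ)| ≤ θ * N * (1 + Real.log N) + B * N / Z := by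
  have e1 : ∑ d ∈ Finset.Ioc Z N, jacobiSym (d:ℤ) D * ((N / d : ℕ) : ℤ)
      = ∑ m ∈ Finset.Ioc 0 (N/Z), ∑ d ∈ Finset.Ioc Z (N/m), jacobiSym (d:ℤ) D := by
    have : ∀ d ∈ Finset.Ioc Z N, jacobiSym (d:ℤ) D * ((N / d : ℕ) : ℤ) =
        ∑ m ∈ Finset.Ioc 0 (N/Z), if m * d ≤ N then jacobiSym (d:ℤ) D else 0 := by
      intro d hd
      rw [Finset.mem_Ioc] at hd
      rw [← Finset.sum_filter, Finset.sum_const]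
      have : (Finset.Ioc 0 (N/Z)).filter (fun m => m * d ≤ N) = Finset.Ioc 0 (N/d) := by
        ext m
        simp only [Finset.mem_filter, Finset.mem_Ioc]
        rw [Nat.le_div_iff_mul_le (by omega), Nat.le_div_iff_mul_le (by omega)]
        constructor
        · rintro ⟨⟨h1, h2⟩, h3⟩; exact ⟨h1, h3⟩
        · rintro ⟨h1, h2⟩; exact ⟨⟨h1, (Nat.mul_le_mul_left m hd.1.le).trans h2⟩, h2⟩
      rw [this, Nat.card_Ioc, Nat.sub_zero, nsmul_eq_mul, mul_comm]
    rw [Finset.sum_congr rfl this, Finset.sum_comm]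
    refine Finset.sum_congr rfl ?_
    intro m hm
    rw [Finset.mem_Ioc] at hm
    rw [← Finset.sum_filter]
    congr 1
    ext d
    simp only [Finset.mem_filter, Finset.mem_Ioc]
    rw [Nat.le_div_iff_mul_le (by omega), mul_comm d m]
    constructor
    · rintro ⟨⟨h1, h2⟩, h3⟩; exact ⟨h1, h3⟩
    · rintro ⟨h1, h2⟩; exact ⟨⟨h1, (Nat.le_mul_of_pos_left d hm.1).trans h2⟩, h2⟩
  rw [e1]
  push_cast
  refine (Finset.abs_sum_le_sum_abs _ _).trans ?_
  have hNp : (0:ℝ) < N := by exact_mod_cast (by omega : 0 < N)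
  have hZp : (0:ℝ) < Z := by exact_mod_cast (by omega : 0 < Z)
  calc _ ≤ ∑ m ∈ Finset.Ioc 0 (N/Z), (θ * N * (m:ℝ)⁻¹ + B) := by
        refine Finset.sum_le_sum ?_
        intro m hm
        rw [Finset.mem_Ioc] at hm
        have h1 := burgess_nat D θ B hθ hB hb Z (N/m)
        push_cast at h1
        refine h1.trans ?_
        have h2 : ((N/m - Z : ℕ):ℝ) ≤ N * (m:ℝ)⁻¹ := by
          have : ((N/m - Z : ℕ):ℝ) ≤ ((N/m : ℕ):ℝ) := by exact_mod_cast Nat.sub_le _ _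
          exact this.trans (Nat.cast_div_le.trans (le_of_eq (div_eq_mul_inv _ _)))
        have := mul_le_mul_of_nonneg_left h2 hθ
        linarith
    _ = θ * N * ∑ m ∈ Finset.Ioc 0 (N/Z), (m:ℝ)⁻¹ + ((N/Z : ℕ):ℝ) * B := by
        rw [Finset.sum_add_distrib, ← Finset.mul_sum]; simp
    _ ≤ θ * N * (1 + Real.log N) + (N/Z) * B := by
        have h1 : ∑ m ∈ Finset.Ioc 0 (N/Z), (m:ℝ)⁻¹ ≤ 1 + Real.log N := by
          have hpos : 1 ≤ N/Z := (Nat.one_le_div_iff (by omega)).mpr hZN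
          have h1 : ∑ m ∈ Finset.Ioc 0 (N/Z), (m:ℝ)⁻¹ ≤ 1 + Real.log (N/Z : ℕ) := sum_inv_le (N/Z) hpos
          refine h1.trans ?_
          have : Real.log (N/Z : ℕ) ≤ Real.log N := by
            apply Real.log_le_log
            · exact_mod_cast hpos
            · exact_mod_cast Nat.div_le_self _ _
          linarith
        have h2 : ((N/Z : ℕ):ℝ) ≤ N/Z := Nat.cast_div_le
        gcongr
    _ = _ := by ring

lemma first_part (D N Z : ℕ) (hZ : 1 ≤ Z) :
    |((∑ d ∈ Finset.Ioc 0 Z, jacobiSym (d:ℤ) D * ((N / d : ℕ) : ℤ) : ℤ):ℝ) - N * ∑ d ∈ Finset.Ioc 0 Z, (d:ℝ)⁻¹ * (jacobiSym (d:ℤ) D : ℝ)| ≤ Z := by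
  rw [Int.cast_sum]
  simp only [Int.cast_mul, Int.cast_natCast]
  rw [Finset.mul_sum, ← Finset.sum_sub_distrib]
  refine (Finset.abs_sum_le_sum_abs _ _).trans ?_
  calc _ ≤ ∑ d ∈ Finset.Ioc 0 Z, (1:ℝ) := by
        refine Finset.sum_le_sum ?_
        intro d hd
        rw [Finset.mem_Ioc] at hd
        have hdp : (0:ℝ) < d := by exact_mod_cast hd.1
        have e : (jacobiSym (d:ℤ) D : ℝ) * ((N/d : ℕ):ℝ) - N * ((d:ℝ)⁻¹ * (jacobiSym (d:ℤ) D : ℝ))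
          = (jacobiSym (d:ℤ) D : ℝ) * (((N/d : ℕ):ℝ) - N / d) := by ring
        rw [e, abs_mul]
        have h1 : |(jacobiSym (d:ℤ) D : ℝ)| ≤ 1 := by exact_mod_cast abs_jacobi_le d D
        have h2 : |((N/d : ℕ):ℝ) - N / d| ≤ 1 := by
          have a1 : ((N/d : ℕ):ℝ) ≤ N/d := Nat.cast_div_le
          have a2 : (N:ℝ)/d < ((N/d : ℕ):ℝ) + 1 := by
            rw [div_lt_iff₀ hdp]
            have : N < (N/d + 1) * d := by
              have h1 := Nat.div_add_mod N d
              have h2 := Nat.mod_lt N hd.1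
              nlinarith
            exact_mod_cast this
          rw [abs_le]; constructor <;> linarith
        exact mul_le_one₀ h1 (abs_nonneg _) h2
    _ = Z := by simp

lemma tail_part (D : ℕ) [NeZero D] (hne : chiD D ≠ 1) (θ B : ℝ) (hθ : 0 ≤ θ) (hB : 0 ≤ B)
    (hb : ∀ (M : ℤ) (n : ℕ), |((∑ n ∈ Finset.Ioc M (M+n), jacobiSym n D : ℤ):ℝ)| ≤ θ * n + B)
    (Z : ℕ) (hZ : 1 ≤ Z) (hZD : Z ≤ D) :
    |(LFunction (chiD D) 1).re - ∑ d ∈ Finset.Ioc 0 Z, (d:ℝ)⁻¹ * (jacobiSym (d:ℤ) D : ℝ)| ≤ B / Z + θ * (1 + 2 * Real.log D) + 2 / D := by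
  have hD1 : 1 ≤ D := by omega
  have hDp : (0:ℝ) < D := by exact_mod_cast hD1
  have hZD2 : Z ≤ D^2 := hZD.trans (Nat.le_self_pow (by norm_num) D)
  have h1 := L_one_tail (chiD D) hne (D^2) (Nat.one_le_pow _ _ hD1)
  have h2 := abel_bound (fun k => chiD D (k : ZMod D)) Z hZ θ B hθ hB ?_ (D^2) hZD2
  · have h3 : ∑ k ∈ Finset.Ioc Z (D^2), (k:ℝ)⁻¹ ≤ 1 + 2 * Real.log D := by
      have := sum_inv_le (D^2) (Nat.one_le_pow _ _ hD1)
      push_cast at this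
      rw [Real.log_pow] at this
      push_cast at this
      refine le_trans ?_ this
      refine Finset.sum_le_sum_of_subset_of_nonneg ?_ (fun _ _ _ => by positivity)
      intro k; simp only [Finset.mem_Ioc, Finset.mem_Icc]; omega
    have e1 : ∑ k ∈ Finset.Icc 1 (D^2), (k:ℂ)⁻¹ * chiD D (k : ZMod D) = 
      ((∑ d ∈ Finset.Ioc 0 Z, (d:ℝ)⁻¹ * (jacobiSym (d:ℤ) D : ℝ) : ℝ) : ℂ) + ∑ k ∈ Finset.Ioc Z (D^2), (k:ℂ)⁻¹ * chiD D (k : ZMod D) := by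
      have := (Finset.sum_Ioc_consecutive (fun k : ℕ => (k:ℂ)⁻¹ * chiD D (k : ZMod D)) (Nat.zero_le Z) hZD2).symm
      refine Eq.trans this ?_
      congr 1
      push_cast
      refine Finset.sum_congr rfl fun d _ => ?_
      rw [chiD_nat]
    set T := ∑ d ∈ Finset.Ioc 0 Z, (d:ℝ)⁻¹ * (jacobiSym (d:ℤ) D : ℝ)
    set A := ∑ k ∈ Finset.Ioc Z (D^2), (k:ℂ)⁻¹ * chiD D (k : ZMod D)
    rw [e1] at h1
    have h4 : |(LFunction (chiD D) 1).re - T| ≤ ‖LFunction (chiD D) 1 - T‖ := by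
      have := Complex.abs_re_le_norm (LFunction (chiD D) 1 - T)
      simpa using this
    have h5 := norm_add_le (LFunction (chiD D) 1 - (T + A)) A
    rw [show LFunction (chiD D) 1 - (T + A) + A = LFunction (chiD D) 1 - T by ring] at h5
    have h6 : (2 * D / ((D^2 : ℕ):ℝ) : ℝ) = 2 / D := by push_cast; field_simp
    rw [h6] at h1
    have h7 := mul_le_mul_of_nonneg_left h3 hθ
    linarith
  · intro m hm
    have := burgess_nat D θ B hθ hB hb Z m
    rw [Nat.cast_sub hm] at this
    refine le_trans (le_of_eq ?_) this
    rw [← Complex.norm_intCast]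
    congr 1
    push_cast
    exact Finset.sum_congr rfl fun d _ => chiD_nat D d

lemma R_error (D : ℕ) [NeZero D] (hne : chiD D ≠ 1) (θ B : ℝ) (hθ : 0 ≤ θ) (hB : 0 ≤ B)
    (hb : ∀ (M : ℤ) (n : ℕ), |((∑ n ∈ Finset.Ioc M (M+n), jacobiSym n D : ℤ):ℝ)| ≤ θ * n + B)
    (Z N : ℕ) (hZ : 1 ≤ Z) (hZN : Z ≤ N) (hND : N ≤ D) :
    |(RR D N : ℝ) - N * (LFunction (chiD D) 1).re| ≤ Z + 2 * B * N / Z + 3 * θ * N * (1 + Real.log D) + 2 * N / D := by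
  have hNp : (0:ℝ) < N := by exact_mod_cast (by omega : 0 < N)
  have h1 := first_part D N Z hZ
  have h2 := second_part D θ B hθ hB hb Z N hZ hZN
  have h3 := tail_part D hne θ B hθ hB hb Z hZ (hZN.trans hND)
  have e : RR D N = ∑ d ∈ Finset.Ioc 0 Z, jacobiSym (d:ℤ) D * ((N / d : ℕ) : ℤ) + ∑ d ∈ Finset.Ioc Z N, jacobiSym (d:ℤ) D * ((N / d : ℕ) : ℤ) := by
    rw [RR_eq, Finset.sum_Ioc_consecutive _ (Nat.zero_le Z) hZN]
  rw [e]
  rw [Int.cast_add]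
  generalize ((∑ d ∈ Finset.Ioc 0 Z, jacobiSym (d:ℤ) D * ((N / d : ℕ) : ℤ) : ℤ) : ℝ) = a at *
  generalize ((∑ d ∈ Finset.Ioc Z N, jacobiSym (d:ℤ) D * ((N / d : ℕ) : ℤ) : ℤ) : ℝ) = b at *
  generalize ∑ d ∈ Finset.Ioc 0 Z, (d:ℝ)⁻¹ * (jacobiSym (d:ℤ) D : ℝ) = T at *
  generalize (LFunction (chiD D) 1).re = L at *
  have h4 : |N * T - N * L| ≤ N * (B / Z + θ * (1 + 2 * Real.log D) + 2 / D) := by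
    rw [← mul_sub, abs_mul, abs_of_pos hNp, abs_sub_comm]
    exact mul_le_mul_of_nonneg_left h3 hNp.le
  have h5 : a + b - N * L = (a - N * T) + b + (N * T - N * L) := by ring
  rw [h5]
  refine (abs_add_three _ _ _).trans ((add_le_add (add_le_add h1 h2) h4).trans ?_)
  have hlog : Real.log N ≤ Real.log D := Real.log_le_log hNp (by exact_mod_cast hND)
  have h6 : θ * N * (1 + Real.log N) ≤ θ * N * (1 + Real.log D) := by gcongr
  have h7 : 0 ≤ θ * N := by positivity
  have e2 : N * (B / Z + θ * (1 + 2 * Real.log D) + 2 / D) = B * N / Z + θ * N * (1 + 2 * Real.log D) + 2 * N / D := by ring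
  have e3 : 2 * B * N / Z = B * N / Z + B * N / Z := by ring
  rw [e2, e3]
  nlinarith

/-- asymptotics -/
theorem R_asymp (η : ℝ) (hη : 4/9 < η) : ∃ δ : ℝ, 0 < δ ∧ ∃ D0 : ℕ, ∀ (D : ℕ) [NeZero D], D0 < D → Squarefree D → D % 2 = 1 →
    ∀ N : ℕ, (D:ℝ)^η ≤ N → N ≤ D → |(RR D N : ℝ) - N * (LFunction (chiD D) 1).re| ≤ 8 * N * (D:ℝ)^(-δ) := by
  obtain ⟨Db, hDb⟩ := burgess
  set δ := min ((η - 4/9)/2) (1/1440) with hδ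
  have hδ0 : 0 < δ := by apply lt_min <;> linarith
  have hδ1 : δ ≤ (η - 4/9)/2 := min_le_left _ _
  have hδ2 : δ ≤ 1/1440 := min_le_right _ _
  obtain ⟨Dl, hDl⟩ := eventually_atTop.mp (ev_log 18 (by norm_num) (show (0:ℝ) < 1/1440 by norm_num))
  obtain ⟨Dc, hDc⟩ := eventually_atTop.mp (ev_const 2 (show (0:ℝ) < η - δ by linarith))
  refine ⟨δ, hδ0, max (max Db Dl) (max Dc 1), ?_⟩
  intro D _ hD hsq hodd N hN hND
  simp only [max_lt_iff] at hD
  have hDr : (1:ℝ) < D := by exact_mod_cast hD.2.2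
  have hne := chiD_ne_one D hsq hodd hD.2.2
  have hNp : (0:ℝ) < N := lt_of_lt_of_le (by positivity) hN
  have hb : ∀ (M : ℤ) (n : ℕ), |((∑ n ∈ Finset.Ioc M (M+n), jacobiSym n D : ℤ):ℝ)| ≤ (6 * (D:ℝ)^(-(1/720:ℝ))) * n + (D:ℝ)^((4:ℝ)/9) := by
    intro M n
    refine (hDb D hD.1.1 hsq hodd M n).trans (le_of_eq (by ring))
  set W := N * (D:ℝ)^(-δ) with hW
  have hW2 : (D:ℝ)^(η-δ) ≤ W := by
    rw [sub_eq_add_neg, Real.rpow_add (by linarith)]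
    exact mul_le_mul_of_nonneg_right hN (by positivity)
  have hW3 : 2 ≤ W := (hDc D hD.2.1.le).trans hW2
  have hWN : W ≤ N := by
    refine mul_le_of_le_one_right hNp.le ?_
    exact Real.rpow_le_one_of_one_le_of_nonpos hDr.le (by linarith)
  have hZ1 : 1 ≤ ⌊W⌋₊ := (Nat.one_le_floor_iff _).mpr (by linarith)
  have hZ2 : W / 2 ≤ (⌊W⌋₊ : ℝ) := by have := Nat.lt_floor_add_one W; linarith
  have hZ3 : (⌊W⌋₊ : ℝ) ≤ W := Nat.floor_le (by linarith)
  have hZN : ⌊W⌋₊ ≤ N := by exact_mod_cast hZ3.trans hWN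
  have h := R_error D hne _ _ (by positivity) (by positivity) hb ⌊W⌋₊ N hZ1 hZN hND
  refine h.trans ?_
  have hDδ : (0:ℝ) < (D:ℝ)^(-δ) := by positivity
  have t2 : 2 * (D:ℝ)^((4:ℝ)/9) * N / ⌊W⌋₊ ≤ 4 * W := by
    have hZp : (0:ℝ) < ⌊W⌋₊ := by exact_mod_cast hZ1
    rw [div_le_iff₀ hZp]
    have a1 : (D:ℝ)^((4:ℝ)/9) ≤ (D:ℝ)^(-δ) * (D:ℝ)^(η - δ) := by
      rw [← Real.rpow_add (by linarith)]
      exact Real.rpow_le_rpow_of_exponent_le hDr.le (by linarith)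
    calc 2 * (D:ℝ)^((4:ℝ)/9) * N ≤ 2 * ((D:ℝ)^(-δ) * W) * N := by gcongr; exact a1.trans (by gcongr)
      _ = 4 * W * (W/2) := by rw [hW]; ring
      _ ≤ 4 * W * ⌊W⌋₊ := by gcongr
  have t3 : 3 * (6 * (D:ℝ)^(-(1/720:ℝ))) * N * (1 + Real.log D) ≤ W := by
    calc _ = N * ((D:ℝ)^(-(1/720:ℝ)) * (18 * (1 + Real.log D))) := by ring
      _ ≤ N * ((D:ℝ)^(-(1/720:ℝ)) * (D:ℝ)^(1/1440:ℝ)) := by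
        have := hDl D hD.1.2.le
        gcongr
      _ ≤ N * (D:ℝ)^(-δ) := by
        gcongr
        rw [← Real.rpow_add (by linarith)]
        exact Real.rpow_le_rpow_of_exponent_le hDr.le (by linarith)
  have t4 : 2 * N / D ≤ 2 * W := by
    have : (D:ℝ)⁻¹ ≤ (D:ℝ)^(-δ) := by
      rw [← Real.rpow_neg_one]
      exact Real.rpow_le_rpow_of_exponent_le hDr.le (by linarith)
    calc 2 * N / D = 2 * (N * (D:ℝ)⁻¹) := by ring
      _ ≤ 2 * (N * (D:ℝ)^(-δ)) := by gcongr
  calc _ ≤ W + 4 * W + W + 2 * W := by linarith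
    _ = 8 * N * (D:ℝ)^(-δ) := by rw [hW]; ring

end HB


set_option linter.unusedSectionVars false
set_option linter.deprecated false
set_option linter.unusedVariables false

namespace HB
open ArithmeticFunction

/-- number of roots of t² - t + k modulo n -/
noncomputable def rho (k : ℤ) : ArithmeticFunction ℤ :=
  ⟨fun n => if n = 0 then 0 else (Nat.card {t : ZMod n // t * t - t + (k : ZMod n) = 0} : ℤ), by simp⟩

lemma rho_apply (k : ℤ) (n : ℕ) (hn : n ≠ 0) :
    rho k n = (Nat.card {t : ZMod n // t * t - t + (k : ZMod n) = 0} : ℤ) := by simp [rho, hn]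

lemma rho_nonneg (k : ℤ) (n : ℕ) : 0 ≤ rho k n := by
  by_cases hn : n = 0
  · simp [hn]
  · rw [rho_apply k n hn]; positivity

lemma rho_one (k : ℤ) : rho k 1 = 1 := by
  rw [rho_apply k 1 one_ne_zero]
  have : Nat.card {t : ZMod 1 // t * t - t + (k : ZMod 1) = 0} = 1 := by
    rw [Nat.card_eq_one_iff_unique]
    refine ⟨⟨fun a b => Subtype.ext (Subsingleton.elim _ _)⟩, ⟨⟨0, Subsingleton.elim _ _⟩⟩⟩
  rw [this]; rfl

lemma rho_mult (k : ℤ) : (rho k).IsMultiplicative := by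
  rw [IsMultiplicative.iff_ne_zero]
  refine ⟨rho_one k, ?_⟩
  intro m n hm hn hmn
  rw [rho_apply k _ hm, rho_apply k _ hn, rho_apply k _ (mul_ne_zero hm hn), ← Nat.cast_mul,
    ← Nat.card_prod]
  congr 1
  let e := ZMod.chineseRemainder hmn
  have key : ∀ t : ZMod (m*n), t * t - t + (k : ZMod (m*n)) = 0 ↔
      (e t).1 * (e t).1 - (e t).1 + (k : ZMod m) = 0 ∧ (e t).2 * (e t).2 - (e t).2 + (k : ZMod n) = 0 := by
    intro t
    rw [← e.map_eq_zero_iff, Prod.ext_iff]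
    simp
  refine Nat.card_congr ?_
  refine ((e.toEquiv.subtypeEquiv (q := fun x : ZMod m × ZMod n => x.1 * x.1 - x.1 + (k : ZMod m) = 0 ∧ x.2 * x.2 - x.2 + (k : ZMod n) = 0) key)).trans ?_
  exact Equiv.subtypeProdEquivProd (p := fun x : ZMod m => x * x - x + (k : ZMod m) = 0) (q := fun x : ZMod n => x * x - x + (k : ZMod n) = 0)

open Classical in
/-- indicator of nonzero squares -/
noncomputable def sqInd : ArithmeticFunction ℤ :=
  ⟨fun n => if n ≠ 0 ∧ IsSquare n then 1 else 0, by simp⟩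

lemma sqInd_sq (d : ℕ) (hd : d ≠ 0) : sqInd (d^2) = 1 := by
  have : IsSquare (d^2) := ⟨d, by ring⟩
  simp [sqInd, hd, this]

lemma sqInd_nonneg (n : ℕ) : 0 ≤ sqInd n := by
  simp only [sqInd, coe_mk]
  split_ifs <;> norm_num

lemma sqInd_mult : sqInd.IsMultiplicative := by
  rw [IsMultiplicative.iff_ne_zero]
  refine ⟨by simpa using sqInd_sq 1 one_ne_zero, ?_⟩
  intro m n hm hn hmn
  have key : IsSquare (m*n) ↔ IsSquare m ∧ IsSquare n := by
    constructor
    · rintro ⟨c, hc⟩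
      have hu : IsUnit (gcd m n) := by rw [Nat.isUnit_iff]; exact hmn
      have hu2 : IsUnit (gcd n m) := by rw [Nat.isUnit_iff]; exact hmn.symm
      obtain ⟨d, hd⟩ := exists_eq_pow_of_mul_eq_pow hu (show m * n = c^2 by rw [hc]; ring)
      obtain ⟨d', hd'⟩ := exists_eq_pow_of_mul_eq_pow hu2 (show n * m = c^2 by rw [mul_comm, hc]; ring)
      exact ⟨⟨d, by rw [hd]; ring⟩, ⟨d', by rw [hd']; ring⟩⟩
    · rintro ⟨h1, h2⟩; exact h1.mul h2
  simp only [sqInd, coe_mk]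
  by_cases h1 : IsSquare m <;> by_cases h2 : IsSquare n <;> simp [key, h1, h2, hm, hn]

lemma sqInd_prime_pow (p j : ℕ) (hp : p.Prime) : sqInd (p^j) = if Even j then 1 else 0 := by
  have : IsSquare (p^j) ↔ Even j := by
    constructor
    · rintro ⟨c, hc⟩
      have hc0 : c ≠ 0 := by
        rintro rfl
        have := pow_pos hp.pos j
        omega
      have h := congrArg (fun x => x.factorization p) hc
      simp only [Nat.factorization_mul hc0 hc0, hp.factorization_pow] at h
      simp at h
      exact ⟨_, h⟩
    · rintro ⟨r, rfl⟩
      exact ⟨p^r, by rw [pow_add]⟩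
  simp [sqInd, this, hp.ne_zero]

lemma JA_mult (D : ℕ) : (JA D).IsMultiplicative := by
  rw [IsMultiplicative.iff_ne_zero]
  refine ⟨by rw [JA_apply D 1 one_ne_zero]; simp, ?_⟩
  intro m n hm hn _
  rw [JA_apply D _ hm, JA_apply D _ hn, JA_apply D _ (mul_ne_zero hm hn), Nat.cast_mul, jacobiSym.mul_left]

lemma rr_mult (D : ℕ) : (rr D).IsMultiplicative :=
  (JA_mult D).mul (isMultiplicative_zeta.natCast)

lemma mul_prime_pow (f g : ArithmeticFunction ℤ) (p m : ℕ) (hp : p.Prime) :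
    (f * g) (p^m) = ∑ i ∈ Finset.range (m+1), f (p^i) * g (p^(m-i)) := by
  rw [mul_apply, Nat.sum_divisorsAntidiagonal (fun a b => f a * g b), Nat.sum_divisors_prime_pow hp]
  refine Finset.sum_congr rfl ?_
  intro i hi
  rw [Finset.mem_range] at hi
  rw [Nat.pow_div (by omega) hp.pos]

lemma rr_prime_pow (D p m : ℕ) (hp : p.Prime) :
    rr D (p^m) = ∑ i ∈ Finset.range (m+1), (jacobiSym p D)^i := by
  unfold rr
  rw [mul_prime_pow _ _ p m hp]
  refine Finset.sum_congr rfl ?_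
  intro i hi
  rw [JA_apply _ _ (pow_ne_zero _ hp.ne_zero), Nat.cast_pow, jacobiSym.pow_left]
  simp [hp.ne_zero]

lemma jac_flip (D p : ℕ) (hD : D % 4 = 3) (hp : p % 2 = 1) : jacobiSym (-(D:ℤ)) p = jacobiSym p D := by
  have hpo : Odd p := Nat.odd_iff.2 hp
  rw [jacobiSym.neg _ hpo]
  rcases (by omega : p % 4 = 1 ∨ p % 4 = 3) with h | h
  · rw [ZMod.χ₄_nat_one_mod_four h, one_mul,
      jacobiSym.quadratic_reciprocity_one_mod_four h (Nat.odd_iff.2 (by omega))]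
  · rw [ZMod.χ₄_nat_three_mod_four h, jacobiSym.quadratic_reciprocity_three_mod_four h hD]; ring

lemma rho_two (D : ℕ) (k : ℤ) (hk : (D:ℤ) + 1 = 4 * k) : rho k 2 = 1 + jacobiSym 2 D := by
  have hodd : Odd D := Nat.odd_iff.2 (by omega)
  rw [rho_apply k 2 two_ne_zero, jacobiSym.at_two hodd, ZMod.χ₈_nat_eq_if_mod_eight]
  rcases Int.even_or_odd k with h | h
  · have hk0 : (k : ZMod 2) = 0 := by
      rw [ZMod.intCast_zmod_eq_zero_iff_dvd]; exact_mod_cast h.two_dvd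
    obtain ⟨j, hj⟩ := h
    rw [hk0, if_neg (by omega), if_pos (by omega)]
    have : Nat.card {t : ZMod 2 // t * t - t + 0 = 0} = 2 := by
      rw [Nat.card_eq_fintype_card]; decide
    rw [this]; norm_num
  · obtain ⟨j, hj⟩ := h
    have hk0 : (k : ZMod 2) = 1 := by
      rw [hj]; push_cast
      rw [show (2 : ZMod 2) = 0 from rfl]; ring
    rw [hk0, if_neg (by omega), if_neg (by omega)]
    have : Nat.card {t : ZMod 2 // t * t - t + 1 = 0} = 0 := by
      rw [Nat.card_eq_fintype_card]; decide
    rw [this]; norm_num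

lemma rho_odd (D p : ℕ) (k : ℤ) (hk : (D:ℤ) + 1 = 4 * k) (hp : p.Prime) (hp2 : p ≠ 2) :
    rho k p = 1 + jacobiSym p D := by
  have : Fact p.Prime := ⟨hp⟩
  have hodd : p % 2 = 1 := (hp.eq_two_or_odd).resolve_left hp2
  rw [← jac_flip D p (by omega) hodd, ← jacobiSym.legendreSym.to_jacobiSym, legendreSym, rho_apply k p hp.ne_zero]
  have hc : ringChar (ZMod p) ≠ 2 := by rw [ZMod.ringChar_zmod_n]; exact hp2
  rw [add_comm, ← quadraticChar_card_sqrts hc]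
  have h2 : (2 : ZMod p) ≠ 0 := by
    intro h
    exact Ring.two_ne_zero hc h
  have hkz : (D : ZMod p) + 1 = 4 * (k : ZMod p) := by exact_mod_cast congrArg (fun x : ℤ => (x : ZMod p)) hk
  rw [Set.toFinset_card, ← Nat.card_eq_fintype_card]
  congr 1
  refine Nat.card_congr ?_
  refine ⟨fun t => ⟨2 * t.1 - 1, ?_⟩, fun x => ⟨(x.1 + 1) / 2, ?_⟩, ?_, ?_⟩
  · have := t.2
    simp only [Set.mem_setOf_eq]
    push_cast
    linear_combination 4 * this + hkz
  · have := x.2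
    simp only [Set.mem_setOf_eq] at this
    push_cast at this
    field_simp
    linear_combination this - hkz
  · intro t; ext; simp only; field_simp; ring
  · intro t; ext; simp only; field_simp; ring

lemma rho_prime (D p : ℕ) (k : ℤ) (hk : (D:ℤ) + 1 = 4 * k) (hp : p.Prime) :
    rho k p = 1 + jacobiSym p D := by
  by_cases h : p = 2
  · subst h; exact rho_two D k hk
  · exact rho_odd D p k hk hp h

lemma root_int (k : ℤ) (n : ℕ) (t : ℤ) :
    ((t : ZMod n) * (t : ZMod n) - (t : ZMod n) + (k : ZMod n) = 0) ↔ (n:ℤ) ∣ t*t - t + k := by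
  rw [← ZMod.intCast_zmod_eq_zero_iff_dvd]; push_cast; rfl

/-- no root means count zero -/
lemma rho_zero_of (k : ℤ) (n : ℕ) (hn : n ≠ 0) (h : ∀ t : ℤ, ¬ (n:ℤ) ∣ t*t - t + k) : rho k n = 0 := by
  rw [rho_apply k n hn]
  have : IsEmpty {t : ZMod n // t * t - t + (k : ZMod n) = 0} := by
    constructor
    rintro ⟨t, ht⟩
    obtain ⟨z, rfl⟩ := ZMod.intCast_surjective t
    exact h z ((root_int k n z).1 ht)
  simp

lemma exists_of_rho_ne (k : ℤ) (n : ℕ) (hn : n ≠ 0) (h : rho k n ≠ 0) : ∃ t : ℤ, (n:ℤ) ∣ t*t - t + k := by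
  by_contra hc
  push Not at hc
  exact h (rho_zero_of k n hn hc)

lemma hensel (k : ℤ) (p : ℕ) (hp : p.Prime) (hd : ¬ (p:ℤ) ∣ 4*k - 1) (t0 : ℤ) (h0 : (p:ℤ) ∣ t0*t0 - t0 + k)
    (j : ℕ) : ∃ t : ℤ, ((p:ℤ)^(j+1)) ∣ t*t - t + k := by
  have hpz : Prime (p:ℤ) := Nat.prime_iff_prime_int.1 hp
  induction j with
  | zero => exact ⟨t0, by simpa using h0⟩
  | succ j ih =>
    obtain ⟨t, u, hu⟩ := ih
    have hnd : ¬ (p:ℤ) ∣ 2*t-1 := by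
      intro h
      apply hd
      have h3 : (p:ℤ) ∣ t*t - t + k := ⟨(p:ℤ)^j * u, by rw [hu]; ring⟩
      have : 4*k - 1 = 4*(t*t-t+k) - (2*t-1)*(2*t-1) := by ring
      rw [this]
      exact dvd_sub (h3.mul_left _) (h.mul_left _)
    have hco : IsCoprime (p:ℤ) (2*t-1) := (hpz.coprime_iff_not_dvd).2 hnd
    obtain ⟨x, y, hxy⟩ := hco
    refine ⟨t + (p:ℤ)^(j+1) * (-u*y), u*x + (p:ℤ)^j * (u*y)^2, ?_⟩
    have e : (t + (p:ℤ)^(j+1) * (-u*y)) * (t + (p:ℤ)^(j+1) * (-u*y)) - (t + (p:ℤ)^(j+1) * (-u*y)) + k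
      = (t*t - t + k) + (p:ℤ)^(j+1) * (-u*y) * (2*t-1) + (p:ℤ)^(j+1)*(p:ℤ)^(j+1) * (u*y)^2 := by ring
    rw [e, hu]
    have hy : y * (2*t-1) = 1 - x * p := by linarith
    have : (p:ℤ)^(j+1) * (-u*y) * (2*t-1) = (p:ℤ)^(j+1) * (-u) * (1 - x*p) := by rw [← hy]; ring
    rw [this]; ring

lemma rho_two_of (k : ℤ) (p : ℕ) (hp : p.Prime) (hd : ¬ (p:ℤ) ∣ 4*k - 1) (t0 : ℤ) (h0 : (p:ℤ) ∣ t0*t0 - t0 + k)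
    (j : ℕ) : rho k (p^(j+1)) = 2 := by
  have hpz : Prime (p:ℤ) := Nat.prime_iff_prime_int.1 hp
  obtain ⟨t, ht⟩ := hensel k p hp hd t0 h0 j
  have hpp : (p:ℤ) ∣ (p:ℤ)^(j+1) := dvd_pow_self _ (by omega)
  have hnd : ¬ (p:ℤ) ∣ 2*t-1 := by
    intro h
    apply hd
    have h3 : (p:ℤ) ∣ t*t - t + k := hpp.trans ht
    have : 4*k - 1 = 4*(t*t-t+k) - (2*t-1)*(2*t-1) := by ring
    rw [this]
    exact dvd_sub (h3.mul_left _) (h.mul_left _)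
  rw [rho_apply k _ (pow_ne_zero _ hp.ne_zero)]
  have hset : {s : ZMod (p^(j+1)) | s * s - s + (k : ZMod (p^(j+1))) = 0} =
      {((t:ℤ) : ZMod (p^(j+1))), ((1 - t : ℤ) : ZMod (p^(j+1)))} := by
    ext s
    obtain ⟨z, rfl⟩ := ZMod.intCast_surjective s
    simp only [Set.mem_setOf_eq, Set.mem_insert_iff, Set.mem_singleton_iff]
    rw [root_int, ZMod.intCast_eq_intCast_iff_dvd_sub, ZMod.intCast_eq_intCast_iff_dvd_sub]
    push_cast
    constructor
    · intro h
      have h5 : (p:ℤ)^(j+1) ∣ (t - z) * (1 - t - z) := by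
        have : (t - z) * (1 - t - z) = (z*z - z + k) - (t*t - t + k) := by ring
        rw [this]; exact dvd_sub h ht
      by_cases h6 : (p:ℤ) ∣ t - z
      · left
        have h7 : ¬ (p:ℤ) ∣ 1 - t - z := by
          intro h8
          apply hnd
          have : 2*t - 1 = (t - z) - (1 - t - z) := by ring
          rw [this]; exact dvd_sub h6 h8
        exact (IsCoprime.pow_left ((hpz.coprime_iff_not_dvd).2 h7)).dvd_of_dvd_mul_right h5
      · right
        exact (IsCoprime.pow_left ((hpz.coprime_iff_not_dvd).2 h6)).dvd_of_dvd_mul_left h5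
    · rintro (⟨c, h⟩ | ⟨c, h⟩)
      · obtain ⟨d, hd⟩ := ht
        have : z = t - (p:ℤ)^(j+1) * c := by linarith
        refine ⟨d - c * (2*t-1) + (p:ℤ)^(j+1) * c^2, ?_⟩
        rw [this]
        linear_combination hd
      · obtain ⟨d, hd⟩ := ht
        have : z = 1 - t - (p:ℤ)^(j+1) * c := by linarith
        refine ⟨d + c * (2*t-1) + (p:ℤ)^(j+1) * c^2, ?_⟩
        rw [this]
        linear_combination hd
  have hne : ((t:ℤ) : ZMod (p^(j+1))) ≠ ((1 - t : ℤ) : ZMod (p^(j+1))) := by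
    rw [Ne, ZMod.intCast_eq_intCast_iff_dvd_sub]
    push_cast
    intro h
    apply hnd
    have : 2*t - 1 = -(1 - t - t) := by ring
    rw [this]
    exact (dvd_neg).2 (hpp.trans h)
  have : Nat.card {s : ZMod (p^(j+1)) // s * s - s + (k : ZMod (p^(j+1))) = 0} = 2 := by
    have h9 := Set.ncard_pair hne
    rw [← hset] at h9
    exact h9
  rw [this]; rfl

lemma rho_prime_pow (D p : ℕ) (k : ℤ) (hk : (D:ℤ) + 1 = 4 * k) (hsq : Squarefree D) (hp : p.Prime) (j : ℕ) :
    rho k (p^(j+2)) = (jacobiSym p D)^(j+1) + (jacobiSym p D)^(j+2) := by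
  have hpz : Prime (p:ℤ) := Nat.prime_iff_prime_int.1 hp
  have hD0 : D ≠ 0 := hsq.ne_zero
  have h1 := rho_prime D p k hk hp
  have e1 : 4*k - 1 = (D:ℤ) := by linarith
  rcases jacobiSym.trichotomy p D with h | h | h
  · -- p ∣ D
    rw [h]
    have hpD : (p:ℤ) ∣ D := by
      have : NeZero D := ⟨hD0⟩
      rw [jacobiSym.eq_zero_iff_not_coprime] at h
      have : ¬ Nat.Coprime p D := by simpa [Int.gcd_natCast_natCast] using h
      rw [Nat.Prime.coprime_iff_not_dvd hp, not_not] at this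
      exact_mod_cast this
    rw [rho_zero_of k _ (pow_ne_zero _ hp.ne_zero)]
    · simp
    · intro t ht
      have hp2 : (p:ℤ)^2 ∣ t*t - t + k := by
        refine dvd_trans ?_ ht
        push_cast
        exact pow_dvd_pow _ (by omega)
      have hpp : (p:ℤ) ∣ t*t - t + k := (dvd_pow_self _ (by norm_num)).trans hp2
      have h3 : (p:ℤ) ∣ (2*t-1)*(2*t-1) := by
        have : (2*t-1)*(2*t-1) = 4*(t*t-t+k) - D := by rw [← e1]; ring
        rw [this]; exact dvd_sub (hpp.mul_left _) hpD
      have h4 : (p:ℤ) ∣ 2*t-1 := by rcases hpz.dvd_or_dvd h3 with h | h <;> exact h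
      have h5 : (p:ℤ)^2 ∣ D := by
        have : (D:ℤ) = 4*(t*t-t+k) - (2*t-1)^2 := by rw [← e1]; ring
        rw [this]; exact dvd_sub (hp2.mul_left _) (pow_dvd_pow_of_dvd h4 2)
      have h6 : p * p ∣ D := by
        have : p^2 ∣ D := by exact_mod_cast h5
        rwa [pow_two] at this
      have := hsq p h6
      rw [Nat.isUnit_iff] at this
      exact hp.one_lt.ne' this
  · rw [h] at h1 ⊢
    obtain ⟨t0, ht0⟩ := exists_of_rho_ne k p hp.ne_zero (by rw [h1]; norm_num)
    rw [rho_two_of k p hp _ t0 ht0 (j+1)]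
    · simp
    · rw [e1]
      intro hdvd
      have : NeZero D := ⟨hD0⟩
      have : jacobiSym p D = 0 := by
        rw [jacobiSym.eq_zero_iff_not_coprime]
        have : p ∣ D := by exact_mod_cast hdvd
        simp only [Int.gcd_natCast_natCast]
        exact fun hco => (Nat.Prime.coprime_iff_not_dvd hp).1 hco this
      rw [h] at this; norm_num at this
  · rw [h] at h1 ⊢
    rw [rho_zero_of k _ (pow_ne_zero _ hp.ne_zero)]
    · rw [pow_succ]; ring
    · intro t ht
      have hpp : (p:ℤ) ∣ t*t - t + k := by
        refine dvd_trans ?_ ht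
        push_cast
        exact dvd_pow_self _ (by omega)
      have hex : Nat.card {t : ZMod p // t * t - t + (k : ZMod p) = 0} ≠ 0 := by
        have : NeZero p := ⟨hp.ne_zero⟩
        have : Nonempty {t : ZMod p // t * t - t + (k : ZMod p) = 0} := ⟨⟨t, (root_int k p t).2 hpp⟩⟩
        exact Nat.card_pos.ne'
      rw [rho_apply k p hp.ne_zero] at h1
      apply hex
      have : (1:ℤ) + -1 = 0 := by norm_num
      rw [this] at h1
      exact_mod_cast h1

lemma rho_sq_prime_pow (D p : ℕ) (k : ℤ) (hk : (D:ℤ) + 1 = 4 * k) (hsq : Squarefree D) (hp : p.Prime) :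
    ∀ m : ℕ, (rho k * sqInd) (p^m) = rr D (p^m)
  | 0 => by
    rw [mul_prime_pow _ _ p _ hp, rr_prime_pow D p _ hp]
    simp [rho_one, sqInd_mult.1]
  | 1 => by
    rw [mul_prime_pow _ _ p _ hp, rr_prime_pow D p _ hp]
    have h1 := rho_prime D p k hk hp
    have h2 := sqInd_prime_pow p 1 hp
    simp only [pow_one, Nat.not_even_one, if_false] at h2
    simp [Finset.sum_range_succ, rho_one, sqInd_mult.1, h1, h2]
  | (m+2) => by
    have ih := rho_sq_prime_pow D p k hk hsq hp m
    rw [mul_prime_pow _ _ p _ hp, rr_prime_pow D p _ hp] at ih ⊢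
    have h2 := sqInd_prime_pow p 1 hp
    simp only [pow_one, Nat.not_even_one, if_false] at h2
    rw [Finset.sum_range_succ, Finset.sum_range_succ, Finset.sum_range_succ (n := m+1+1), Finset.sum_range_succ (n := m+1), ← ih,
      show m + 2 - (m+1) = 1 by omega, show m + 2 - (m+1+1) = 0 by omega, pow_one, h2, pow_zero, sqInd_mult.1,
      rho_prime_pow D p k hk hsq hp m]
    have : ∑ i ∈ Finset.range (m+1), rho k (p^i) * sqInd (p^(m+2-i)) = ∑ i ∈ Finset.range (m+1), rho k (p^i) * sqInd (p^(m-i)) := by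
      refine Finset.sum_congr rfl ?_
      intro i hi
      rw [Finset.mem_range] at hi
      rw [sqInd_prime_pow p _ hp, sqInd_prime_pow p _ hp, show m + 2 - i = (m - i) + 2 by omega]
      simp [Nat.even_add]
    rw [this]; ring

theorem rho_mul_sq (D : ℕ) (k : ℤ) (hk : (D:ℤ) + 1 = 4 * k) (hsq : Squarefree D) :
    rho k * sqInd = rr D := by
  rw [IsMultiplicative.eq_iff_eq_on_prime_powers _ ((rho_mult k).mul sqInd_mult) _ (rr_mult D)]
  intro p i hp
  exact rho_sq_prime_pow D p k hk hsq hp i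

end HB


set_option linter.unusedSectionVars false
set_option linter.deprecated false
set_option linter.unusedVariables false

namespace HB
open ArithmeticFunction

noncomputable def PP (k : ℤ) (N : ℕ) : ℤ := ∑ n ∈ Finset.Ioc 0 N, rho k n

lemma PP_nonneg (k : ℤ) (N : ℕ) : 0 ≤ PP k N := Finset.sum_nonneg fun n _ => rho_nonneg k n

lemma rho_le_rr (D : ℕ) (k : ℤ) (hk : (D:ℤ) + 1 = 4 * k) (hsq : Squarefree D) (n : ℕ) :
    rho k n ≤ rr D n := by
  by_cases hn : n = 0
  · simp [hn]
  rw [← rho_mul_sq D k hk hsq, mul_apply]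
  have h := Finset.single_le_sum (f := fun x : ℕ × ℕ => rho k x.1 * sqInd x.2) (s := n.divisorsAntidiagonal)
    (fun x _ => mul_nonneg (rho_nonneg k x.1) (sqInd_nonneg x.2)) (a := (n, 1)) (by simp [hn])
  simpa [sqInd_mult.1] using h

lemma PP_le_RR (D : ℕ) (k : ℤ) (hk : (D:ℤ) + 1 = 4 * k) (hsq : Squarefree D) (N : ℕ) :
    PP k N ≤ RR D N := Finset.sum_le_sum fun n _ => rho_le_rr D k hk hsq n

lemma RR_le_PP (D : ℕ) (k : ℤ) (hk : (D:ℤ) + 1 = 4 * k) (hsq : Squarefree D) (N : ℕ) :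
    RR D N ≤ ∑ d ∈ Finset.Ioc 0 N, PP k (N / d^2) := by
  classical
  unfold RR
  rw [← rho_mul_sq D k hk hsq, mul_comm, sum_Ioc_mul_eq_sum_sum]
  have h1 : ∑ n ∈ Finset.Ioc 0 N, sqInd n * ∑ m ∈ Finset.Ioc 0 (N/n), rho k m ≤
      ∑ n ∈ (Finset.Ioc 0 N).filter IsSquare, PP k (N/n) := by
    rw [Finset.sum_filter]
    refine Finset.sum_le_sum ?_
    intro n hn
    rw [Finset.mem_Ioc] at hn
    have hn0 : n ≠ 0 := by omega
    by_cases h : IsSquare n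
    · simp [sqInd, h, hn0, PP]
    · simp [sqInd, h]
  refine h1.trans ?_
  have hinj : Set.InjOn (fun d : ℕ => d^2) (Finset.Ioc 0 N : Finset ℕ) := by
    intro a _ b _ h
    exact Nat.pow_left_injective (by norm_num : (2:ℕ) ≠ 0) h
  rw [← Finset.sum_image (f := fun n => PP k (N/n)) hinj]
  refine Finset.sum_le_sum_of_subset_of_nonneg ?_ (fun i _ _ => PP_nonneg k _)
  intro n hn
  rw [Finset.mem_filter, Finset.mem_Ioc] at hn
  obtain ⟨⟨h0, h2⟩, d, hd⟩ := hn
  rw [Finset.mem_image]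
  refine ⟨d, ?_, by rw [hd]; ring⟩
  rw [Finset.mem_Ioc]
  have : 0 < d := by
    rcases Nat.eq_zero_or_pos d with h | h
    · subst h; omega
    · exact h
  exact ⟨this, by nlinarith⟩

lemma RR_triv (D N : ℕ) (hN : 1 ≤ N) : (RR D N : ℝ) ≤ N * (1 + Real.log N) := by
  rw [RR_eq]
  push_cast [-Int.natCast_ediv]
  have h : ∀ d ∈ Finset.Ioc 0 N, ((jacobiSym (d:ℤ) D : ℤ):ℝ) * (((N/d : ℕ):ℤ):ℝ) ≤ (N:ℝ) * (d:ℝ)⁻¹ := by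
    intro d hd
    have h1 : ((jacobiSym (d:ℤ) D : ℤ):ℝ) ≤ 1 := by
      have := (abs_le.1 (abs_jacobi_le (d:ℤ) D)).2
      exact_mod_cast this
    have h2 : (((N/d : ℕ):ℤ):ℝ) ≤ (N:ℝ) * (d:ℝ)⁻¹ := by
      rw [← div_eq_mul_inv, Int.cast_natCast]; exact Nat.cast_div_le
    have h3 : (0:ℝ) ≤ (((N/d : ℕ):ℤ):ℝ) := by rw [Int.cast_natCast]; positivity
    nlinarith
  refine (Finset.sum_le_sum h).trans ?_
  rw [← Finset.mul_sum]
  refine mul_le_mul_of_nonneg_left ?_ (by positivity)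
  exact sum_inv_le N hN

instance fin_roots (k : ℤ) (M N : ℕ) (a : ↥(Finset.Ioc M N)) :
    Finite {t : ZMod a.1 // t * t - t + (k : ZMod a.1) = 0} := by
  have : NeZero a.1 := ⟨by have := Finset.mem_Ioc.1 a.2; omega⟩
  infer_instance

lemma sum_rho_card (k : ℤ) (M N : ℕ) :
    ∑ n ∈ Finset.Ioc M N, rho k n =
      (Nat.card (Σ a : ↥(Finset.Ioc M N), {t : ZMod a.1 // t * t - t + (k : ZMod a.1) = 0}) : ℤ) := by
  rw [Nat.card_sigma, ← Finset.sum_coe_sort, Nat.cast_sum]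
  refine Finset.sum_congr rfl ?_
  intro a _
  exact rho_apply k a.1 (by have := Finset.mem_Ioc.1 a.2; omega)

lemma class_le (D : ℕ) (k : ℤ) (hk : (D:ℤ) + 1 = 4 * k) :
    (classNumber D : ℤ) ≤ PP k (Nat.sqrt D) := by
  unfold PP classNumber
  rw [sum_rho_card, Nat.cast_le]
  have hodd : ∀ f : ℤ × ℤ × ℤ, IsReducedForm D f → f.2.1 % 2 = 1 := by
    rintro ⟨a, b, c⟩ ⟨h1, h2, h3, h4, h5⟩
    simp only at h2 ⊢
    rcases Int.emod_two_eq_zero_or_one b with h | h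
    · exfalso
      obtain ⟨u, rfl⟩ := Int.dvd_of_emod_eq_zero h
      have h2' : 4 * (u^2 - a*c) = -(D:ℤ) := by linarith
      omega
    · exact h
  have hle : ∀ f : ℤ × ℤ × ℤ, IsReducedForm D f → f.1.toNat ∈ Finset.Ioc 0 (Nat.sqrt D) := by
    rintro ⟨a, b, c⟩ ⟨h1, h2, h3, h4, h5⟩
    simp only at h1 h2 h3 h4 ⊢
    rw [Finset.mem_Ioc]
    refine ⟨by omega, ?_⟩
    rw [Nat.le_sqrt]
    have hb : b^2 ≤ a^2 := by rw [← sq_abs b]; exact pow_le_pow_left₀ (abs_nonneg b) h3 2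
    zify
    rw [Int.toNat_of_nonneg h1.le]
    nlinarith
  have hroot : ∀ f : ℤ × ℤ × ℤ, IsReducedForm D f →
      ((((f.2.1+1)/2 : ℤ)) : ZMod f.1.toNat) * ((((f.2.1+1)/2 : ℤ)) : ZMod f.1.toNat)
        - ((((f.2.1+1)/2 : ℤ)) : ZMod f.1.toNat) + (k : ZMod f.1.toNat) = 0 := by
    intro f hf
    have ho := hodd f hf
    obtain ⟨a, b, c⟩ := f
    obtain ⟨h1, h2, h3, h4, h5⟩ := hf
    simp only at h1 h2 ho ⊢
    rw [root_int, Int.toNat_of_nonneg h1.le]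
    obtain ⟨u, hu⟩ : ∃ u, b = 2*u - 1 := ⟨(b+1)/2, by omega⟩
    subst hu
    have : (2*u-1+1)/2 = u := by omega
    rw [this]
    refine ⟨c, ?_⟩
    have : 4 * (u*u - u + k) = 4 * (a * c) := by linarith
    linarith
  refine Nat.card_le_card_of_injective
    (fun f : {f : ℤ × ℤ × ℤ // IsReducedForm D f} =>
      (⟨⟨f.1.1.toNat, hle f.1 f.2⟩, ⟨(((f.1.2.1+1)/2 : ℤ)), hroot f.1 f.2⟩⟩ :
        Σ a : ↥(Finset.Ioc 0 (Nat.sqrt D)), {t : ZMod a.1 // t * t - t + (k : ZMod a.1) = 0})) ?_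
  rintro ⟨f, hf⟩ ⟨g, hg⟩ h
  have e1 := congrArg (fun x : (Σ a : ↥(Finset.Ioc 0 (Nat.sqrt D)), {t : ZMod a.1 // t * t - t + (k : ZMod a.1) = 0}) => x.1.1) h
  have e2 := congrArg (fun x : (Σ a : ↥(Finset.Ioc 0 (Nat.sqrt D)), {t : ZMod a.1 // t * t - t + (k : ZMod a.1) = 0}) => ((x.2.1.val : ℕ) : ℤ)) h
  have hf1 := hodd f hf
  have hg1 := hodd g hg
  obtain ⟨a, b, c⟩ := f
  obtain ⟨a', b', c'⟩ := g
  obtain ⟨h1, h2, h3, h4, h5⟩ := hf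
  obtain ⟨g1, g2, g3, g4, g5⟩ := hg
  simp only at h1 h2 h3 h4 h5 g1 g2 g3 g4 g5 e1 hf1 hg1
  have : NeZero a.toNat := ⟨by omega⟩
  have : NeZero a'.toNat := ⟨by omega⟩
  have haa : a = a' := by omega
  subst haa
  simp only [ZMod.val_intCast] at e2
  rw [Int.toNat_of_nonneg h1.le] at e2
  have hb1 : -a < b ∧ b ≤ a := by
    rw [abs_le] at h3
    refine ⟨?_, h3.2⟩
    by_contra hc
    have : b = -a := by omega
    have := h5 (Or.inl (by rw [this, abs_neg, abs_of_pos h1]))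
    omega
  have hb2 : -a < b' ∧ b' ≤ a := by
    rw [abs_le] at g3
    refine ⟨?_, g3.2⟩
    by_contra hc
    have : b' = -a := by omega
    have := g5 (Or.inl (by rw [this, abs_neg, abs_of_pos h1]))
    omega
  have hdvd : a ∣ (b+1)/2 - (b'+1)/2 := Int.ModEq.dvd (Int.ModEq.symm e2)
  obtain ⟨u, hu⟩ : ∃ u, b = 2*u - 1 := ⟨(b+1)/2, by omega⟩
  obtain ⟨u', hu'⟩ : ∃ u', b' = 2*u' - 1 := ⟨(b'+1)/2, by omega⟩
  have q1 : (b+1)/2 = u := by omega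
  have q2 : (b'+1)/2 = u' := by omega
  rw [q1, q2] at hdvd
  have hz : u - u' = 0 := by
    refine Int.eq_zero_of_abs_lt_dvd hdvd ?_
    rw [abs_lt]; constructor <;> omega
  have hbb : b = b' := by omega
  subst hbb
  have hcc : c = c' := by
    have : a * c = a * c' := by linarith
    exact mul_left_cancel₀ h1.ne' this
  subst hcc
  rfl

lemma count_ge (D : ℕ) (k : ℤ) (hk : (D:ℤ) + 1 = 4 * k) (X : ℝ) (c : ℝ) (M N : ℕ)
    (hM : ∀ a : ℕ, M < a → c * X ≤ a) (hN : ∀ a : ℕ, a ≤ N → (a:ℝ) ≤ 1 * X) :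
    ∑ n ∈ Finset.Ioc M N, rho k n ≤ (Nat.card {p : ℤ × ℤ //
                c * X ≤ (p.1 : ℝ) ∧ (p.1 : ℝ) ≤ 1 * X ∧
                  |p.2| ≤ p.1 ∧ (4 * p.1) ∣ (p.2 ^ 2 + (D : ℤ))} : ℤ) := by
  rw [sum_rho_card, Nat.cast_le]
  have hfin : Finite {p : ℤ × ℤ // c * X ≤ (p.1 : ℝ) ∧ (p.1 : ℝ) ≤ 1 * X ∧
                  |p.2| ≤ p.1 ∧ (4 * p.1) ∣ (p.2 ^ 2 + (D : ℤ))} := by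
    have hs : Set.Finite (Set.Icc (0:ℤ) ⌊X⌋ ×ˢ Set.Icc (-⌊X⌋) ⌊X⌋) :=
      (Set.finite_Icc _ _).prod (Set.finite_Icc _ _)
    refine Set.Finite.subset hs ?_
    rintro ⟨a, b⟩ ⟨h1, h2, h3, h4⟩
    simp only [one_mul] at h2 h3
    have h5 : a ≤ ⌊X⌋ := Int.le_floor.2 h2
    have h6 := abs_nonneg b
    rw [abs_le] at h3
    simp only [Set.mem_prod, Set.mem_Icc]
    omega
  let B : ℕ → ℕ → ℤ := fun a v => if 2*(v:ℤ) - 1 ≤ a then 2*(v:ℤ)-1 else 2*(v:ℤ)-1-2*a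
  have hBabs : ∀ a v : ℕ, v < a → |B a v| ≤ a := by
    intro a v h
    simp only [B]
    rw [abs_le]
    split_ifs <;> omega
  have hBd : ∀ a v : ℕ, (a:ℤ) ∣ (v:ℤ)*v - v + k → (4*(a:ℤ)) ∣ (B a v)^2 + D := by
    rintro a v ⟨w, hw⟩
    have e : (D:ℤ) = 4*k - 1 := by linarith
    simp only [B]
    split_ifs
    · refine ⟨w, ?_⟩
      rw [e]; linear_combination 4*hw
    · refine ⟨w - (2*(v:ℤ)-1) + a, ?_⟩
      rw [e]; linear_combination 4*hw
  refine Nat.card_le_card_of_injective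
    (fun x : (Σ a : ↥(Finset.Ioc M N), {t : ZMod a.1 // t * t - t + (k : ZMod a.1) = 0}) =>
      (⟨((x.1.1:ℤ), B x.1.1 x.2.1.val), ?_⟩ : {p : ℤ × ℤ // c * X ≤ (p.1 : ℝ) ∧ (p.1 : ℝ) ≤ 1 * X ∧
                  |p.2| ≤ p.1 ∧ (4 * p.1) ∣ (p.2 ^ 2 + (D : ℤ))})) ?_
  · obtain ⟨⟨a, ha⟩, ⟨t, ht⟩⟩ := x
    have ha' := Finset.mem_Ioc.1 ha
    have : NeZero a := ⟨by omega⟩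
    refine ⟨?_, ?_, ?_, ?_⟩
    · simpa using hM a ha'.1
    · simpa using hN a ha'.2
    · exact hBabs a t.val (ZMod.val_lt t)
    · refine hBd a t.val ?_
      rw [← root_int]
      have : (((t.val : ℕ) : ℤ) : ZMod a) = t := by rw [Int.cast_natCast, ZMod.natCast_zmod_val]
      rw [this]; exact ht
  · rintro ⟨⟨a, ha⟩, ⟨t, ht⟩⟩ ⟨⟨a', ha'⟩, ⟨t', ht'⟩⟩ h
    have h1 := congrArg Subtype.val h
    rw [Prod.mk.injEq] at h1
    obtain ⟨e1, e2⟩ := h1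
    have haa : a = a' := by
      simp only at e1
      exact_mod_cast e1
    subst haa
    have ha2 := Finset.mem_Ioc.1 ha
    have : NeZero a := ⟨by omega⟩
    have l1 : t.val < a := ZMod.val_lt t
    change B a t.val = B a t'.val at e2
    have l2 : t'.val < a := ZMod.val_lt t'
    have : t.val = t'.val := by
      simp only [B] at e2
      split_ifs at e2 <;> omega
    have : t = t' := ZMod.val_injective a this
    subst this
    rfl

end HB


set_option linter.unusedSectionVars false
set_option linter.deprecated false
set_option linter.unusedVariables false

namespace HB
open Filter Topology DirichletCharacter

lemma core_lower (D : ℕ) (k : ℤ) (hk : (D:ℤ) + 1 = 4 * k) (hsq : Squarefree D) (L E lo : ℝ) (N Y : ℕ)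
    (hL : 0 ≤ L) (hE : 0 ≤ E) (hlo0 : 0 < lo) (hND : N ≤ D) (hY : 4 ≤ Y)
    (hlo : ∀ d : ℕ, 1 ≤ d → d ≤ Y → lo ≤ ((N / d^2 : ℕ):ℝ))
    (hR : ∀ M : ℕ, lo ≤ (M:ℝ) → M ≤ D → |(RR D M : ℝ) - M * L| ≤ M * E) :
    (N:ℝ) * (3/20 * L - 2 * E - (1 + Real.log D) * (Y:ℝ)⁻¹) ≤ ((∑ n ∈ Finset.Ioc (N/10) N, rho k n : ℤ) : ℝ) := by
  have hYN : Y ≤ N := by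
    have h1 := hlo Y (by omega) le_rfl
    have h2 : 0 < N / Y^2 := by
      have : (0:ℝ) < ((N / Y^2 : ℕ):ℝ) := lt_of_lt_of_le hlo0 h1
      exact_mod_cast this
    have h3 : Y^2 ≤ N := by
      by_contra hc
      rw [Nat.div_eq_of_lt (by omega)] at h2
      omega
    nlinarith
  have hlogD : 0 ≤ Real.log D := Real.log_natCast_nonneg D
  -- PP at N / 10
  have hM : (PP k (N/10) : ℝ) ≤ (N:ℝ)/10 * (L + E) := by
    have h1 : (PP k (N/10) : ℝ) ≤ (RR D (N/10) : ℝ) := by exact_mod_cast PP_le_RR D k hk hsq _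
    have h2 : lo ≤ ((N/10 : ℕ):ℝ) := by
      refine (hlo 4 (by norm_num) hY).trans ?_
      have : N / 4^2 ≤ N/10 := Nat.div_le_div_left (by norm_num) (by norm_num)
      exact_mod_cast this
    have h3 := (abs_le.1 (hR (N/10) h2 ((Nat.div_le_self _ _).trans hND))).2
    have h4 : ((N/10 : ℕ):ℝ) ≤ (N:ℝ)/10 := by
      have := @Nat.cast_div_le ℝ _ _ _ N 10
      simpa using this
    have h5 : ((N/10 : ℕ):ℝ) * (L+E) ≤ (N:ℝ)/10 * (L+E) := mul_le_mul_of_nonneg_right h4 (by linarith)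
    linarith
  have hsplit : (∑ n ∈ Finset.Ioc (N/10) N, rho k n) = PP k N - PP k (N/10) := by
    unfold PP
    rw [← Finset.sum_Ioc_consecutive (fun n => rho k n) (Nat.zero_le (N/10)) (Nat.div_le_self N 10)]
    ring
  have hN := (abs_le.1 (hR N (by simpa using hlo 1 le_rfl (by omega)) hND)).1
  have hRP : (RR D N : ℝ) ≤ ∑ d ∈ Finset.Ioc 0 N, (PP k (N / d^2) : ℝ) := by
    exact_mod_cast RR_le_PP D k hk hsq N
  rw [← Finset.sum_Ioc_consecutive _ (Nat.zero_le 1) (by omega : 1 ≤ N),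
    ← Finset.sum_Ioc_consecutive _ (by omega : 1 ≤ Y) hYN] at hRP
  have s0 : ∑ d ∈ Finset.Ioc 0 1, (PP k (N / d^2) : ℝ) = PP k N := by simp
  have hdiv : ∀ d : ℕ, ((N / d^2 : ℕ):ℝ) ≤ (N:ℝ) * ((d:ℝ)^2)⁻¹ := by
    intro d
    have := @Nat.cast_div_le ℝ _ _ _ N (d^2)
    rw [← div_eq_mul_inv]
    simpa using this
  have s1 : ∑ d ∈ Finset.Ioc 1 Y, (PP k (N / d^2) : ℝ) ≤ (N:ℝ) * (L+E) * (3/4) := by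
    have h1 : ∀ d ∈ Finset.Ioc 1 Y, (PP k (N / d^2) : ℝ) ≤ (N:ℝ) * (L+E) * ((d:ℝ)^2)⁻¹ := by
      intro d hd
      rw [Finset.mem_Ioc] at hd
      have h1 : (PP k (N/d^2) : ℝ) ≤ (RR D (N/d^2) : ℝ) := by exact_mod_cast PP_le_RR D k hk hsq _
      have h3 := (abs_le.1 (hR (N/d^2) (hlo d (by omega) hd.2) ((Nat.div_le_self _ _).trans hND))).2
      have h5 := mul_le_mul_of_nonneg_right (hdiv d) (by linarith : 0 ≤ L + E)
      linarith
    refine (Finset.sum_le_sum h1).trans ?_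
    rw [← Finset.mul_sum]
    refine mul_le_mul_of_nonneg_left ?_ (by positivity)
    rw [← Finset.sum_Ioc_consecutive _ (by norm_num : 1 ≤ 2) (by omega : 2 ≤ Y)]
    have h2 := sum_Ioc_inv_sq_le_sub (α := ℝ) (k := 2) (n := Y) (by norm_num) (by omega)
    have h3 : (0:ℝ) ≤ (Y:ℝ)⁻¹ := by positivity
    have h4 : ∑ d ∈ Finset.Ioc (1:ℕ) 2, ((d:ℝ)^2)⁻¹ = 1/4 := by
      rw [show Finset.Ioc (1:ℕ) 2 = {2} by rfl]; norm_num
    rw [h4]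
    norm_num at h2 ⊢
    linarith
  have s2 : ∑ d ∈ Finset.Ioc Y N, (PP k (N / d^2) : ℝ) ≤ (N:ℝ) * (1 + Real.log D) * (Y:ℝ)⁻¹ := by
    have h1 : ∀ d ∈ Finset.Ioc Y N, (PP k (N / d^2) : ℝ) ≤ (N:ℝ) * (1 + Real.log D) * ((d:ℝ)^2)⁻¹ := by
      intro d hd
      rcases Nat.eq_zero_or_pos (N/d^2) with h0 | h0
      · rw [h0]
        simp only [PP, Finset.Ioc_self, Finset.sum_empty, Int.cast_zero]
        positivity
      have h1 : (PP k (N/d^2) : ℝ) ≤ (RR D (N/d^2) : ℝ) := by exact_mod_cast PP_le_RR D k hk hsq _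
      have h2 := RR_triv D (N/d^2) h0
      have h3 : Real.log ((N/d^2 : ℕ):ℝ) ≤ Real.log D := by
        refine Real.log_le_log (by exact_mod_cast h0) ?_
        exact_mod_cast (Nat.div_le_self _ _).trans hND
      have h4 : ((N/d^2 : ℕ):ℝ) * (1 + Real.log ((N/d^2 : ℕ):ℝ)) ≤ ((N/d^2 : ℕ):ℝ) * (1 + Real.log D) :=
        mul_le_mul_of_nonneg_left (by linarith) (by positivity)
      have h5 := mul_le_mul_of_nonneg_right (hdiv d) (by linarith : 0 ≤ 1 + Real.log D)
      linarith
    refine (Finset.sum_le_sum h1).trans ?_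
    rw [← Finset.mul_sum]
    refine mul_le_mul_of_nonneg_left ?_ (by positivity)
    have h2 := sum_Ioc_inv_sq_le_sub (α := ℝ) (k := Y) (n := N) (by omega) hYN
    have h3 : (0:ℝ) ≤ (N:ℝ)⁻¹ := by positivity
    linarith
  rw [hsplit, Int.cast_sub]
  rw [s0] at hRP
  have hNE : 0 ≤ (N:ℝ) * E := by positivity
  have hNL : 0 ≤ (N:ℝ) * L := by positivity
  nlinarith

end HB

namespace HB
open Filter
set_option maxHeartbeats 1000000 in
theorem main_thm :
    ∀ η : ℝ, 4 / 9 < η → η ≤ 1 / 2 →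
      ∃ c₁ c₂ c₃ : ℝ, ∃ D₀ : ℕ, 0 < c₁ ∧ 0 < c₂ ∧ 0 < c₃ ∧
        ∀ D : ℕ, D₀ < D → Squarefree D → D % 4 = 3 →
          c₃ * (classNumber D : ℝ) / (D : ℝ) ^ ((1 : ℝ) / 2 - η) ≤
            (Nat.card {p : ℤ × ℤ //
                c₁ * (D : ℝ) ^ η ≤ (p.1 : ℝ) ∧ (p.1 : ℝ) ≤ c₂ * (D : ℝ) ^ η ∧
                  |p.2| ≤ p.1 ∧ (4 * p.1) ∣ (p.2 ^ 2 + (D : ℤ))} : ℝ) := by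
  intro η hη1 hη2
  obtain ⟨η', hη'⟩ : ∃ x, x = (η + 4/9)/2 := ⟨_, rfl⟩
  obtain ⟨κ, hκ⟩ : ∃ x, x = (η - η')/4 := ⟨_, rfl⟩
  have hκ0 : 0 < κ := by rw [hκ, hη']; linarith
  obtain ⟨δ, hδ, D1, hR⟩ := R_asymp η' (by rw [hη']; linarith)
  obtain ⟨ε, hε0, hεδ, hεκ⟩ : ∃ ε, 0 < ε ∧ ε < δ ∧ ε < κ :=
    ⟨min δ κ / 2, by have := lt_min hδ hκ0; linarith,
      by have := min_le_left δ κ; linarith, by have := min_le_right δ κ; linarith⟩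
  obtain ⟨c, hc, D2, hS⟩ := siegel ε hε0
  have ev1 := ev_const (5:ℝ) hκ0
  have ev2 := ev_const (1000/c) (sub_pos.2 hεδ)
  have ev3 := ev_log (100/c) (by positivity) (sub_pos.2 hεκ)
  obtain ⟨D3, hD3⟩ := eventually_atTop.1 ((ev1.and ev2).and ev3)
  refine ⟨1/10, 1, 1/40, max (max D1 D2) (max D3 1), by norm_num, by norm_num, by norm_num, ?_⟩
  intro D hD hsq hD4
  have hD1 : D1 < D := lt_of_le_of_lt ((le_max_left _ _).trans (le_max_left _ _)) hD
  have hD2 : D2 < D := lt_of_le_of_lt ((le_max_right _ _).trans (le_max_left _ _)) hD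
  have hD3' : D3 ≤ D := (lt_of_le_of_lt ((le_max_left _ _).trans (le_max_right _ _)) hD).le
  have hD0 : 1 < D := lt_of_le_of_lt ((le_max_right _ _).trans (le_max_right _ _)) hD
  have : NeZero D := ⟨by omega⟩
  obtain ⟨⟨e1, e2⟩, e3⟩ := hD3 D hD3'
  have hDp : (0:ℝ) < D := by exact_mod_cast (by omega : 0 < D)
  have hDge1 : (1:ℝ) ≤ D := by exact_mod_cast hD0.le
  have hLs := hS D hD2 hsq (by omega)
  have hRR := hR D hD1 hsq (by omega)
  set L := (DirichletCharacter.LFunction (chiD D) 1).re with hLdef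
  have hL0 : 0 < L := lt_of_lt_of_le (by positivity) hLs
  obtain ⟨k, hk⟩ : ∃ k : ℤ, (D:ℤ) + 1 = 4 * k := ⟨((D:ℤ)+1)/4, by omega⟩
  obtain ⟨E, hE⟩ : ∃ E, E = 8 * (D:ℝ)^(-δ) := ⟨_, rfl⟩
  have hE0 : 0 < E := by rw [hE]; positivity
  have hR' : ∀ M : ℕ, (D:ℝ)^η' ≤ (M:ℝ) → M ≤ D → |(RR D M : ℝ) - M * L| ≤ M * E := by
    intro M h1 h2
    have := hRR M h1 h2
    rw [hE]; linarith
  -- E small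
  have hEL : E ≤ L / 100 := by
    have h1 : (D:ℝ)^(-δ) * (1000/c) ≤ (D:ℝ)^(-ε) := by
      calc (D:ℝ)^(-δ) * (1000/c) ≤ (D:ℝ)^(-δ) * (D:ℝ)^(δ-ε) := mul_le_mul_of_nonneg_left e2 (by positivity)
        _ = (D:ℝ)^(-ε) := by rw [← Real.rpow_add hDp]; congr 1; ring
    have h2 : c * ((D:ℝ)^(-δ) * (1000/c)) ≤ L := (mul_le_mul_of_nonneg_left h1 hc.le).trans hLs
    have h3 : c * ((D:ℝ)^(-δ) * (1000/c)) = 1000 * (D:ℝ)^(-δ) := by field_simp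
    rw [hE]; rw [h3] at h2
    have : 0 < (D:ℝ)^(-δ) := by positivity
    linarith
  obtain ⟨Y, hYdef⟩ : ∃ Y, Y = ⌊(D:ℝ)^κ⌋₊ := ⟨_, rfl⟩
  have hYle : (Y:ℝ) ≤ (D:ℝ)^κ := by rw [hYdef]; exact Nat.floor_le (by positivity)
  have hYlt : (D:ℝ)^κ < Y + 1 := by rw [hYdef]; exact Nat.lt_floor_add_one _
  have hY4 : 4 ≤ Y := by
    have : (4:ℝ) < Y + 1 := by linarith
    have : 4 < Y + 1 := by exact_mod_cast this
    omega
  have hYhalf : (D:ℝ)^κ / 2 ≤ Y := by linarith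
  have hYpos : (0:ℝ) < Y := by exact_mod_cast (by omega : 0 < Y)
  have hYL : (1 + Real.log D) * (Y:ℝ)⁻¹ ≤ L / 50 := by
    have hlog : 0 ≤ Real.log D := Real.log_natCast_nonneg D
    rw [← div_eq_mul_inv, div_le_iff₀ hYpos]
    have h1 : c * (D:ℝ)^(-ε) * ((D:ℝ)^κ/2) ≤ L * Y := mul_le_mul hLs hYhalf (by positivity) hL0.le
    have h2 : (D:ℝ)^(-ε) * (D:ℝ)^κ = (D:ℝ)^(κ-ε) := by
      rw [← Real.rpow_add hDp]; congr 1; ring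
    have h3 : c * (100/c * (1 + Real.log D)) ≤ c * (D:ℝ)^(κ-ε) := mul_le_mul_of_nonneg_left e3 hc.le
    have h4 : c * (100/c * (1 + Real.log D)) = 100 * (1 + Real.log D) := by field_simp
    have h5 : c * (D:ℝ)^(-ε) * ((D:ℝ)^κ/2) = c * (D:ℝ)^(κ-ε) / 2 := by rw [← h2]; ring
    rw [h4] at h3
    rw [h5] at h1
    linarith
  obtain ⟨X, hX⟩ : ∃ X, X = (D:ℝ)^η := ⟨_, rfl⟩
  have hX1 : 1 ≤ X := by rw [hX]; exact Real.one_le_rpow hDge1 (by linarith)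
  obtain ⟨N, hNdef⟩ : ∃ N, N = ⌊X⌋₊ := ⟨_, rfl⟩
  have hNle : (N:ℝ) ≤ X := by rw [hNdef]; exact Nat.floor_le (by linarith)
  have hNlt : X < N + 1 := by rw [hNdef]; exact Nat.lt_floor_add_one _
  have hXsq : X ≤ (D:ℝ)^((1:ℝ)/2) := by rw [hX]; exact Real.rpow_le_rpow_of_exponent_le hDge1 hη2
  have hhalf : (D:ℝ)^((1:ℝ)/2) * (D:ℝ)^((1:ℝ)/2) = D := by
    rw [← Real.rpow_add hDp]; norm_num
  have hNsq : N * N ≤ D := by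
    have h0 : (0:ℝ) ≤ N := by positivity
    have : (N:ℝ) * N ≤ D := by rw [← hhalf]; exact mul_le_mul (hNle.trans hXsq) (hNle.trans hXsq) h0 (by positivity)
    exact_mod_cast this
  have hNS : N ≤ Nat.sqrt D := Nat.le_sqrt.2 hNsq
  have hSD : Nat.sqrt D ≤ D := Nat.sqrt_le_self D
  have hlo : ∀ d : ℕ, 1 ≤ d → d ≤ Y → (D:ℝ)^η' ≤ ((N / d^2 : ℕ):ℝ) := by
    intro d hd1 hdY
    have hd1' : (1:ℝ) ≤ d := by exact_mod_cast hd1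
    have hdκ : (d:ℝ) ≤ (D:ℝ)^κ := le_trans (by exact_mod_cast hdY) hYle
    have hd2 : (d:ℝ)^2 ≤ (D:ℝ)^κ * (D:ℝ)^κ := by rw [pow_two]; exact mul_le_mul hdκ hdκ (by linarith) (by positivity)
    have hlow1 : 1 ≤ (D:ℝ)^η' := Real.one_le_rpow hDge1 (by rw [hη']; linarith)
    have hXe : X = (D:ℝ)^η' * ((D:ℝ)^κ * (D:ℝ)^κ) * ((D:ℝ)^κ * (D:ℝ)^κ) := by
      rw [hX, ← Real.rpow_add hDp, ← Real.rpow_add hDp, ← Real.rpow_add hDp]; congr 1; rw [hκ]; ring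
    have hK : 25 ≤ (D:ℝ)^κ * (D:ℝ)^κ := by
      have := mul_le_mul e1 e1 (by norm_num) (by positivity)
      linarith
    have hlt : N < d^2 * (N/d^2 + 1) := by
      have := Nat.lt_mul_div_succ N (by positivity : 0 < d^2)
      simpa using this
    have hlt' : (N:ℝ) < (d:ℝ)^2 * (((N/d^2 : ℕ):ℝ) + 1) := by exact_mod_cast hlt
    by_contra hcon
    push Not at hcon
    set q := ((N/d^2 : ℕ):ℝ)
    set K := (D:ℝ)^κ * (D:ℝ)^κ
    set lo := (D:ℝ)^η'
    have hq : 0 ≤ q := by positivity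
    have h1 : (d:ℝ)^2 * (q+1) ≤ K * (q+1) := mul_le_mul_of_nonneg_right hd2 (by linarith)
    have h2 : K * (q + 1) ≤ K * (lo + 1) := mul_le_mul_of_nonneg_left (by linarith) (by linarith)
    have h3 : lo * K * K ≤ K * (lo+1) + 1 := by rw [← hXe]; linarith
    have h4 : lo * K * 25 ≤ lo * K * K := mul_le_mul_of_nonneg_left hK (by positivity)
    have h5 : K ≤ lo * K := le_mul_of_one_le_left (by linarith) hlow1
    linarith
  have hlo0 : 0 < (D:ℝ)^η' := by positivity
  have hcore := core_lower D k hk hsq L E _ N Y hL0.le hE0.le hlo0 (hNS.trans hSD) hY4 hlo hR'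
  have hcount := count_ge D k hk X (1/10) (N/10) N
    (by
      intro a ha
      have h1 : N + 1 ≤ 10 * a := by omega
      have h2 : (N:ℝ) + 1 ≤ 10 * a := by exact_mod_cast h1
      linarith)
    (by
      intro a ha
      have : (a:ℝ) ≤ N := by exact_mod_cast ha
      linarith)
  rw [hX] at hcount
  have hcount' : ((∑ n ∈ Finset.Ioc (N/10) N, rho k n : ℤ):ℝ) ≤ (Nat.card {p : ℤ × ℤ //
                1/10 * (D : ℝ) ^ η ≤ (p.1 : ℝ) ∧ (p.1 : ℝ) ≤ 1 * (D : ℝ) ^ η ∧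
                  |p.2| ≤ p.1 ∧ (4 * p.1) ∣ (p.2 ^ 2 + (D : ℤ))} : ℝ) := by
    exact_mod_cast hcount
  refine le_trans ?_ hcount'
  refine le_trans ?_ hcore
  have hN1 : (1:ℝ) ≤ N := by
    have : 1 ≤ N := by rw [hNdef]; exact Nat.le_floor (by simpa using hX1)
    exact_mod_cast this
  have hlow : X * L / 20 ≤ (N:ℝ) * (3/20 * L - 2 * E - (1 + Real.log D) * (Y:ℝ)⁻¹) := by
    have h1 : L / 10 ≤ 3/20 * L - 2 * E - (1 + Real.log D) * (Y:ℝ)⁻¹ := by linarith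
    have h2 : (N:ℝ) * (L/10) ≤ _ := mul_le_mul_of_nonneg_left h1 (by positivity : (0:ℝ) ≤ N)
    have h3 : X/2 ≤ N := by linarith
    have h4 : X/2 * (L/10) ≤ N * (L/10) := mul_le_mul_of_nonneg_right h3 (by positivity)
    linarith
  refine le_trans ?_ hlow
  -- class number upper bound
  have hcl : (classNumber D : ℝ) ≤ (D:ℝ)^((1:ℝ)/2) * (2 * L) := by
    have h1 : (classNumber D : ℤ) ≤ RR D (Nat.sqrt D) := (class_le D k hk).trans (PP_le_RR D k hk hsq _)
    have h2 : (classNumber D : ℝ) ≤ (RR D (Nat.sqrt D) : ℝ) := by exact_mod_cast h1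
    have h3 : (D:ℝ)^η' ≤ ((Nat.sqrt D : ℕ):ℝ) := by
      have := hlo 1 le_rfl (by omega)
      simp only [one_pow, Nat.div_one] at this
      exact this.trans (by exact_mod_cast hNS)
    have h4 := (abs_le.1 (hR' _ h3 hSD)).2
    have h5 : ((Nat.sqrt D : ℕ):ℝ) ≤ (D:ℝ)^((1:ℝ)/2) := by
      rw [← Real.sqrt_eq_rpow]; exact Real.nat_sqrt_le_real_sqrt
    have h6 : ((Nat.sqrt D : ℕ):ℝ) * (L + E) ≤ (D:ℝ)^((1:ℝ)/2) * (2*L) :=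
      mul_le_mul h5 (by linarith) (by positivity) (by positivity)
    linarith
  rw [div_le_iff₀ (by positivity)]
  have hXX : X * (D:ℝ)^((1:ℝ)/2 - η) = (D:ℝ)^((1:ℝ)/2) := by
    rw [hX, ← Real.rpow_add hDp]; congr 1; ring
  have : X * L / 20 * (D:ℝ)^((1:ℝ)/2 - η) = (D:ℝ)^((1:ℝ)/2) * L / 20 := by rw [← hXX]; ring
  rw [this]
  linarith

end HB


/-- **Proposition 1.2 (1)**: for every `4/9 < η ≤ 1/2` there are positive constants
`c₁, c₂, c₃` and a (possibly ineffective) `D₀` such that for every squarefree `D > D₀`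
with `D ≡ 3 (mod 4)`, the number of integer pairs `(a, b)` with `c₁ D^η ≤ a ≤ c₂ D^η`,
`|b| ≤ a`, and `b² ≡ -D (mod 4a)` is at least `c₃ h(-D) / D^{1/2-η}`. -/
theorem heegner_congruence_solutions_a_small :
    ∀ η : ℝ, 4 / 9 < η → η ≤ 1 / 2 →
      ∃ c₁ c₂ c₃ : ℝ, ∃ D₀ : ℕ, 0 < c₁ ∧ 0 < c₂ ∧ 0 < c₃ ∧
        ∀ D : ℕ, D₀ < D → Squarefree D → D % 4 = 3 →
          c₃ * (classNumber D : ℝ) / (D : ℝ) ^ ((1 : ℝ) / 2 - η) ≤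
            (Nat.card {p : ℤ × ℤ //
                c₁ * (D : ℝ) ^ η ≤ (p.1 : ℝ) ∧ (p.1 : ℝ) ≤ c₂ * (D : ℝ) ^ η ∧
                  |p.2| ≤ p.1 ∧ (4 * p.1) ∣ (p.2 ^ 2 + (D : ℤ))} : ℝ) := by
  exact HB.main_thm
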